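/- Let K₁, …, Kₙ be simple polygons in the plane with aco Kᵢ > −π for every i. Then the Minkowski sum K₁ + K₂ + ⋯ + Kₙ is a simple polygon, and aco(K₁ + ⋯ + Kₙ) ≥ min_i aco Kᵢ. -/

import Mathlib

open Real Set Pointwise

noncomputable section

/-- The signed angle from `v` to `w`, in `(-π, π]`; for nonzero non-opposite
vectors it lies in `(-π, π)` and its sign is the sign of the skew product. -/
def vangle (v w : ℝ × ℝ) : ℝ :=
  Complex.arg ((w.1 + w.2 * Complex.I) / (v.1 + v.2 * Complex.I))

/-- `w` is opposite to `v` : `w = a • v` with `a < 0`. -/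
def Opp (v w : ℝ × ℝ) : Prop := ∃ a : ℝ, a < 0 ∧ w = a • v

/-- A shift sequence is non-reverse if no two consecutive shifts are opposite. -/
def NonReverse (s : List (ℝ × ℝ)) : Prop := List.Chain' (fun v w => ¬ Opp v w) s

/-- The rotation of a polyline with the given shift sequence:
the sum of the signed angles between consecutive shifts. -/
def rotShifts : List (ℝ × ℝ) → ℝ
  | v :: w :: rest => vangle v w + rotShifts (w :: rest)
  | _ => 0

/-- The angular convexity of a polyline with shift sequence `s` :
the minimum of the rotations of its contiguous subpolylines. -/
def acoShifts (s : List (ℝ × ℝ)) : ℝ :=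
  sInf (rotShifts '' { t : List (ℝ × ℝ) | t <:+: s })

/-- The (cyclic) rotation of a closed polyline with shift sequence `s`. -/
def rotClosed (s : List (ℝ × ℝ)) : ℝ := rotShifts (s ++ s.take 1)

/-- The angular convexity of a closed polyline with shift sequence `s` :
the minimum of the rotations over all (possibly wrapping) contiguous
subpolylines traversing the cycle at most once, oriented along it. -/
def acoClosed (s : List (ℝ × ℝ)) : ℝ :=
  sInf (rotShifts '' { t : List (ℝ × ℝ) | t.length ≤ s.length ∧ t <:+: (s ++ s) })

/-- A polyline, given by its first vertex and its shift sequence. -/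
structure Polyline where
  start : ℝ × ℝ
  shifts : List (ℝ × ℝ)

namespace Polyline

/-- A genuine polyline: at least one edge and consecutive vertices distinct. -/
def Proper (P : Polyline) : Prop := P.shifts ≠ [] ∧ ∀ v ∈ P.shifts, v ≠ 0

/-- The `i`-th vertex (`0`-indexed). -/
def vert (P : Polyline) (i : ℕ) : ℝ × ℝ := P.start + (P.shifts.take i).sum

/-- The natural piecewise-linear parameterization of `P` on `[0, number of edges]`. -/
def param (P : Polyline) (t : ℝ) : ℝ × ℝ :=
  P.vert ⌊t⌋.toNat + Int.fract t • P.shifts.getD ⌊t⌋.toNat 0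

/-- The polyline as a subset of the plane. -/
def trace (P : Polyline) : Set (ℝ × ℝ) := P.param '' Set.Icc 0 (P.shifts.length : ℝ)

/-- A closed polyline: the last vertex equals the first one. -/
def Closed (P : Polyline) : Prop := P.shifts.sum = 0

/-- A simple (open) polyline: edges may intersect only at a common vertex of
consecutive edges, i.e. the natural parameterization is injective. -/
def Simple (P : Polyline) : Prop := Set.InjOn P.param (Set.Icc 0 (P.shifts.length : ℝ))

/-- A simple closed polyline: closed and injective except for first = last point. -/
def SimpleClosed (P : Polyline) : Prop :=
  P.Closed ∧ Set.InjOn P.param (Set.Ico 0 (P.shifts.length : ℝ))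

/-- The `i`-th edge as a segment in the plane. -/
def edge (P : Polyline) (i : ℕ) : Set (ℝ × ℝ) := segment ℝ (P.vert i) (P.vert (i + 1))

/-- A polyline is in general position if all vertices are distinct, two edges meet
in at most one point which is either the common vertex of consecutive edges or lies
in the relative interiors of both, and no three edges have a common point. -/
def GeneralPosition (P : Polyline) : Prop :=
  (∀ i j, i < j → j ≤ P.shifts.length → P.vert i ≠ P.vert j) ∧
  (∀ i j, i < j → j < P.shifts.length →
    (P.edge i ∩ P.edge j).Subsingleton ∧
    ∀ x ∈ P.edge i ∩ P.edge j,
      (j = i + 1 ∧ x = P.vert j) ∨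
      (x ∈ openSegment ℝ (P.vert i) (P.vert (i + 1)) ∧
        x ∈ openSegment ℝ (P.vert j) (P.vert (j + 1)))) ∧
  ∀ i j k, i < j → j < k → k < P.shifts.length →
    P.edge i ∩ P.edge j ∩ P.edge k = ∅

end Polyline

/-- `P` is the (anticlockwise-oriented) closed simple boundary polyline of the
simple polygon `K`. -/
structure IsSimplePolygon (K : Set (ℝ × ℝ)) (P : Polyline) : Prop where
  compact : IsCompact K
  regular : K = closure (interior K)
  proper : P.Proper
  nonReverse : NonReverse (P.shifts ++ P.shifts.take 1)
  simpleClosed : P.SimpleClosed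
  boundary : frontier K = P.trace
  orient : rotClosed P.shifts = 2 * π

/-- The ray with apex `x` and direction `d`. -/
def ray (x d : ℝ × ℝ) : Set (ℝ × ℝ) := {y | ∃ t : ℝ, 0 ≤ t ∧ y = x + t • d}

/-- The angular region with apex `x` spanned by the directions `u` and `v` :
the convex hull of the two rays. Its angular measure is `|vangle u v|`. -/
def angularRegion (x u v : ℝ × ℝ) : Set (ℝ × ℝ) :=
  convexHull ℝ (ray x u ∪ ray x v)

/-- The merge of two shift sequences used in the sorted sum: repeatedly take the
head of the remaining sequence with the larger rotation (preferring the first). -/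
def sortedMerge : List (ℝ × ℝ) → List (ℝ × ℝ) → List (ℝ × ℝ)
  | [], t => t
  | s, [] => s
  | a :: s, b :: t =>
    if rotShifts (b :: t) ≤ rotShifts (a :: s) then a :: sortedMerge s (b :: t)
    else b :: sortedMerge (a :: s) t
termination_by s t => s.length + t.length

/-- The hypotheses of the sorted sum: both polylines are proper and non-reverse,
their first shifts have the same direction, and their rotations are equal. -/
def SortedSumHyp (P Q : Polyline) : Prop :=
  P.Proper ∧ Q.Proper ∧ NonReverse P.shifts ∧ NonReverse Q.shifts ∧
  vangle P.shifts.headI Q.shifts.headI = 0 ∧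
  rotShifts P.shifts = rotShifts Q.shifts

/-- The sorted sum `P +ₛ Q` : starts at the sum of the first vertices and has the
merged shift sequence. -/
def sortedSum (P Q : Polyline) : Polyline :=
  ⟨P.start + Q.start, sortedMerge P.shifts Q.shifts⟩


namespace MS

/-- unit vector -/
def e (θ : ℝ) : ℂ := Complex.exp (θ * Complex.I)

/-- skew product -/
def cr (a b : ℂ) : ℝ := a.re * b.im - a.im * b.re

/-- `θ` is an argument of `w`. -/
def IsArg (w : ℂ) (θ : ℝ) : Prop := w = ‖w‖ * e θ

lemma e_re (θ : ℝ) : (e θ).re = cos θ := by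
  simp [e, Complex.exp_ofReal_mul_I_re]
lemma e_im (θ : ℝ) : (e θ).im = sin θ := by
  simp [e, Complex.exp_ofReal_mul_I_im]
lemma e_add (a b : ℝ) : e (a + b) = e a * e b := by
  simp [e, add_mul, Complex.exp_add]
lemma e_zero : e 0 = 1 := by simp [e]
lemma e_neg (a : ℝ) : e (-a) = (e a)⁻¹ := by simp [e, Complex.exp_neg]
lemma e_sub (a b : ℝ) : e (a - b) = e a / e b := by
  simp [e, sub_mul, Complex.exp_sub]
lemma e_ne (a : ℝ) : e a ≠ 0 := Complex.exp_ne_zero _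
lemma norm_e (a : ℝ) : ‖e a‖ = 1 := by simp [e, Complex.norm_exp_ofReal_mul_I]
lemma e_pi : e π = -1 := by simp [e]
lemma e_add_pi (a : ℝ) : e (a + π) = - e a := by rw [e_add, e_pi]; ring
lemma e_int (m : ℤ) : e (2 * π * m) = 1 := by
  rw [e, Complex.exp_eq_one_iff]; exact ⟨m, by push_cast; ring⟩
lemma e_add_int (a : ℝ) (m : ℤ) : e (a + 2 * π * m) = e a := by
  rw [e_add, e_int, mul_one]
lemma e_eq_iff {a b : ℝ} : e a = e b ↔ ∃ m : ℤ, a = b + 2 * π * m := by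
  constructor
  · intro h
    rw [e, e, Complex.exp_eq_exp_iff_exists_int] at h
    obtain ⟨m, hm⟩ := h
    refine ⟨m, ?_⟩
    have := congrArg Complex.im hm
    simpa [mul_comm, mul_assoc, mul_left_comm] using this
  · rintro ⟨m, rfl⟩; exact e_add_int _ _
@[fun_prop] lemma continuous_e : Continuous e := by unfold e; fun_prop

lemma e_eq_neg_one {c : ℝ} (h : e c = -1) : ∃ m : ℤ, c = π + 2 * π * m := by
  rw [← e_pi, e_eq_iff] at h; exact h

lemma cr_smul_e (r s a b : ℝ) : cr (r * e a) (s * e b) = r * s * sin (b - a) := by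
  simp [cr, e_re, e_im, sin_sub]; ring
lemma cr_add_right (a b c : ℂ) : cr a (b + c) = cr a b + cr a c := by simp [cr]; ring
lemma cr_add_left (a b c : ℂ) : cr (a + b) c = cr a c + cr b c := by simp [cr]; ring
lemma cr_sub_right (a b c : ℂ) : cr a (b - c) = cr a b - cr a c := by simp [cr]; ring
lemma cr_self (a : ℂ) : cr a a = 0 := by simp [cr]; ring
lemma cr_smul_right (a b : ℂ) (r : ℝ) : cr a (r * b) = r * cr a b := by simp [cr]; ring
lemma cr_smul_left (a b : ℂ) (r : ℝ) : cr (r * a) b = r * cr a b := by simp [cr]; ring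
lemma cr_neg_right (a b : ℂ) : cr a (-b) = - cr a b := by simp [cr]; ring
@[fun_prop] lemma continuous_cr (a : ℂ) : Continuous (cr a) := by
  unfold cr; fun_prop

lemma isArg_arg (w : ℂ) : IsArg w (Complex.arg w) := by
  rw [IsArg, e, Complex.norm_mul_exp_arg_mul_I]

lemma exists_arg_Ico (w : ℂ) (a : ℝ) : ∃ θ ∈ Ico a (a + 2 * π), IsArg w θ := by
  refine ⟨toIcoMod two_pi_pos a (Complex.arg w), toIcoMod_mem_Ico _ _ _, ?_⟩
  have h := isArg_arg w
  unfold IsArg at *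
  rw [← self_sub_toIcoDiv_zsmul, e_sub]
  have : e (toIcoDiv two_pi_pos a (Complex.arg w) • (2 * π)) = 1 := by
    rw [← e_int (toIcoDiv two_pi_pos a (Complex.arg w))]; congr 1; simp; ring
  rw [this, div_one]; exact h

lemma isArg_smul_e {r : ℝ} (hr : 0 ≤ r) (θ : ℝ) : IsArg (r * e θ) θ := by
  simp [IsArg, norm_e, abs_of_nonneg hr]

lemma IsArg.unit {w : ℂ} {θ : ℝ} (h : IsArg w θ) (hw : w ≠ 0) : e θ = w / ‖w‖ := by
  have : (‖w‖ : ℂ) ≠ 0 := by simpa using hw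
  rw [eq_div_iff this, mul_comm]; exact h.symm

lemma IsArg.unique {w : ℂ} {a b : ℝ} (hw : w ≠ 0) (ha : IsArg w a) (hb : IsArg w b) :
    ∃ m : ℤ, a = b + 2 * π * m := by
  rw [← e_eq_iff, ha.unit hw, hb.unit hw]

lemma IsArg.add_int {w : ℂ} {a : ℝ} (h : IsArg w a) (m : ℤ) : IsArg w (a + 2 * π * m) := by
  rw [IsArg, e_add_int]; exact h

lemma IsArg.of_e {w : ℂ} {a b : ℝ} (h : IsArg w a) (hab : e a = e b) : IsArg w b := by
  rw [IsArg, ← hab]; exact h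

lemma IsArg.neg {w : ℂ} {a : ℝ} (h : IsArg w a) : IsArg (-w) (a + π) := by
  rw [IsArg, e_add_pi, norm_neg, mul_neg, neg_inj]; exact h

lemma IsArg.smul {w : ℂ} {a r : ℝ} (h : IsArg w a) (hr : 0 ≤ r) : IsArg (r * w) a := by
  rw [h, ← mul_assoc, ← Complex.ofReal_mul]; exact isArg_smul_e (by positivity) a

lemma IsArg.div {w z : ℂ} {a b : ℝ} (h : IsArg w a) (hz : IsArg z b) : IsArg (w / z) (a - b) := by
  rw [IsArg, e_sub, norm_div, Complex.ofReal_div, div_mul_div_comm, ← h, ← hz]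

lemma IsArg.mul {w z : ℂ} {a b : ℝ} (h : IsArg w a) (hz : IsArg z b) : IsArg (w * z) (a + b) := by
  rw [IsArg, e_add, norm_mul, Complex.ofReal_mul, mul_mul_mul_comm, ← h, ← hz]

lemma IsArg.cr_eq {w z : ℂ} {a b : ℝ} (h : IsArg w a) (hz : IsArg z b) :
    cr w z = ‖w‖ * ‖z‖ * sin (b - a) := by
  conv_lhs => rw [h, hz, cr_smul_e]

/-- if `θ` is an argument in `(-π, π]`, it is `arg`. -/
lemma IsArg.eq_arg {w : ℂ} {θ : ℝ} (h : IsArg w θ) (hw : w ≠ 0) (h1 : -π < θ) (h2 : θ ≤ π) :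
    Complex.arg w = θ := by
  rw [h, e, Complex.exp_mul_I]
  exact Complex.arg_mul_cos_add_sin_mul_I (norm_pos_iff.2 hw) ⟨h1, h2⟩

lemma slit_of_isArg {w : ℂ} {θ : ℝ} (h : IsArg w θ) (hw : w ≠ 0) (h1 : |θ| < π) :
    w ∈ Complex.slitPlane := by
  rw [abs_lt] at h1
  rw [Complex.mem_slitPlane_iff_arg, h.eq_arg hw h1.1 h1.2.le]
  exact ⟨h1.2.ne, hw⟩

/-- existence of continuous arguments on open convex sets -/
lemma exists_lift {E : Type*} [NormedAddCommGroup E] [NormedSpace ℝ E] {S : Set E}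
    (hS : IsOpen S) (hc : Convex ℝ S) (hne : S.Nonempty) {f : E → ℂ} (hf : ContinuousOn f S)
    (h0 : ∀ x ∈ S, f x ≠ 0) :
    ∃ θ : E → ℝ, ContinuousOn θ S ∧ ∀ x ∈ S, IsArg (f x) (θ x) := by
  have hsc : IsSimplyConnected S := by
    have := hc.contractibleSpace hne
    exact (inferInstance : SimplyConnectedSpace S)
  obtain ⟨g, hg, hgf⟩ := Complex.exists_continuousOn_eqOn_exp_comp hsc hS hf
    (by rintro ⟨x, hx, h⟩; exact h0 x hx h)
  refine ⟨fun x => (g x).im, Complex.continuous_im.comp_continuousOn hg, fun x hx => ?_⟩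
  have := hgf hx
  simp only [Function.comp] at this
  rw [IsArg, ← this, Complex.norm_exp, e, Complex.ofReal_exp, ← Complex.exp_add,
    Complex.re_add_im]

lemma two_lifts {E : Type*} [TopologicalSpace E] {S : Set E} (hS : IsPreconnected S)
    {f g : E → ℝ} (hf : ContinuousOn f S) (hg : ContinuousOn g S) {c : ℂ}
    (h : ∀ x ∈ S, e (f x) = c * e (g x)) {x y : E} (hx : x ∈ S) (hy : y ∈ S) :
    f x - g x = f y - g y := by
  have hcont : ContinuousOn (fun x => (f x - g x)) S := hf.sub hg
  have key : ∀ x ∈ S, e (f x - g x) = c := by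
    intro x hx
    rw [e_sub, h x hx, mul_div_assoc, div_self (e_ne _), mul_one]
  have hd : ContinuousOn (fun x => (f x - g x) - (f y - g y)) S := hcont.sub continuousOn_const
  have hz : ∀ x ∈ S, ∃ m : ℤ, (f x - g x) - (f y - g y) = 2 * π * m := by
    intro x hx
    have := (key x hx).trans (key y hy).symm
    rw [e_eq_iff] at this
    obtain ⟨m, hm⟩ := this
    exact ⟨m, by rw [hm]; ring⟩
  by_contra hne
  obtain ⟨m, hm⟩ := hz x hx
  have hm0 : m ≠ 0 := by
    rintro rfl
    apply hne; simp at hm; linarith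
  have himg := hS.image _ hd
  have hI := himg.ordConnected
  have h0 : (0 : ℝ) ∈ (fun x => (f x - g x) - (f y - g y)) '' S := ⟨y, hy, by simp⟩
  have h1 : 2 * π * m ∈ (fun x => (f x - g x) - (f y - g y)) '' S := ⟨x, hx, hm⟩
  have hpi := Real.pi_pos
  rcases lt_or_gt_of_ne hm0 with hm0 | hm0
  · have : (m : ℝ) ≤ -1 := by exact_mod_cast (by omega : m ≤ -1)
    have h2 : -π ∈ (fun x => (f x - g x) - (f y - g y)) '' S := by
      refine hI.out h1 h0 ⟨by nlinarith, by linarith⟩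
    obtain ⟨z, hz', hzz⟩ := h2
    obtain ⟨k, hk⟩ := hz z hz'
    simp only at hzz
    rw [hzz] at hk
    have : (2 * k : ℝ) = -1 := by
      have : π * (2 * k + 1) = 0 := by linarith
      rcases mul_eq_zero.1 this with h | h <;> linarith
    have : 2 * k = -1 := by exact_mod_cast this
    omega
  · have : (1 : ℝ) ≤ m := by exact_mod_cast (by omega : 1 ≤ m)
    have h2 : π ∈ (fun x => (f x - g x) - (f y - g y)) '' S := by
      refine hI.out h0 h1 ⟨by linarith, by nlinarith⟩
    obtain ⟨z, hz', hzz⟩ := h2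
    obtain ⟨k, hk⟩ := hz z hz'
    simp only at hzz
    rw [hzz] at hk
    have : (2 * k : ℝ) = 1 := by
      have : π * (2 * k - 1) = 0 := by linarith
      rcases mul_eq_zero.1 this with h | h <;> linarith
    have : 2 * k = 1 := by exact_mod_cast this
    omega

/-- a continuous lift avoiding a direction stays in one window -/
lemma lift_window {E : Type*} [TopologicalSpace E] {S : Set E} (hS : IsPreconnected S)
    {f : E → ℝ} (hf : ContinuousOn f S) {δ : ℝ} (h : ∀ x ∈ S, e (f x) ≠ e δ) :
    ∃ m : ℤ, ∀ x ∈ S, f x ∈ Ioo (δ + 2 * π * m) (δ + 2 * π * m + 2 * π) := by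
  rcases S.eq_empty_or_nonempty with rfl | ⟨x0, hx0⟩
  · exact ⟨0, by simp⟩
  have hpi := Real.pi_pos
  set m := ⌊(f x0 - δ) / (2 * π)⌋ with hm
  have h1 : (m : ℝ) ≤ (f x0 - δ) / (2 * π) := Int.floor_le _
  have h2 : (f x0 - δ) / (2 * π) < m + 1 := Int.lt_floor_add_one _
  rw [le_div_iff₀ (by positivity)] at h1
  rw [div_lt_iff₀ (by positivity)] at h2
  have hI := (hS.image _ hf).ordConnected
  have hno : ∀ k : ℤ, δ + 2 * π * k ∉ f '' S := by
    rintro k ⟨x, hx, hk⟩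
    exact h x hx (by rw [hk, e_add_int])
  refine ⟨m, fun x hx => ⟨?_, ?_⟩⟩
  · by_contra hcon
    push Not at hcon
    exact hno m (hI.out ⟨x, hx, rfl⟩ ⟨x0, hx0, rfl⟩ ⟨hcon, by linarith⟩)
  · by_contra hcon
    push Not at hcon
    refine hno (m+1) (hI.out ⟨x0, hx0, rfl⟩ ⟨x, hx, rfl⟩ ⟨?_, ?_⟩)
    · push_cast; linarith
    · push_cast; linarith

/-- along a set where `f / c` is in the slit plane, the lift is given by arg -/
lemma lift_eq_arg {E : Type*} [TopologicalSpace E] {S : Set E} (hS : IsPreconnected S)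
    {f : E → ℂ} (hf : ContinuousOn f S) {θ : E → ℝ} (hθ : ContinuousOn θ S)
    (ha : ∀ x ∈ S, IsArg (f x) (θ x)) {c : ℂ} (hc : ∀ x ∈ S, f x / c ∈ Complex.slitPlane)
    {x y : E} (hx : x ∈ S) (hy : y ∈ S) :
    θ x - Complex.arg (f x / c) = θ y - Complex.arg (f y / c) := by
  have hg : ContinuousOn (fun x => Complex.arg (f x / c)) S := by
    intro x hx
    exact ContinuousAt.comp_continuousWithinAt (f := fun x => f x / c)
      (Complex.continuousAt_arg (hc x hx)) ((hf x hx).div_const c)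
  have hc0 : c ≠ 0 := by
    rintro rfl; have := hc x hx; simp at this
  refine two_lifts hS hθ hg (c := e (Complex.arg c)) (fun z hz => ?_) hx hy
  have h1 : f z ≠ 0 := by
    intro h; have := hc z hz; simp [h] at this
  have h3 := ((isArg_arg c).mul (isArg_arg (f z / c))).unit
    (by rw [mul_div_cancel₀ _ hc0]; exact h1)
  rw [mul_div_cancel₀ _ hc0, e_add] at h3
  rw [(ha z hz).unit h1, h3]

end MS

namespace MS

/-- the piecewise linear curve through the points `v k` -/
def gam (v : ℤ → ℂ) (t : ℝ) : ℂ := v ⌊t⌋ + ((Int.fract t : ℝ) : ℂ) * (v (⌊t⌋ + 1) - v ⌊t⌋)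

/-- a simple closed polygon with vertex sequence `v`, period `N`, edge angles `φ` -/
structure IsPg (N : ℤ) (v : ℤ → ℂ) (φ : ℤ → ℝ) : Prop where
  hN : 0 < N
  per : ∀ i, v (i + N) = v i
  inj : ∀ s t : ℝ, gam v s = gam v t → ∃ m : ℤ, t = s + m * N
  arg : ∀ k, IsArg (v (k + 1) - v k) (φ k)
  turn : ∀ k, |φ (k + 1) - φ k| < π

lemma gam_edge (v : ℤ → ℂ) {k : ℤ} {t : ℝ} (h1 : k ≤ t) (h2 : t ≤ k + 1) :
    gam v t = v k + ((t - k : ℝ) : ℂ) * (v (k + 1) - v k) := by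
  rcases eq_or_lt_of_le h2 with h2 | h2
  · have : t = ((k + 1 : ℤ) : ℝ) := by push_cast; exact h2
    subst this
    simp [gam]
  · have : ⌊t⌋ = k := Int.floor_eq_iff.2 ⟨h1, h2⟩
    rw [gam, this, Int.fract, this]

lemma gam_int (v : ℤ → ℂ) (k : ℤ) : gam v k = v k := by
  simp [gam]

lemma gam_per {v : ℤ → ℂ} {N : ℤ} (h : ∀ i, v (i + N) = v i) (t : ℝ) :
    gam v (t + N) = gam v t := by
  simp only [gam, Int.floor_add_intCast, Int.fract_add_intCast]
  rw [h, add_right_comm, h]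

lemma per_mul {α : Type*} {v : ℤ → α} {N : ℤ} (h : ∀ i, v (i + N) = v i) (i m : ℤ) :
    v (i + m * N) = v i := by
  induction m using Int.induction_on with
  | zero => simp
  | succ n ih => rw [← ih, ← h (i + n * N)]; congr 1; ring
  | pred n ih => rw [← ih, ← h]; congr 1; ring

lemma gam_per_mul {v : ℤ → ℂ} {N : ℤ} (h : ∀ i, v (i + N) = v i) (t : ℝ) (m : ℤ) :
    gam v (t + m * N) = gam v t := by
  have := gam_per (N := m * N) (v := v) (fun i => per_mul h i m) t
  push_cast at this
  exact this

lemma continuous_gam (v : ℤ → ℂ) : Continuous (gam v) := by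
  have hloc : LocallyFinite (fun k : ℤ => Icc (k : ℝ) (k + 1)) := by
    intro x
    refine ⟨Ioo (x - 1) (x + 1), Ioo_mem_nhds (by linarith) (by linarith), ?_⟩
    refine (Set.finite_Icc (⌊x⌋ - 3) (⌊x⌋ + 3)).subset ?_
    rintro k ⟨y, ⟨h1, h2⟩, h3, h4⟩
    have h5 := Int.floor_le x
    have h6 := Int.lt_floor_add_one x
    constructor
    · have : (⌊x⌋ - 3 : ℝ) < k + 1 := by linarith
      have : ⌊x⌋ - 3 < k + 1 := by exact_mod_cast this
      omega
    · have : (k : ℝ) < ⌊x⌋ + 3 := by linarith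
      have : k < ⌊x⌋ + 3 := by exact_mod_cast this
      omega
  refine hloc.continuous ?_ (fun k => isClosed_Icc) ?_
  · ext x
    simp only [mem_iUnion, mem_univ, iff_true]
    exact ⟨⌊x⌋, Int.floor_le x, (Int.lt_floor_add_one x).le⟩
  · intro k
    have : ContinuousOn (fun t : ℝ => v k + ((t - k : ℝ) : ℂ) * (v (k + 1) - v k))
        (Icc (k : ℝ) (k + 1)) := by fun_prop
    refine this.congr (fun t ht => ?_)
    exact gam_edge v ht.1 ht.2

lemma slit_comb {q : ℂ} (hq : q ∈ Complex.slitPlane) {a b : ℝ} (ha : 0 ≤ a) (hb : 0 ≤ b)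
    (hab : 0 < a + b) : (a : ℂ) + b * q ∈ Complex.slitPlane := by
  rw [Complex.mem_slitPlane_iff] at *
  simp only [Complex.add_re, Complex.add_im, Complex.mul_re, Complex.mul_im, Complex.ofReal_re,
    Complex.ofReal_im, zero_mul, sub_zero, add_zero, zero_add]
  rcases eq_or_lt_of_le hb with hb | hb
  · left; rw [← hb] at hab ⊢; linarith
  · rcases hq with hq | hq
    · left; positivity
    · right; exact mul_ne_zero hb.ne' hq

/-- turn lies between : argument of positive combination -/
lemma arg_comb {q : ℂ} (hq : q ∈ Complex.slitPlane) {a b : ℝ} (ha : 0 ≤ a) (hb : 0 ≤ b)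
    (hab : 0 < a + b) :
    (0 ≤ Complex.arg q → 0 ≤ Complex.arg (a + b * q) ∧ Complex.arg (a + b * q) ≤ Complex.arg q) ∧
    (Complex.arg q ≤ 0 → Complex.arg (a + b * q) ≤ 0 ∧
      Complex.arg q ≤ Complex.arg (a + b * q)) := by
  have hz := slit_comb hq ha hb hab
  set z : ℂ := a + b * q with hzdef
  have hq0 : q ≠ 0 := Complex.slitPlane_ne_zero hq
  have hz0 : z ≠ 0 := Complex.slitPlane_ne_zero hz
  have him : z.im = b * q.im := by simp [hzdef]
  have hcr : cr z q = a * q.im := by simp [cr, hzdef]; ring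
  have hA := (isArg_arg z).cr_eq (isArg_arg q)
  have hB : q.im = ‖q‖ * sin (Complex.arg q) := (Complex.norm_mul_sin_arg q).symm
  have hzn : 0 < ‖z‖ := norm_pos_iff.2 hz0
  have hqn : 0 < ‖q‖ := norm_pos_iff.2 hq0
  have hz1 := (Complex.mem_slitPlane_iff_arg.1 hz).1
  have hq1 := (Complex.mem_slitPlane_iff_arg.1 hq).1
  have hz2 := Complex.neg_pi_lt_arg z
  have hz3 := lt_of_le_of_ne (Complex.arg_le_pi z) hz1
  have hq2 := Complex.neg_pi_lt_arg q
  have hq3 := lt_of_le_of_ne (Complex.arg_le_pi q) hq1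
  constructor
  · intro h
    have hqi : 0 ≤ q.im := Complex.arg_nonneg_iff.1 h
    have hz4 : 0 ≤ Complex.arg z := Complex.arg_nonneg_iff.2 (by rw [him]; positivity)
    refine ⟨hz4, ?_⟩
    by_contra hcon
    push Not at hcon
    have hs : sin (Complex.arg q - Complex.arg z) < 0 :=
      sin_neg_of_neg_of_neg_pi_lt (by linarith) (by linarith)
    have : 0 ≤ ‖z‖ * ‖q‖ * sin (Complex.arg q - Complex.arg z) := by
      rw [← hA, hcr]; positivity
    have : ‖z‖ * ‖q‖ * sin (Complex.arg q - Complex.arg z) < 0 :=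
      mul_neg_of_pos_of_neg (by positivity) hs
    linarith
  · intro h
    have hqi : q.im ≤ 0 := by
      rw [hB]
      exact mul_nonpos_of_nonneg_of_nonpos hqn.le (sin_nonpos_of_nonpos_of_neg_pi_le h hq2.le)
    have hzi : z.im ≤ 0 := by rw [him]; exact mul_nonpos_of_nonneg_of_nonpos hb hqi
    have hz4 : Complex.arg z ≤ 0 := by
      by_contra hcon
      push Not at hcon
      have : 0 < sin (Complex.arg z) := sin_pos_of_pos_of_lt_pi hcon hz3
      have h2 := Complex.norm_mul_sin_arg z
      nlinarith
    refine ⟨hz4, ?_⟩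
    by_contra hcon
    push Not at hcon
    have hs : 0 < sin (Complex.arg q - Complex.arg z) :=
      sin_pos_of_pos_of_lt_pi (by linarith) (by linarith)
    have h1 : ‖z‖ * ‖q‖ * sin (Complex.arg q - Complex.arg z) ≤ 0 := by
      rw [← hA, hcr]; exact mul_nonpos_of_nonneg_of_nonpos ha hqi
    have : 0 < ‖z‖ * ‖q‖ * sin (Complex.arg q - Complex.arg z) := by positivity
    linarith

namespace IsPg

variable {N : ℤ} {v : ℤ → ℂ} {φ : ℤ → ℝ} (h : IsPg N v φ)
include h

lemma edge_ne (k : ℤ) : v (k + 1) - v k ≠ 0 := by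
  intro h0
  have h1 : gam v (k : ℝ) = gam v ((k : ℝ) + 1 / 2) := by
    rw [gam_edge v (k := k) (t := k) le_rfl (by linarith),
      gam_edge v (k := k) (t := (k : ℝ) + 1/2) (by linarith) (by linarith), h0]; simp
  obtain ⟨m, hm⟩ := h.inj _ _ h1
  have : (1 : ℝ) = 2 * (m * N) := by linarith
  have : (1 : ℤ) = 2 * (m * N) := by exact_mod_cast this
  omega

lemma edge_eq (k : ℤ) : v (k + 1) - v k = ‖v (k + 1) - v k‖ * e (φ k) := h.arg k

lemma edge_pos (k : ℤ) : 0 < ‖v (k + 1) - v k‖ := norm_pos_iff.2 (h.edge_ne k)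

lemma turn_eq (k : ℤ) :
    φ (k + 1) - φ k = Complex.arg ((v (k + 1 + 1) - v (k + 1)) / (v (k + 1) - v k)) := by
  have h1 := abs_lt.1 (h.turn k)
  exact (((h.arg (k + 1)).div (h.arg k)).eq_arg (div_ne_zero (h.edge_ne _) (h.edge_ne _))
    h1.1 h1.2.le).symm

lemma turn_slit (k : ℤ) :
    (v (k + 1 + 1) - v (k + 1)) / (v (k + 1) - v k) ∈ Complex.slitPlane :=
  slit_of_isArg ((h.arg (k + 1)).div (h.arg k)) (div_ne_zero (h.edge_ne _) (h.edge_ne _))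
    (h.turn k)

lemma three_le : 3 ≤ N := by
  have h0 := h.hN
  by_contra hcon
  have : N = 1 ∨ N = 2 := by omega
  rcases this with rfl | rfl
  · have := h.per 0
    exact h.edge_ne 0 (by rw [this, sub_self])
  · have h1 := h.turn_slit 0
    have h2 := h.per 0
    have h3 := h.edge_ne 0
    simp only [zero_add] at h1 h2 h3
    rw [show (1 : ℤ) + 1 = 2 by norm_num, h2, ← neg_sub (v 1) (v 0), neg_div, div_self h3] at h1
    simp [Complex.mem_slitPlane_iff] at h1
    linarith

lemma nreal : (3 : ℝ) ≤ N := by exact_mod_cast h.three_le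

lemma gam_ne {s t : ℝ} (h1 : s < t) (h2 : t < s + N) : gam v t - gam v s ≠ 0 := by
  intro h0
  obtain ⟨m, hm⟩ := h.inj s t (sub_eq_zero.1 h0).symm
  have hN := h.nreal
  have h3 : (0 : ℝ) < m := by
    by_contra hc; push Not at hc; nlinarith
  have h4 : (m : ℝ) < 1 := by
    by_contra hc; push Not at hc; nlinarith
  have h3 : 0 < m := by exact_mod_cast h3
  have h4 : m < 1 := by exact_mod_cast h4
  omega

end IsPg

/-- the strip of parameter pairs -/
def strip (N : ℤ) : Set (ℝ × ℝ) := {p | p.1 < p.2 ∧ p.2 < p.1 + N}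

lemma isOpen_strip (N : ℤ) : IsOpen (strip N) :=
  (isOpen_lt continuous_fst continuous_snd).inter
    (isOpen_lt continuous_snd (continuous_fst.add continuous_const))

lemma convex_strip (N : ℤ) : Convex ℝ (strip N) := by
  rintro ⟨a, b⟩ ⟨h1, h2⟩ ⟨c, d⟩ ⟨h3, h4⟩ x y hx hy hxy
  simp only [strip, mem_ofPred_eq, Prod.smul_mk, Prod.mk_add_mk, smul_eq_mul] at *
  rcases eq_or_lt_of_le hx with hx | hx
  · have : y = 1 := by linarith
    subst this; subst hx
    constructor <;> nlinarith
  · have hy' : y = 1 - x := by linarith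
    subst hy'
    constructor
    · nlinarith
    · nlinarith

/-- The continuous angle function of the chords of a simple closed polygon. -/
structure IsTheta (N : ℤ) (v : ℤ → ℂ) (φ : ℤ → ℝ) (Θ : ℝ × ℝ → ℝ) (c : ℝ) : Prop where
  cont : ContinuousOn Θ (strip N)
  arg : ∀ s t : ℝ, s < t → t < s + N → IsArg (gam v t - gam v s) (Θ (s, t))
  edge : ∀ (k : ℤ) (s t : ℝ), k ≤ s → s < t → t ≤ k + 1 → Θ (s, t) = φ k
  corner : ∀ (k : ℤ) (s t : ℝ), k ≤ s → s ≤ k + 1 → k + 1 ≤ t → t ≤ k + 1 + 1 → s < t →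
    Θ (s, t) ∈ uIcc (φ k) (φ (k + 1))
  shift : ∀ s t : ℝ, s < t → t < s + N → Θ (t, s + N) = Θ (s, t) + c
  c_eq : ∃ m : ℤ, c = π + 2 * π * m

lemma exists_theta {N : ℤ} {v : ℤ → ℂ} {φ : ℤ → ℝ} (h : IsPg N v φ) :
    ∃ Θ c, IsTheta N v φ Θ c := by
  have hN := h.nreal
  have hcf : Continuous (fun p : ℝ × ℝ => gam v p.2 - gam v p.1) :=
    ((continuous_gam v).comp continuous_snd).sub ((continuous_gam v).comp continuous_fst)
  have hmem : ((0 : ℝ), (1 : ℝ)) ∈ strip N := by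
    simp only [strip, mem_ofPred_eq]; constructor <;> linarith
  obtain ⟨T, hTc, hTa⟩ := exists_lift (isOpen_strip N) (convex_strip N)
    ⟨_, hmem⟩ hcf.continuousOn (fun p hp => h.gam_ne hp.1 hp.2)
  -- edges
  have hedge : ∀ (k : ℤ) (s t : ℝ), k ≤ s → s < t → t ≤ k + 1 → T (s, t) = T (k, k + 1) := by
    intro k s t h1 h2 h3
    let S : Set (ℝ × ℝ) := {p | (k : ℝ) ≤ p.1 ∧ p.1 < p.2 ∧ p.2 ≤ k + 1}
    have hS : Convex ℝ S := by
      rintro ⟨a, b⟩ ⟨h1, h2, h3⟩ ⟨c, d⟩ ⟨h4, h5, h6⟩ x y hx hy hxy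
      have hy' : y = 1 - x := by linarith
      subst hy'
      simp only [S, mem_ofPred_eq, Prod.smul_mk, Prod.mk_add_mk, smul_eq_mul] at *
      refine ⟨by nlinarith, ?_, by nlinarith⟩
      rcases eq_or_lt_of_le hx with hx | hx
      · subst hx; nlinarith
      · nlinarith
    have hsub : S ⊆ strip N := by
      rintro ⟨a, b⟩ ⟨h1, h2, h3⟩
      simp only [strip, mem_ofPred_eq] at *
      exact ⟨h2, by linarith⟩
    have hx : ((s, t) : ℝ × ℝ) ∈ S := ⟨h1, h2, h3⟩
    have hy : (((k : ℝ), (k : ℝ) + 1) : ℝ × ℝ) ∈ S := ⟨le_rfl, by simp, le_rfl⟩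
    have := two_lifts (f := T) (g := fun _ => φ k) (c := 1) hS.isPreconnected (hTc.mono hsub)
      continuousOn_const ?_ hx hy
    · linarith
    · rintro ⟨a, b⟩ hab
      have h7 := hTa (a, b) (hsub hab)
      obtain ⟨h1, h2, h3⟩ := hab
      simp only at h1 h2 h3 h7
      have h8 := h7.unit (h.gam_ne h2 (by linarith))
      have h9 : gam v b - gam v a = ((b - a : ℝ) : ℂ) * (v (k + 1) - v k) := by
        rw [gam_edge v (k := k) (t := a) h1 (by linarith),
          gam_edge v (k := k) (t := b) (by linarith) h3]; push_cast; ring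
      have h10 : IsArg (gam v b - gam v a) (φ k) := by
        rw [h9]; exact (h.arg k).smul (by linarith)
      rw [h8, h10.unit (h.gam_ne h2 (by linarith)), one_mul]
  -- corners
  have hcor : ∀ (k : ℤ) (s t : ℝ), k ≤ s → s ≤ k + 1 → k + 1 ≤ t → t ≤ k + 1 + 1 → s < t →
      ∃ a b : ℝ, 0 ≤ a ∧ 0 ≤ b ∧ 0 < a + b ∧ T (s, t) = T (k, k + 1) +
        Complex.arg (a + b * ((v (k + 1 + 1) - v (k + 1)) / (v (k + 1) - v k))) ∧
        a = k + 1 - s ∧ b = t - (k + 1) := by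
    intro k s t h1 h2 h3 h4 h5
    let S : Set (ℝ × ℝ) := {p | (k : ℝ) ≤ p.1 ∧ p.1 ≤ k + 1 ∧ k + 1 ≤ p.2 ∧ p.2 ≤ k + 1 + 1 ∧
      p.1 < p.2}
    have hS : Convex ℝ S := by
      rintro ⟨a, b⟩ ⟨h1, h2, h3, h4, h5⟩ ⟨c, d⟩ ⟨g1, g2, g3, g4, g5⟩ x y hx hy hxy
      have hy' : y = 1 - x := by linarith
      subst hy'
      simp only [S, mem_ofPred_eq, Prod.smul_mk, Prod.mk_add_mk, smul_eq_mul] at *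
      refine ⟨by nlinarith, by nlinarith, by nlinarith, by nlinarith, ?_⟩
      rcases eq_or_lt_of_le hx with hx | hx
      · subst hx; nlinarith
      · nlinarith
    have hsub : S ⊆ strip N := by
      rintro ⟨a, b⟩ ⟨h1, h2, h3, h4, h5⟩
      simp only [strip, mem_ofPred_eq] at *
      exact ⟨h5, by linarith⟩
    have hx : ((s, t) : ℝ × ℝ) ∈ S := ⟨h1, h2, h3, h4, h5⟩
    have hy : (((k : ℝ), (k : ℝ) + 1) : ℝ × ℝ) ∈ S :=
      ⟨le_rfl, by simp, le_rfl, by simp, by simp⟩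
    have hf : ∀ p ∈ S, (gam v p.2 - gam v p.1) / (v (k + 1) - v k) =
        ((k + 1 - p.1 : ℝ) : ℂ) + ((p.2 - (k + 1) : ℝ) : ℂ) *
          ((v (k + 1 + 1) - v (k + 1)) / (v (k + 1) - v k)) := by
      rintro ⟨a, b⟩ ⟨h1, h2, h3, h4, h5⟩
      simp only at *
      have h9 : gam v b - gam v a = ((k + 1 - a : ℝ) : ℂ) * (v (k + 1) - v k) +
          ((b - (k + 1) : ℝ) : ℂ) * (v (k + 1 + 1) - v (k + 1)) := by
        rw [gam_edge v (k := k) (t := a) h1 (by linarith),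
          gam_edge v (k := k + 1) (t := b) (by push_cast; linarith) (by push_cast; linarith)]
        push_cast; ring
      rw [h9, add_div, mul_div_assoc, div_self (h.edge_ne k), mul_one, mul_div_assoc]
    have key := lift_eq_arg (c := v (k + 1) - v k) hS.isPreconnected hcf.continuousOn
      (hTc.mono hsub) (fun x hx => hTa x (hsub hx)) (fun p hp => by
        rw [hf p hp]
        exact slit_comb (h.turn_slit k) (by linarith [hp.2.1]) (by linarith [hp.2.2.1])
          (by linarith [hp.2.2.2.2])) hx hy
    refine ⟨k + 1 - s, t - (k + 1), by linarith, by linarith, by linarith, ?_, rfl, rfl⟩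
    rw [hf _ hx, hf _ hy] at key
    simp only [add_sub_cancel_left, Complex.ofReal_one, sub_self, Complex.ofReal_zero, zero_mul,
      add_zero, Complex.arg_one, sub_zero] at key
    rw [← key]; push_cast; ring
  have hstep : ∀ k : ℤ, T (((k + 1 : ℤ) : ℝ), ((k + 1 : ℤ) : ℝ) + 1) - φ (k + 1) =
      T (k, k + 1) - φ k := by
    intro k
    obtain ⟨a, b, ha, hb, hab, hT, ha', hb'⟩ := hcor k (k + 1) (k + 1 + 1) (by linarith) le_rfl
      (by linarith) le_rfl (by linarith)
    have ha'' : a = 0 := by linarith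
    have hb'' : b = 1 := by linarith
    subst ha''; subst hb''
    have := h.turn_eq k
    rw [Complex.ofReal_zero, zero_add, Complex.ofReal_one, one_mul, ← this] at hT
    push_cast
    rw [hT]; ring
  have hall : ∀ k : ℤ, T (k, k + 1) - φ k = T (0, 1) - φ 0 := by
    intro k
    induction k using Int.induction_on with
    | zero => simp
    | succ n ih => rw [← ih]; exact_mod_cast hstep n
    | pred n ih => rw [← ih, ← hstep]; simp
  have hd : e (T (0, 1) - φ 0) = 1 := by
    have h1 := hTa _ hmem
    simp only at h1
    have h0 := gam_int v 0
    have h2 := gam_int v 1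
    simp only [Int.cast_zero, Int.cast_one] at h0 h2
    rw [h0, h2] at h1
    have h3 := h.arg 0
    have h4 := h.edge_ne 0
    simp only [zero_add] at h3 h4
    rw [e_sub, h1.unit h4, h3.unit h4, div_self]
    have := h3.unit h4
    rw [← this]; exact e_ne _
  set d := T (0, 1) - φ 0 with hddef
  -- shift
  have hshift : ∃ c, ∀ s t : ℝ, s < t → t < s + N → T (t, s + N) = T (s, t) + c := by
    refine ⟨T (1, 0 + N) - T (0, 1), fun s t h1 h2 => ?_⟩
    have hmap : ContinuousOn (fun p : ℝ × ℝ => T (p.2, p.1 + N)) (strip N) := by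
      refine hTc.comp (f := fun p : ℝ × ℝ => (p.2, p.1 + N)) (by fun_prop) ?_
      rintro ⟨a, b⟩ ⟨h1, h2⟩
      simp only [strip, mem_ofPred_eq] at *
      exact ⟨h2, by linarith⟩
    have := two_lifts (convex_strip N).isPreconnected hmap hTc (c := -1) ?_
      (x := (s, t)) (y := (0, 1)) ⟨h1, h2⟩ hmem
    · simp only at this; linarith
    · rintro ⟨a, b⟩ ⟨h1, h2⟩
      simp only at *
      have h3 := (hTa (b, a + N) ⟨h2, by simpa using h1⟩).unit (h.gam_ne h2 (by linarith))
      have h4 := (hTa (a, b) ⟨h1, h2⟩).unit (h.gam_ne h1 h2)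
      simp only at h3 h4
      rw [gam_per h.per] at h3
      rw [h3, h4, ← norm_neg, neg_sub, ← neg_sub]; ring
  obtain ⟨c, hc⟩ := hshift
  have hTd : ∀ s t : ℝ, s < t → t < s + N → IsArg (gam v t - gam v s) (T (s, t) - d) := by
    intro s t h1 h2
    refine (hTa (s, t) ⟨h1, h2⟩).of_e ?_
    rw [e_sub, hd, div_one]
  refine ⟨fun p => T p - d, c, hTc.sub continuousOn_const, hTd, ?_, ?_, ?_, ?_⟩
  · intro k s t h1 h2 h3
    rw [hedge k s t h1 h2 h3]; linarith [hall k]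
  · intro k s t h1 h2 h3 h4 h5
    obtain ⟨a, b, ha, hb, hab, hT, -, -⟩ := hcor k s t h1 h2 h3 h4 h5
    have := arg_comb (h.turn_slit k) ha hb hab
    rw [← h.turn_eq k] at this
    have h7 := hall k
    rw [hT]
    rcases le_total 0 (φ (k + 1) - φ k) with h6 | h6
    · have := this.1 h6
      rw [uIcc_of_le (by linarith)]
      constructor <;> linarith
    · have := this.2 h6
      rw [uIcc_of_ge (by linarith)]
      constructor <;> linarith
  · intro s t h1 h2
    rw [hc s t h1 h2]; ring
  · apply e_eq_neg_one
    have h1 := hc 0 1 (by norm_num) (by linarith)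
    have h2 := (hTa (1, 0 + N) ⟨by simp only; linarith, by simp only; linarith⟩).unit
      (h.gam_ne (by linarith) (by linarith))
    have h3 := (hTa (0, 1) hmem).unit (h.gam_ne (by norm_num) (by linarith))
    simp only at h2 h3
    rw [gam_per h.per] at h2
    have : c = T (1, 0 + N) - T (0, 1) := by linarith
    rw [this, e_sub, h2, h3, ← neg_sub (gam v 1), norm_neg, neg_div, neg_div, div_self]
    rw [← h3]; exact e_ne _

namespace IsTheta
variable {N : ℤ} {v : ℤ → ℂ} {φ : ℤ → ℝ} {Θ : ℝ × ℝ → ℝ} {c : ℝ}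

lemma phi_per (h : IsPg N v φ) (hT : IsTheta N v φ Θ c) (k : ℤ) : φ (k + N) = φ k + 2 * c := by
  have hN := h.nreal
  have h1 := hT.shift k (k + 1) (by linarith) (by linarith)
  have h2 := hT.shift (k + 1) (k + N) (by linarith) (by linarith)
  have h3 := hT.edge k k (k + 1) le_rfl (by linarith) le_rfl
  have h4 := hT.edge (k + N) (k + N) (k + 1 + N) (by push_cast; rfl) (by linarith)
    (by push_cast; linarith)
  linarith

end IsTheta

end MS

namespace MS

/-- outgoing edge angle at a parameter -/
def phP (φ : ℤ → ℝ) (t : ℝ) : ℝ := φ ⌊t⌋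
/-- incoming edge angle at a parameter -/
def phM (φ : ℤ → ℝ) (t : ℝ) : ℝ := φ (⌈t⌉ - 1)

/-- the left germ at `t` lies in `O` -/
def LG (v : ℤ → ℂ) (φ : ℤ → ℝ) (t : ℝ) (O : Set ℂ) : Prop :=
  ∃ ρ > 0, ∀ θ ∈ Ioo (phP φ t) (phM φ t + π), ∀ r ∈ Ioo 0 ρ, gam v t + (r : ℝ) * e θ ∈ O
/-- the right germ at `t` lies in `O` -/
def RG (v : ℤ → ℂ) (φ : ℤ → ℝ) (t : ℝ) (O : Set ℂ) : Prop :=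
  ∃ ρ > 0, ∀ θ ∈ Ioo (phM φ t + π) (phP φ t + 2 * π), ∀ r ∈ Ioo 0 ρ,
    gam v t + (r : ℝ) * e θ ∈ O

lemma phP_int (φ : ℤ → ℝ) (k : ℤ) : phP φ k = φ k := by simp [phP]
lemma phM_int (φ : ℤ → ℝ) (k : ℤ) : phM φ k = φ (k - 1) := by simp [phM]
lemma phP_of {φ : ℤ → ℝ} {k : ℤ} {t : ℝ} (h1 : k ≤ t) (h2 : t < k + 1) : phP φ t = φ k := by
  rw [phP, Int.floor_eq_iff.2 ⟨h1, h2⟩]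
lemma phM_of {φ : ℤ → ℝ} {k : ℤ} {t : ℝ} (h1 : k < t) (h2 : t ≤ k + 1) : phM φ t = φ k := by
  rw [phM, (Int.ceil_eq_iff (z := k + 1)).2 ⟨by push_cast; linarith, by push_cast; linarith⟩]
  simp

namespace IsPg

variable {N : ℤ} {v : ℤ → ℂ} {φ : ℤ → ℝ} (h : IsPg N v φ)
include h

lemma turn_abs (t : ℝ) : |phP φ t - phM φ t| < π := by
  rcases eq_or_lt_of_le (Int.floor_le t) with ht | ht
  · rw [← ht, phP_int, phM_int]
    have := h.turn (⌊t⌋ - 1)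
    rwa [sub_add_cancel] at this
  · rw [phP, phM_of ht (Int.lt_floor_add_one t).le]
    simp [pi_pos]

lemma fwd {t τ : ℝ} (h1 : 0 ≤ τ) (h2 : t + τ ≤ ⌊t⌋ + 1) :
    gam v (t + τ) = gam v t + ((τ * ‖v (⌊t⌋ + 1) - v ⌊t⌋‖ : ℝ) : ℂ) * e (phP φ t) := by
  have := Int.floor_le t
  rw [gam_edge v (k := ⌊t⌋) (t := t + τ) (by linarith) h2,
    gam_edge v (k := ⌊t⌋) (t := t) this (by linarith), phP, Complex.ofReal_mul, mul_assoc,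
    ← h.edge_eq]
  push_cast; ring

lemma bwd {t τ : ℝ} (h1 : 0 ≤ τ) (h2 : (⌈t⌉ : ℝ) - 1 ≤ t - τ) :
    gam v (t - τ) = gam v t +
      ((τ * ‖v (⌈t⌉ - 1 + 1) - v (⌈t⌉ - 1)‖ : ℝ) : ℂ) * e (phM φ t + π) := by
  have := Int.le_ceil t
  rw [gam_edge v (k := ⌈t⌉ - 1) (t := t - τ) (by push_cast; linarith) (by push_cast; linarith),
    gam_edge v (k := ⌈t⌉ - 1) (t := t) (by push_cast; linarith) (by push_cast; linarith), phM,
    e_add_pi, mul_neg, Complex.ofReal_mul, mul_assoc, ← h.edge_eq]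
  push_cast; ring

lemma mod_near (t x : ℝ) (η : ℝ) : ∃ t' ∈ Ico (t - η) (t - η + N), gam v t' = gam v x := by
  have hN : (0 : ℝ) < N := by exact_mod_cast h.hN
  refine ⟨toIcoMod hN (t - η) x, toIcoMod_mem_Ico _ _ _, ?_⟩
  rw [← self_sub_toIcoDiv_zsmul, ← gam_per_mul h.per _ (toIcoDiv hN (t - η) x)]
  congr 1; simp

lemma loc (t : ℝ) : ∃ ε > 0, ∀ w : ℂ, ‖w‖ < ε → gam v t + w ∈ range (gam v) →
    ∃ x : ℝ, 0 ≤ x ∧ (w = x * e (phP φ t) ∨ w = x * e (phM φ t + π)) := by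
  have hN := h.nreal
  have hf := Int.lt_floor_add_one t
  have hc := Int.ceil_lt_add_one t
  set η := min (⌊t⌋ + 1 - t) (t - (⌈t⌉ - 1)) with hη
  have hη0 : 0 < η := lt_min (by linarith) (by linarith)
  have hη1 : η ≤ ⌊t⌋ + 1 - t := min_le_left _ _
  have hη2 : η ≤ t - (⌈t⌉ - 1) := min_le_right _ _
  have hcomp : IsCompact (gam v '' Icc (t + η) (t - η + N)) :=
    isCompact_Icc.image (continuous_gam v)
  have hnot : gam v t ∉ gam v '' Icc (t + η) (t - η + N) := by
    rintro ⟨x, ⟨hx1, hx2⟩, hx⟩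
    exact h.gam_ne (s := t) (t := x) (by linarith) (by linarith) (sub_eq_zero.2 hx)
  obtain ⟨ε, hε, hball⟩ := Metric.isOpen_iff.1 hcomp.isClosed.isOpen_compl _ hnot
  refine ⟨ε, hε, fun w hw ⟨x, hx⟩ => ?_⟩
  obtain ⟨t', ⟨h1, h2⟩, h3⟩ := h.mod_near t x η
  rw [hx] at h3
  have h4 : ¬ (t + η ≤ t') := by
    intro h4
    have : gam v t + w ∈ Metric.ball (gam v t) ε := by simpa [Metric.mem_ball, dist_eq_norm] using hw
    exact hball this ⟨t', ⟨h4, h2.le⟩, h3⟩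
  push Not at h4
  rcases le_total t t' with h5 | h5
  · have := h.fwd (t := t) (τ := t' - t) (by linarith) (by linarith)
    rw [add_sub_cancel, h3] at this
    exact ⟨_, mul_nonneg (by linarith) (norm_nonneg _), Or.inl (add_left_cancel this)⟩
  · have := h.bwd (t := t) (τ := t - t') (by linarith) (by linarith)
    rw [sub_sub_cancel, h3] at this
    exact ⟨_, mul_nonneg (by linarith) (norm_nonneg _), Or.inr (add_left_cancel this)⟩

lemma ray_out (t : ℝ) : ∃ ε > 0, ∀ x : ℝ, 0 ≤ x → x < ε →
    gam v t + x * e (phP φ t) ∈ range (gam v) := by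
  have hf := Int.lt_floor_add_one t
  have hp := h.edge_pos ⌊t⌋
  refine ⟨(⌊t⌋ + 1 - t) * ‖v (⌊t⌋ + 1) - v ⌊t⌋‖, mul_pos (by linarith) hp, fun x h0 h1 => ?_⟩
  refine ⟨t + x / ‖v (⌊t⌋ + 1) - v ⌊t⌋‖, ?_⟩
  rw [h.fwd (by positivity), div_mul_cancel₀ _ hp.ne']
  have : x / ‖v (⌊t⌋ + 1) - v ⌊t⌋‖ < ⌊t⌋ + 1 - t := by rwa [div_lt_iff₀ hp]
  linarith

lemma ray_in (t : ℝ) : ∃ ε > 0, ∀ x : ℝ, 0 ≤ x → x < ε →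
    gam v t + x * e (phM φ t + π) ∈ range (gam v) := by
  have hf := Int.ceil_lt_add_one t
  have hp := h.edge_pos (⌈t⌉ - 1)
  refine ⟨(t - (⌈t⌉ - 1)) * ‖v (⌈t⌉ - 1 + 1) - v (⌈t⌉ - 1)‖, mul_pos (by linarith) hp,
    fun x h0 h1 => ?_⟩
  refine ⟨t - x / ‖v (⌈t⌉ - 1 + 1) - v (⌈t⌉ - 1)‖, ?_⟩
  rw [h.bwd (by positivity), div_mul_cancel₀ _ hp.ne']
  have : x / ‖v (⌈t⌉ - 1 + 1) - v (⌈t⌉ - 1)‖ < t - (⌈t⌉ - 1) := by rwa [div_lt_iff₀ hp]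
  linarith

lemma isClosed_range : IsCompact (range (gam v)) := by
  have : range (gam v) = gam v '' Icc 0 N := by
    ext z; constructor
    · rintro ⟨x, rfl⟩
      obtain ⟨t, ⟨h1, h2⟩, h3⟩ := h.mod_near 0 x 0
      exact ⟨t, ⟨by linarith, by linarith⟩, h3⟩
    · rintro ⟨x, -, rfl⟩; exact ⟨x, rfl⟩
  rw [this]
  exact isCompact_Icc.image (continuous_gam v)

/-- sector points are off the curve -/
lemma sector_avoid (t : ℝ) : ∃ ε > 0, ∀ θ, (θ ∈ Ioo (phP φ t) (phM φ t + π) ∨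
    θ ∈ Ioo (phM φ t + π) (phP φ t + 2 * π)) → ∀ r ∈ Ioo 0 ε,
    gam v t + (r : ℝ) * e θ ∉ range (gam v) := by
  obtain ⟨ε, hε, hl⟩ := h.loc t
  refine ⟨ε, hε, fun θ hθ r hr hmem => ?_⟩
  have ht := abs_lt.1 (h.turn_abs t)
  have hpi := pi_pos
  obtain ⟨x, hx0, hx⟩ := hl (r * e θ) (by simp [norm_e, abs_of_pos hr.1, hr.2]) hmem
  have hne : ((r : ℝ) : ℂ) * e θ ≠ 0 :=
    mul_ne_zero (by exact_mod_cast hr.1.ne') (e_ne _)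
  have ha := isArg_smul_e hr.1.le θ
  rcases hx with hx | hx
  · have hb := isArg_smul_e hx0 (phP φ t)
    rw [← hx] at hb
    obtain ⟨m, hm⟩ := ha.unique hne hb
    have h1 : (0 : ℝ) < m := by
      rcases hθ with ⟨h1, h2⟩ | ⟨h1, h2⟩ <;> (by_contra hc; push Not at hc; nlinarith)
    have h2 : (m : ℝ) < 1 := by
      rcases hθ with ⟨h1, h2⟩ | ⟨h1, h2⟩ <;> (by_contra hc; push Not at hc; nlinarith)
    have h1 : 0 < m := by exact_mod_cast h1
    have h2 : m < 1 := by exact_mod_cast h2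
    omega
  · have hb := isArg_smul_e hx0 (phM φ t + π)
    rw [← hx] at hb
    obtain ⟨m, hm⟩ := ha.unique hne hb
    rcases hθ with ⟨h3, h4⟩ | ⟨h3, h4⟩
    · have h1 : (m : ℝ) < 0 := by by_contra hc; push Not at hc; nlinarith
      have h2 : (-1 : ℝ) < m := by by_contra hc; push Not at hc; nlinarith
      have h1 : m < 0 := by exact_mod_cast h1
      have h2 : -1 < m := by exact_mod_cast h2
      omega
    · have h1 : (0 : ℝ) < m := by by_contra hc; push Not at hc; nlinarith
      have h2 : (m : ℝ) < 1 := by by_contra hc; push Not at hc; nlinarith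
      have h1 : 0 < m := by exact_mod_cast h1
      have h2 : m < 1 := by exact_mod_cast h2
      omega

lemma sec_dich (t : ℝ) {O O' : Set ℂ} (hO : IsOpen O) (hO' : IsOpen O')
    (hd : Disjoint O O') (hc : (range (gam v))ᶜ ⊆ O ∪ O') {a b : ℝ}
    (hab : ∀ θ ∈ Ioo a b, θ ∈ Ioo (phP φ t) (phM φ t + π) ∨
      θ ∈ Ioo (phM φ t + π) (phP φ t + 2 * π)) :
    (∃ ρ > 0, ∀ θ ∈ Ioo a b, ∀ r ∈ Ioo 0 ρ, gam v t + (r : ℝ) * e θ ∈ O) ∨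
    (∃ ρ > 0, ∀ θ ∈ Ioo a b, ∀ r ∈ Ioo 0 ρ, gam v t + (r : ℝ) * e θ ∈ O') := by
  obtain ⟨ε, hε, ha⟩ := h.sector_avoid t
  let F : ℝ × ℝ → ℂ := fun p => gam v t + (p.2 : ℝ) * e p.1
  have hpre : IsPreconnected (F '' (Ioo a b ×ˢ Ioo 0 ε)) :=
    (isPreconnected_Ioo.prod isPreconnected_Ioo).image _ (by unfold F; fun_prop)
  have hsub : F '' (Ioo a b ×ˢ Ioo 0 ε) ⊆ O ∪ O' := by
    rintro _ ⟨⟨θ, r⟩, ⟨h1, h2⟩, rfl⟩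
    exact hc (ha θ (hab θ h1) r h2)
  rcases isPreconnected_iff_subset_of_disjoint.1 hpre O O' hO hO' hsub
    (by rw [hd.inter_eq, inter_empty]) with h1 | h1
  · exact Or.inl ⟨ε, hε, fun θ hθ r hr => h1 ⟨(θ, r), ⟨hθ, hr⟩, rfl⟩⟩
  · exact Or.inr ⟨ε, hε, fun θ hθ r hr => h1 ⟨(θ, r), ⟨hθ, hr⟩, rfl⟩⟩

lemma LG_dich (t : ℝ) {O O' : Set ℂ} (hO : IsOpen O) (hO' : IsOpen O')
    (hd : Disjoint O O') (hc : (range (gam v))ᶜ ⊆ O ∪ O') : LG v φ t O ∨ LG v φ t O' :=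
  h.sec_dich t hO hO' hd hc (fun _ => Or.inl)

lemma RG_dich (t : ℝ) {O O' : Set ℂ} (hO : IsOpen O) (hO' : IsOpen O')
    (hd : Disjoint O O') (hc : (range (gam v))ᶜ ⊆ O ∪ O') : RG v φ t O ∨ RG v φ t O' :=
  h.sec_dich t hO hO' hd hc (fun _ => Or.inr)

end IsPg

lemma small_turn {x ω ρ ρ' : ℝ} (hx : 0 < x) (hω : 0 < ω) (hρ : x < ρ) (hρ' : 0 < ρ') :
    ∃ r ∈ Ioo 0 ρ', ∃ η ∈ Ioo 0 ω, ∃ r1 ∈ Ioo 0 ρ,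
      (x : ℂ) + r * Complex.I = (r1 : ℝ) * e η ∧ (x : ℂ) - r * Complex.I = (r1 : ℝ) * e (-η) := by
  have hpi := pi_pos
  -- choose the angle first
  have hcont : ContinuousAt (fun η : ℝ => x * tan η) 0 :=
    continuousAt_const.mul (continuousAt_tan.2 (by simp))
  have hcont2 : ContinuousAt (fun η : ℝ => x / cos η) 0 :=
    continuousAt_const.div continuous_cos.continuousAt (by simp)
  have h1 : ∀ᶠ η in nhds (0 : ℝ), x * tan η < ρ' :=
    hcont.eventually_lt continuousAt_const (by simpa using hρ')
  have h2 : ∀ᶠ η in nhds (0 : ℝ), x / cos η < ρ :=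
    hcont2.eventually_lt continuousAt_const (by simpa using hρ)
  have h3 : ∀ᶠ η in nhds (0 : ℝ), η < min ω (π / 2) :=
    eventually_lt_nhds (by simp [hω, hpi])
  have h4 := (h1.and (h2.and h3))
  have h5 := (h4.filter_mono nhdsWithin_le_nhds).and
    (self_mem_nhdsWithin : Ioi (0 : ℝ) ∈ nhdsWithin 0 (Ioi 0))
  obtain ⟨η, ⟨g1, g2, g3⟩, g4⟩ := h5.exists
  have g4 : 0 < η := g4
  have g5 := g3.trans_le (min_le_left _ _)
  have g6 := g3.trans_le (min_le_right _ _)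
  have hc : 0 < cos η := cos_pos_of_mem_Ioo ⟨by linarith, g6⟩
  have hs : 0 < sin η := sin_pos_of_pos_of_lt_pi g4 (by linarith)
  refine ⟨x * tan η, ⟨by rw [tan_eq_sin_div_cos]; positivity, g1⟩, η, ⟨g4, g5⟩, x / cos η,
    ⟨by positivity, g2⟩, ?_, ?_⟩
  · apply Complex.ext
    · rw [Complex.re_ofReal_mul, Complex.add_re, Complex.re_ofReal_mul, e_re]
      simp only [Complex.ofReal_re, Complex.I_re]; field_simp; ring
    · rw [Complex.im_ofReal_mul, Complex.add_im, Complex.im_ofReal_mul, e_im, tan_eq_sin_div_cos]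
      simp only [Complex.ofReal_im, Complex.I_im]; field_simp; ring
  · apply Complex.ext
    · rw [Complex.re_ofReal_mul, Complex.sub_re, Complex.re_ofReal_mul, e_re, cos_neg]
      simp only [Complex.ofReal_re, Complex.I_re]; field_simp; ring
    · rw [Complex.im_ofReal_mul, Complex.sub_im, Complex.im_ofReal_mul, e_im, sin_neg,
        tan_eq_sin_div_cos]
      simp only [Complex.ofReal_im, Complex.I_im]; field_simp; ring

lemma e_half (a : ℝ) : e (a + π / 2) = Complex.I * e a := by
  rw [e_add]
  have : e (π / 2) = Complex.I := by
    apply Complex.ext <;> simp [e_re, e_im]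
  rw [this, mul_comm]

namespace IsPg

variable {N : ℤ} {v : ℤ → ℂ} {φ : ℤ → ℝ} (h : IsPg N v φ)
include h

lemma LG_near {t : ℝ} {O : Set ℂ} (hO : LG v φ t O) : ∃ η > 0, ∀ t', |t' - t| < η →
    ∀ O', LG v φ t' O' → (O ∩ O').Nonempty := by
  have hpi := pi_pos
  obtain ⟨ρ, hρ, hg⟩ := hO
  have ht := abs_lt.1 (h.turn_abs t)
  have hf := Int.lt_floor_add_one t
  have hc := Int.ceil_lt_add_one t
  have hf' := Int.floor_le t
  have hc' := Int.le_ceil t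
  have hp := h.edge_pos ⌊t⌋
  have hq := h.edge_pos (⌈t⌉ - 1)
  refine ⟨min (min (⌊t⌋ + 1 - t) (t - (⌈t⌉ - 1))) (min (ρ / ‖v (⌊t⌋ + 1) - v ⌊t⌋‖)
    (ρ / ‖v (⌈t⌉ - 1 + 1) - v (⌈t⌉ - 1)‖)), lt_min (lt_min (by linarith) (by linarith))
    (lt_min (by positivity) (by positivity)), ?_⟩
  rintro t' ht' O' ⟨ρ', hρ', hg'⟩
  simp only [lt_min_iff, abs_lt] at ht'
  obtain ⟨⟨⟨a1, a2⟩, ⟨a3, a4⟩⟩, ⟨a5, a6⟩, ⟨a7, a8⟩⟩ := ht'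
  rw [lt_div_iff₀ hp] at a6
  rw [neg_lt, lt_div_iff₀ hq] at a7
  rcases lt_trichotomy t t' with hlt | rfl | hlt
  · have b1 : phP φ t' = phP φ t := phP_of (by linarith) (by linarith)
    have b2 : phM φ t' = phP φ t := phM_of (by linarith) (by linarith)
    have b3 := h.fwd (t := t) (τ := t' - t) (by linarith) (by linarith)
    rw [add_sub_cancel] at b3
    obtain ⟨r, hr, η, hη, r1, hr1, h1, -⟩ := small_turn (x := (t' - t) * ‖v (⌊t⌋ + 1) - v ⌊t⌋‖)
      (ω := phM φ t + π - phP φ t) (mul_pos (by linarith) hp) (by linarith) a6 hρ'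
    refine ⟨gam v t + (r1 : ℝ) * e (phP φ t + η), hg _ ⟨by linarith [hη.1], by linarith [hη.2]⟩ _ hr1, ?_⟩
    have := hg' (phP φ t + π / 2) ⟨by rw [b1]; linarith, by rw [b2]; linarith⟩ r hr
    rw [b3, e_half] at this
    convert this using 1
    rw [add_comm (phP φ t), e_add, ← mul_assoc, ← h1]; ring
  · refine ⟨gam v t + ((min ρ ρ' / 2 : ℝ) : ℂ) * e ((phP φ t + (phM φ t + π)) / 2), ?_, ?_⟩
    · refine hg _ ⟨by linarith, by linarith⟩ _ ⟨by positivity, ?_⟩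
      have := min_le_left ρ ρ'; linarith
    · refine hg' _ ⟨by linarith, by linarith⟩ _ ⟨by positivity, ?_⟩
      have := min_le_right ρ ρ'; linarith
  · have b1 : phP φ t' = phM φ t := phP_of (by push_cast; linarith) (by push_cast; linarith)
    have b2 : phM φ t' = phM φ t := phM_of (by push_cast; linarith) (by push_cast; linarith)
    have b3 := h.bwd (t := t) (τ := t - t') (by linarith) (by linarith)
    rw [sub_sub_cancel] at b3
    obtain ⟨r, hr, η, hη, r1, hr1, -, h1⟩ := small_turn
      (x := (t - t') * ‖v (⌈t⌉ - 1 + 1) - v (⌈t⌉ - 1)‖)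
      (ω := phM φ t + π - phP φ t) (ρ := ρ) (mul_pos (by linarith) hq) (by linarith) (by linarith) hρ'
    refine ⟨gam v t + (r1 : ℝ) * e (phM φ t + π + -η), hg _ ⟨by linarith [hη.2], by linarith [hη.1]⟩ _ hr1, ?_⟩
    have := hg' (phM φ t + π / 2) ⟨by rw [b1]; linarith, by rw [b2]; linarith⟩ r hr
    rw [b3, e_half] at this
    convert this using 1
    rw [add_comm (phM φ t + π), e_add, ← mul_assoc, ← h1, e_add_pi]; ring

lemma RG_near {t : ℝ} {O : Set ℂ} (hO : RG v φ t O) : ∃ η > 0, ∀ t', |t' - t| < η →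
    ∀ O', RG v φ t' O' → (O ∩ O').Nonempty := by
  have hpi := pi_pos
  obtain ⟨ρ, hρ, hg⟩ := hO
  have ht := abs_lt.1 (h.turn_abs t)
  have hf := Int.lt_floor_add_one t
  have hc := Int.ceil_lt_add_one t
  have hf' := Int.floor_le t
  have hc' := Int.le_ceil t
  have hp := h.edge_pos ⌊t⌋
  have hq := h.edge_pos (⌈t⌉ - 1)
  refine ⟨min (min (⌊t⌋ + 1 - t) (t - (⌈t⌉ - 1))) (min (ρ / ‖v (⌊t⌋ + 1) - v ⌊t⌋‖)
    (ρ / ‖v (⌈t⌉ - 1 + 1) - v (⌈t⌉ - 1)‖)), lt_min (lt_min (by linarith) (by linarith))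
    (lt_min (by positivity) (by positivity)), ?_⟩
  rintro t' ht' O' ⟨ρ', hρ', hg'⟩
  simp only [lt_min_iff, abs_lt] at ht'
  obtain ⟨⟨⟨a1, a2⟩, ⟨a3, a4⟩⟩, ⟨a5, a6⟩, ⟨a7, a8⟩⟩ := ht'
  rw [lt_div_iff₀ hp] at a6
  rw [neg_lt, lt_div_iff₀ hq] at a7
  have h2pi : ∀ a, e (a + 2 * π) = e a := fun a => by
    have := e_add_int a 1
    simpa using this
  rcases lt_trichotomy t t' with hlt | rfl | hlt
  · have b1 : phP φ t' = phP φ t := phP_of (by linarith) (by linarith)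
    have b2 : phM φ t' = phP φ t := phM_of (by linarith) (by linarith)
    have b3 := h.fwd (t := t) (τ := t' - t) (by linarith) (by linarith)
    rw [add_sub_cancel] at b3
    obtain ⟨r, hr, η, hη, r1, hr1, -, h1⟩ := small_turn (x := (t' - t) * ‖v (⌊t⌋ + 1) - v ⌊t⌋‖)
      (ω := phP φ t + π - phM φ t) (mul_pos (by linarith) hp) (by linarith) a6 hρ'
    refine ⟨gam v t + (r1 : ℝ) * e (-η + phP φ t + 2 * π), hg _ ⟨by linarith [hη.2], by linarith [hη.1]⟩ _ hr1, ?_⟩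
    have := hg' (phP φ t + π / 2 + π) ⟨by rw [b2]; linarith, by rw [b1]; linarith⟩ r hr
    rw [b3, e_add_pi, e_half] at this
    convert this using 1
    rw [h2pi, e_add, ← mul_assoc, ← h1]; ring
  · refine ⟨gam v t + ((min ρ ρ' / 2 : ℝ) : ℂ) * e ((phM φ t + π + (phP φ t + 2 * π)) / 2), ?_, ?_⟩
    · refine hg _ ⟨by linarith, by linarith⟩ _ ⟨by positivity, ?_⟩
      have := min_le_left ρ ρ'; linarith
    · refine hg' _ ⟨by linarith, by linarith⟩ _ ⟨by positivity, ?_⟩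
      have := min_le_right ρ ρ'; linarith
  · have b1 : phP φ t' = phM φ t := phP_of (by push_cast; linarith) (by push_cast; linarith)
    have b2 : phM φ t' = phM φ t := phM_of (by push_cast; linarith) (by push_cast; linarith)
    have b3 := h.bwd (t := t) (τ := t - t') (by linarith) (by linarith)
    rw [sub_sub_cancel] at b3
    obtain ⟨r, hr, η, hη, r1, hr1, h1, -⟩ := small_turn
      (x := (t - t') * ‖v (⌈t⌉ - 1 + 1) - v (⌈t⌉ - 1)‖)
      (ω := phP φ t + π - phM φ t) (ρ := ρ) (mul_pos (by linarith) hq) (by linarith) (by linarith) hρ'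
    refine ⟨gam v t + (r1 : ℝ) * e (η + (phM φ t + π)), hg _ ⟨by linarith [hη.1], by linarith [hη.2]⟩ _ hr1, ?_⟩
    have := hg' (phM φ t + π / 2 + π) ⟨by rw [b2]; linarith, by rw [b1]; linarith⟩ r hr
    rw [b3, e_add_pi (_ + π / 2), e_half] at this
    convert this using 1
    rw [e_add, ← mul_assoc, ← h1, e_add_pi]; ring

lemma all_or {P Q : ℝ → Prop} (hor : ∀ t, P t ∨ Q t)
    (hP : ∀ t, P t → ∃ η > 0, ∀ t', |t' - t| < η → ¬ Q t')
    (hQ : ∀ t, Q t → ∃ η > 0, ∀ t', |t' - t| < η → ¬ P t') {t0 : ℝ} (h0 : P t0) : ∀ t, P t := by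
  have hPQ : ∀ t, P t → ¬ Q t := by
    intro t hp hq
    obtain ⟨η, hη, hh⟩ := hP t hp
    exact hh t (by simpa using hη) hq
  have hcl : IsClopen {t | P t} := by
    constructor
    · rw [← isOpen_compl_iff, Metric.isOpen_iff]
      intro t ht
      have hq : Q t := (hor t).resolve_left ht
      obtain ⟨η, hη, hh⟩ := hQ t hq
      exact ⟨η, hη, fun t' ht' => hh t' (by simpa [dist_eq] using ht')⟩
    · rw [Metric.isOpen_iff]
      intro t ht
      obtain ⟨η, hη, hh⟩ := hP t ht
      exact ⟨η, hη, fun t' ht' => (hor t').resolve_right (hh t' (by simpa [dist_eq] using ht'))⟩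
  have := hcl.eq_univ ⟨t0, h0⟩
  intro t
  have : t ∈ {t | P t} := by rw [this]; trivial
  exact this

/-- main germ lemma -/
lemma germs {O O' : Set ℂ} (hO : IsOpen O) (hO' : IsOpen O')
    (hd : Disjoint O O') (hc : (range (gam v))ᶜ ⊆ O ∪ O') (hJ : ∀ z ∈ O, z ∉ range (gam v))
    (hne : O.Nonempty) :
    (∀ t, LG v φ t O) ∨ (∀ t, RG v φ t O) := by
  have hL : ∀ t0, LG v φ t0 O → ∀ t, LG v φ t O := fun t0 h0 =>
    h.all_or (P := fun t => LG v φ t O) (Q := fun t => LG v φ t O')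
      (fun t => h.LG_dich t hO hO' hd hc)
      (fun t ht => by
        obtain ⟨η, hη, hh⟩ := h.LG_near ht
        refine ⟨η, hη, fun t' h1 h2 => ?_⟩
        have := hh t' h1 _ h2
        rw [hd.inter_eq] at this; simp at this)
      (fun t ht => by
        obtain ⟨η, hη, hh⟩ := h.LG_near ht
        refine ⟨η, hη, fun t' h1 h2 => ?_⟩
        have := hh t' h1 _ h2
        rw [hd.symm.inter_eq] at this; simp at this) h0
  have hR : ∀ t0, RG v φ t0 O → ∀ t, RG v φ t O := fun t0 h0 =>
    h.all_or (P := fun t => RG v φ t O) (Q := fun t => RG v φ t O')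
      (fun t => h.RG_dich t hO hO' hd hc)
      (fun t ht => by
        obtain ⟨η, hη, hh⟩ := h.RG_near ht
        refine ⟨η, hη, fun t' h1 h2 => ?_⟩
        have := hh t' h1 _ h2
        rw [hd.inter_eq] at this; simp at this)
      (fun t ht => by
        obtain ⟨η, hη, hh⟩ := h.RG_near ht
        refine ⟨η, hη, fun t' h1 h2 => ?_⟩
        have := hh t' h1 _ h2
        rw [hd.symm.inter_eq] at this; simp at this) h0
  obtain ⟨p, hp⟩ := hne
  obtain ⟨_, ⟨t, rfl⟩, hmin⟩ := h.isClosed_range.exists_isMinOn (range_nonempty _)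
    (f := fun z => dist z p) (by fun_prop)
  have hmin' : ∀ z ∈ range (gam v), dist (gam v t) p ≤ dist z p := fun z hz => hmin hz
  have hpne : p - gam v t ≠ 0 := by
    intro h0
    exact hJ p hp ⟨t, (sub_eq_zero.1 h0).symm⟩
  set R := ‖p - gam v t‖ with hR0
  have hRpos : 0 < R := norm_pos_iff.2 hpne
  have hdist : dist (gam v t) p = R := by rw [dist_comm, dist_eq_norm]
  have hball : Metric.ball p R ⊆ O := by
    have hb : Metric.ball p R ⊆ O ∪ O' := by
      intro z hz
      apply hc
      intro hzr
      have := hmin' z hzr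
      rw [Metric.mem_ball] at hz
      linarith
    rcases isPreconnected_iff_subset_of_disjoint.1
      (convex_ball p R).isPreconnected O O' hO hO' hb (by rw [hd.inter_eq, inter_empty]) with h1 | h1
    · exact h1
    · exact absurd (h1 (Metric.mem_ball_self hRpos)) (fun h2 => hd.le_bot ⟨hp, h2⟩)
  obtain ⟨θ, ⟨hθ1, hθ2⟩, hθ⟩ := exists_arg_Ico (p - gam v t) (phP φ t)
  have hpt : ∀ x : ℝ, 0 < x → x < R → gam v t + x * e θ ∈ Metric.ball p R := by
    intro x hx0 hx1
    have : p = gam v t + R * e θ := by rw [← hθ]; ring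
    rw [Metric.mem_ball, dist_eq_norm]
    have : gam v t + x * e θ - p = ((x - R : ℝ) : ℂ) * e θ := by rw [this]; push_cast; ring
    rw [this, norm_mul, norm_e, mul_one, Complex.norm_real, Real.norm_eq_abs, abs_lt]
    constructor <;> linarith
  have hno : ∀ a, (∃ ε > 0, ∀ x : ℝ, 0 ≤ x → x < ε → gam v t + x * e a ∈ range (gam v)) →
      θ ≠ a := by
    rintro a ⟨ε, hε, hx⟩ rfl
    have h1 := hx (min ε R / 2) (by positivity) (by have := min_le_left ε R; have := lt_min hε hRpos; linarith)
    have h2 := hball (hpt (min ε R / 2) (by positivity) (by have := min_le_right ε R; have := lt_min hε hRpos; linarith))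
    exact hJ _ h2 h1
  have hn1 := hno _ (h.ray_out t)
  have hn2 := hno _ (h.ray_in t)
  have hcontra : ∀ ρ > 0, (∀ r ∈ Ioo 0 ρ, gam v t + (r : ℝ) * e θ ∈ O') → False := by
    intro ρ hρ hr
    have h0 := lt_min hρ hRpos
    have h1 := hr (min ρ R / 2) ⟨by positivity, by have := min_le_left ρ R; linarith⟩
    have h2 := hball (hpt (min ρ R / 2) (by positivity) (by have := min_le_right ρ R; linarith))
    exact hd.le_bot ⟨h2, h1⟩
  rcases lt_or_gt_of_ne hn2 with h2 | h2
  · left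
    refine hL t ?_
    rcases h.LG_dich t hO hO' hd hc with h3 | h3
    · exact h3
    · obtain ⟨ρ, hρ, h3⟩ := h3
      exact (hcontra ρ hρ (h3 θ ⟨lt_of_le_of_ne hθ1 (Ne.symm hn1), h2⟩)).elim
  · right
    refine hR t ?_
    rcases h.RG_dich t hO hO' hd hc with h3 | h3
    · exact h3
    · obtain ⟨ρ, hρ, h3⟩ := h3
      exact (hcontra ρ hρ (h3 θ ⟨h2, hθ2⟩)).elim

end IsPg

end MS

namespace MS

/-- a region bounded by a simple closed polygon -/
structure IsReg (X : Set ℂ) (N : ℤ) (v : ℤ → ℂ) (φ : ℤ → ℝ) : Prop where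
  pg : IsPg N v φ
  comp : IsCompact X
  reg : X = closure (interior X)
  fr : frontier X = range (gam v)

/-- last point of a compact set along a ray -/
lemma last_pt {X : Set ℂ} (hX : IsCompact X) {z : ℂ} {δ r : ℝ} (h : z + r * e δ ∈ X) :
    ∃ r', r ≤ r' ∧ z + (r' : ℝ) * e δ ∈ frontier X := by
  let S : Set ℝ := {x | z + (x : ℝ) * e δ ∈ X}
  have hcont : Continuous (fun x : ℝ => z + (x : ℂ) * e δ) := by fun_prop
  have hScl : IsClosed S := hX.isClosed.preimage hcont
  have hbdd : BddAbove S := by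
    obtain ⟨R, hR⟩ := hX.isBounded.subset_closedBall z
    refine ⟨R, fun x hx => ?_⟩
    have := hR hx
    simp only [mem_closedBall_iff_norm, add_sub_cancel_left, norm_mul, norm_e, mul_one,
      Complex.norm_real, Real.norm_eq_abs] at this
    exact (le_abs_self x).trans this
  have hne : S.Nonempty := ⟨r, h⟩
  refine ⟨sSup S, le_csSup hbdd h, ?_⟩
  have hmem : sSup S ∈ S := hScl.csSup_mem hne hbdd
  refine ⟨subset_closure hmem, fun hintr => ?_⟩
  have : ∀ᶠ x in nhds (sSup S), z + (x : ℝ) * e δ ∈ X :=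
    hcont.continuousAt.eventually_mem (mem_interior_iff_mem_nhds.1 hintr)
  obtain ⟨x, hx1, hx2⟩ := ((this.filter_mono nhdsWithin_le_nhds).and
    (self_mem_nhdsWithin : Ioi (sSup S) ∈ nhdsWithin _ _)).exists
  exact absurd (le_csSup hbdd (show x ∈ S from hx1)) (not_le.2 hx2)

namespace IsPg

variable {N : ℤ} {v : ℤ → ℂ} {φ : ℤ → ℝ} (h : IsPg N v φ)
include h

lemma LG_disj {t : ℝ} {O O' : Set ℂ} (h1 : LG v φ t O) (h2 : LG v φ t O') :
    (O ∩ O').Nonempty := by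
  obtain ⟨η, hη, hh⟩ := h.LG_near h1
  exact hh t (by simpa using hη) _ h2

lemma RG_disj {t : ℝ} {O O' : Set ℂ} (h1 : RG v φ t O) (h2 : RG v φ t O') :
    (O ∩ O').Nonempty := by
  obtain ⟨η, hη, hh⟩ := h.RG_near h1
  exact hh t (by simpa using hη) _ h2

lemma germs3 {A B C : Set ℂ} (hA : IsOpen A) (hB : IsOpen B) (hC : IsOpen C)
    (hAB : Disjoint A B) (hAC : Disjoint A C) (hBC : Disjoint B C)
    (hc : (range (gam v))ᶜ = A ∪ (B ∪ C)) (nA : A.Nonempty) (nB : B.Nonempty) (nC : C.Nonempty) :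
    False := by
  have hsub : ∀ z, (z ∈ A ∨ z ∈ B ∨ z ∈ C) → z ∉ range (gam v) := fun z hz => by
    have : z ∈ (range (gam v))ᶜ := by rw [hc]; exact hz
    exact this
  have g1 := h.germs hA (hB.union hC) (disjoint_union_right.2 ⟨hAB, hAC⟩) hc.subset
    (fun z hz => hsub z (Or.inl hz)) nA
  have g2 := h.germs hB (hA.union hC) (disjoint_union_right.2 ⟨hAB.symm, hBC⟩)
    (by rw [hc]; intro z; simp only [mem_union]; tauto) (fun z hz => hsub z (Or.inr (Or.inl hz))) nB
  have g3 := h.germs hC (hA.union hB) (disjoint_union_right.2 ⟨hAC.symm, hBC.symm⟩)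
    (by rw [hc]; intro z; simp only [mem_union]; tauto) (fun z hz => hsub z (Or.inr (Or.inr hz))) nC
  have f : ∀ {P Q : Set ℂ}, Disjoint P Q → (P ∩ Q).Nonempty → False := fun hd hn => by
    rw [hd.inter_eq] at hn; simp at hn
  rcases g1 with g1 | g1 <;> rcases g2 with g2 | g2 <;> rcases g3 with g3 | g3
  · exact f hAB (h.LG_disj (g1 0) (g2 0))
  · exact f hAB (h.LG_disj (g1 0) (g2 0))
  · exact f hAC (h.LG_disj (g1 0) (g3 0))
  · exact f hBC (h.RG_disj (g2 0) (g3 0))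
  · exact f hBC (h.LG_disj (g2 0) (g3 0))
  · exact f hAC (h.RG_disj (g1 0) (g3 0))
  · exact f hAB (h.RG_disj (g1 0) (g2 0))
  · exact f hAB (h.RG_disj (g1 0) (g2 0))

lemma preconn_aux {S T : Set ℂ} (hS : IsOpen S) (hT : IsOpen T) (hST : Disjoint S T)
    (hc : (range (gam v))ᶜ = S ∪ T) (nT : T.Nonempty) : IsPreconnected S := by
  intro u w hu hw hsub hnu hnw
  by_contra hcon
  rw [not_nonempty_iff_eq_empty] at hcon
  refine h.germs3 (hS.inter hu) (hS.inter hw) hT ?_ (hST.mono_left inter_subset_left)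
    (hST.mono_left inter_subset_left) ?_ hnu hnw nT
  · rw [disjoint_iff_inter_eq_empty, ← hcon]; ext z; simp only [mem_inter_iff]; tauto
  · rw [hc]; ext z; simp only [mem_union, mem_inter_iff]
    constructor
    · rintro (h1 | h1)
      · rcases hsub h1 with h2 | h2 <;> tauto
      · tauto
    · tauto

/-- the norm on the curve is maximised at a vertex -/
lemma exists_max : ∃ k : ℤ, ∀ t, ‖gam v t‖ ≤ ‖v k‖ := by
  have hN := h.hN
  obtain ⟨k, -, hk⟩ := (Finset.Ico 0 N).exists_max_image (fun k => ‖v k‖) ⟨0, by simp [hN]⟩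
  have hall : ∀ j, ‖v j‖ ≤ ‖v k‖ := by
    intro j
    have h1 := hk (j % N) (by
      simp only [Finset.mem_Ico]; exact ⟨Int.emod_nonneg _ hN.ne', Int.emod_lt_of_pos _ hN⟩)
    have h2 : v (j % N + (j / N) * N) = v (j % N) := per_mul h.per _ _
    rw [Int.emod_add_ediv_mul] at h2
    rwa [h2]
  refine ⟨k, fun t => ?_⟩
  have h0 := Int.fract_nonneg t
  have h1 := (Int.fract_lt_one t).le
  have : gam v t = ((1 - Int.fract t : ℝ) : ℂ) * v ⌊t⌋ + ((Int.fract t : ℝ) : ℂ) * v (⌊t⌋ + 1) := by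
    simp only [gam]; push_cast; ring
  rw [this]
  refine (norm_add_le _ _).trans ?_
  rw [norm_mul, norm_mul, Complex.norm_of_nonneg h0, Complex.norm_of_nonneg (by linarith)]
  nlinarith [hall ⌊t⌋, hall (⌊t⌋ + 1)]

end IsPg

lemma re_lt_of_norm_le {p q : ℂ} (h : ‖p‖ ≤ ‖q‖) (hne : p ≠ q) :
    (p - q).re * q.re + (p - q).im * q.im < 0 := by
  have h1 : ‖p‖ ^ 2 ≤ ‖q‖ ^ 2 := by gcongr
  rw [← Complex.normSq_eq_norm_sq, ← Complex.normSq_eq_norm_sq, Complex.normSq_apply,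
    Complex.normSq_apply] at h1
  have h2 : 0 < Complex.normSq (p - q) := Complex.normSq_pos.2 (sub_ne_zero.2 hne)
  rw [Complex.normSq_apply] at h2
  simp only [Complex.sub_re, Complex.sub_im] at *
  nlinarith

namespace IsReg

variable {X : Set ℂ} {N : ℤ} {v : ℤ → ℂ} {φ : ℤ → ℝ} (h : IsReg X N v φ)
include h

lemma compl_range : (range (gam v))ᶜ = interior X ∪ Xᶜ := by
  rw [← h.fr, h.comp.isClosed.frontier_eq]
  ext z; simp only [mem_compl_iff, mem_sdiff, mem_union, not_and, not_not]
  have := @interior_subset _ _ X z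
  tauto

lemma disj : Disjoint (interior X) Xᶜ :=
  disjoint_compl_right.mono_left interior_subset

lemma gam_mem (t : ℝ) : gam v t ∈ X := by
  have : gam v t ∈ frontier X := by rw [h.fr]; exact ⟨t, rfl⟩
  rw [h.comp.isClosed.frontier_eq] at this
  exact this.1

lemma int_nonempty : (interior X).Nonempty := by
  have : (closure (interior X)).Nonempty := by rw [← h.reg]; exact ⟨_, h.gam_mem 0⟩
  exact closure_nonempty_iff.1 this

omit h in
lemma compl_nonempty' {X : Set ℂ} (hX : IsCompact X) : Xᶜ.Nonempty := by
  rw [nonempty_compl]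
  intro h1
  exact noncompact_univ ℂ (h1 ▸ hX)

lemma preconn_int : IsPreconnected (interior X) :=
  h.pg.preconn_aux isOpen_interior h.comp.isClosed.isOpen_compl h.disj h.compl_range
    (compl_nonempty' h.comp)

lemma preconn_compl : IsPreconnected Xᶜ :=
  h.pg.preconn_aux h.comp.isClosed.isOpen_compl isOpen_interior h.disj.symm
    (by rw [h.compl_range, union_comm]) h.int_nonempty

lemma dich : ((∀ t, LG v φ t (interior X)) ∧ (∀ t, RG v φ t Xᶜ)) ∨
    ((∀ t, RG v φ t (interior X)) ∧ (∀ t, LG v φ t Xᶜ)) := by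
  have hr : ∀ z, (z ∈ interior X ∨ z ∈ Xᶜ) → z ∉ range (gam v) := fun z hz => by
    have : z ∈ (range (gam v))ᶜ := by rw [h.compl_range]; exact hz
    exact this
  have g1 := h.pg.germs isOpen_interior h.comp.isClosed.isOpen_compl h.disj h.compl_range.subset
    (fun z hz => hr z (Or.inl hz)) h.int_nonempty
  have g2 := h.pg.germs h.comp.isClosed.isOpen_compl isOpen_interior h.disj.symm
    (by rw [union_comm]; exact h.compl_range.subset)
    (fun z hz => hr z (Or.inr hz)) (compl_nonempty' h.comp)
  rcases g1 with g1 | g1 <;> rcases g2 with g2 | g2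
  · have := h.pg.LG_disj (g1 0) (g2 0)
    rw [h.disj.inter_eq] at this; simp at this
  · exact Or.inl ⟨g1, g2⟩
  · exact Or.inr ⟨g1, g2⟩
  · have := h.pg.RG_disj (g1 0) (g2 0)
    rw [h.disj.inter_eq] at this; simp at this

lemma norm_le {R : ℝ} (hR : ∀ t, ‖gam v t‖ ≤ R) {p : ℂ} (hp : p ∈ X) : ‖p‖ ≤ R := by
  obtain ⟨θ, hθ⟩ : ∃ θ, IsArg p θ := ⟨_, isArg_arg p⟩
  have : (0 : ℂ) + ‖p‖ * e θ ∈ X := by rw [zero_add, ← hθ]; exact hp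
  obtain ⟨r', hr, hm⟩ := last_pt h.comp this
  rw [h.fr] at hm
  obtain ⟨t, ht⟩ := hm
  have h1 := hR t
  rw [ht, zero_add, norm_mul, norm_e, mul_one, Complex.norm_real, Real.norm_eq_abs] at h1
  exact hr.trans ((le_abs_self _).trans h1)

lemma orient {Θ : ℝ × ℝ → ℝ} {c : ℝ} (hT : IsTheta N v φ Θ c) :
    (c = π ∧ (∀ t, LG v φ t (interior X)) ∧ (∀ t, RG v φ t Xᶜ)) ∨
    (c = -π ∧ (∀ t, RG v φ t (interior X)) ∧ (∀ t, LG v φ t Xᶜ)) := by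
  have hpi := pi_pos
  have hN := h.pg.nreal
  obtain ⟨k, hk⟩ := h.pg.exists_max
  have hpos : 0 < ‖v k‖ := by
    by_contra h0
    have h1 := hk k
    have h2 := hk ((k + 1 : ℤ) : ℝ)
    rw [gam_int] at h1 h2
    have h3 : v k = 0 := norm_le_zero_iff.1 (not_lt.1 h0)
    have h4 : v (k + 1) = 0 := norm_le_zero_iff.1 (by linarith)
    exact h.pg.edge_ne k (by rw [h3, h4]; simp)
  obtain ⟨β, hβ⟩ : ∃ β, IsArg (v k) β := ⟨_, isArg_arg _⟩
  have hcos : ∀ t : ℝ, k < t → t < k + N → cos (Θ (k, t) - β) < 0 := by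
    intro t h1 h2
    have ha := hT.arg k t h1 h2
    have hne := h.pg.gam_ne h1 h2
    rw [gam_int] at ha hne
    have h3 := re_lt_of_norm_le (hk t) (sub_ne_zero.1 hne)
    have hp2 := norm_pos_iff.2 hne
    rw [ha] at h3
    have e1 : (v k).re = ‖v k‖ * cos β := by
      conv_lhs => rw [hβ, Complex.re_ofReal_mul, e_re]
    have e2 : (v k).im = ‖v k‖ * sin β := by
      conv_lhs => rw [hβ, Complex.im_ofReal_mul, e_im]
    rw [e1, e2, Complex.re_ofReal_mul, Complex.im_ofReal_mul, e_re, e_im] at h3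
    rw [cos_sub]
    by_contra hc
    push Not at hc
    have := mul_nonneg (mul_pos hp2 hpos).le hc
    nlinarith
  obtain ⟨m, hm⟩ := lift_window (S := Ioo (k : ℝ) (k + N)) (f := fun t => Θ (k, t)) (δ := β)
    isPreconnected_Ioo (hT.cont.comp (by fun_prop) (fun t ht => ⟨ht.1, ht.2⟩)) (by
      intro t ht heq
      obtain ⟨m, hm⟩ := e_eq_iff.1 heq
      have := hcos t ht.1 ht.2
      rw [hm, show β + 2 * π * m - β = m * (2 * π) by ring, cos_int_mul_two_pi] at this
      linarith)
  have hwin : ∀ t : ℝ, k < t → t < k + N →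
      β + 2 * π * m + π / 2 < Θ (k, t) ∧ Θ (k, t) < β + 2 * π * m + 3 * (π / 2) := by
    intro t h1 h2
    obtain ⟨h3, h4⟩ := hm t ⟨h1, h2⟩
    have h5 := hcos t h1 h2
    have h6 : cos (Θ (k, t) - β) = cos (Θ (k, t) - (β + 2 * π * m)) := by
      rw [show Θ (k, t) - (β + 2 * π * m) = Θ (k, t) - β - m * (2 * π) by ring,
        cos_sub_int_mul_two_pi]
    rw [h6] at h5
    constructor
    · by_contra hc
      push Not at hc
      exact absurd (cos_nonneg_of_mem_Icc ⟨by linarith, by linarith⟩) (not_le.2 h5)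
    · by_contra hc
      push Not at hc
      have := cos_nonneg_of_mem_Icc (x := Θ (k, t) - (β + 2 * π * m) - 2 * π)
        ⟨by linarith, by linarith⟩
      rw [cos_sub_two_pi] at this
      linarith
  set b := β + 2 * π * m with hb
  have w1 := hwin (k + 1) (by linarith) (by linarith)
  rw [hT.edge k k (k + 1) le_rfl (by linarith) le_rfl] at w1
  have w2 := hwin (k - 1 + N) (by linarith) (by linarith)
  rw [hT.shift (k - 1) k (by linarith) (by linarith),
    hT.edge (k - 1) (k - 1) k (by push_cast; linarith) (by linarith) (by push_cast; linarith)] at w2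
  have ht := abs_lt.1 (h.pg.turn (k - 1))
  rw [sub_add_cancel] at ht
  -- outer point
  have hout : ∀ r : ℝ, 0 < r → gam v k + r * e (b + 2 * π) ∉ X := by
    intro r hr hmem
    have := h.norm_le hk hmem
    have hb2 : e (b + 2 * π) = e β := by
      have h1 := e_add_int b 1
      have h2 := e_add_int β m
      rw [Int.cast_one, mul_one] at h1
      rw [h1, hb, h2]
    rw [gam_int, hb2] at this
    have h2 : v k + r * e β = ((‖v k‖ + r : ℝ) : ℂ) * e β := by
      conv_lhs => rw [hβ]
      push_cast; ring
    rw [h2, norm_mul, norm_e, mul_one, Complex.norm_of_nonneg (by linarith)] at this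
    linarith
  obtain ⟨n, hn⟩ := hT.c_eq
  have hc1 : (-2 : ℝ) < n := by by_contra hc; push Not at hc; nlinarith
  have hc2 : (n : ℝ) < 1 := by by_contra hc; push Not at hc; nlinarith
  have hc1 : -2 < n := by exact_mod_cast hc1
  have hc2 : n < 1 := by exact_mod_cast hc2
  have hn' : n = 0 ∨ n = -1 := by omega
  have pP := phP_int φ k
  have pM := phM_int φ k
  rcases hn' with rfl | rfl
  · left
    have hcp : c = π := by rw [hn]; simp
    refine ⟨hcp, ?_⟩
    rcases h.dich with hd | hd
    · exact hd
    · obtain ⟨ρ, hρ, hg⟩ := hd.1 k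
      have := hg (b + 2 * π) ⟨by linarith, by linarith⟩ (ρ / 2) ⟨by linarith, by linarith⟩
      exact (hout _ (by linarith) (interior_subset this)).elim
  · right
    have hcp : c = -π := by rw [hn]; push_cast; ring
    refine ⟨hcp, ?_⟩
    rcases h.dich with hd | hd
    · obtain ⟨ρ, hρ, hg⟩ := hd.1 k
      have := hg (b + 2 * π) ⟨by linarith, by linarith⟩ (ρ / 2) ⟨by linarith, by linarith⟩
      exact (hout _ (by linarith) (interior_subset this)).elim
    · exact hd

end IsReg

end MS

namespace MS

/-- behaviour of a lift along a straight edge -/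
lemma edge_lift {w σ : ℂ} {φ : ℝ} (hσ : IsArg σ φ) (hσ0 : σ ≠ 0) {f : ℝ → ℝ}
    (hf : ContinuousOn f (Icc 0 1)) (ha : ∀ x ∈ Icc (0 : ℝ) 1, IsArg (w + x * σ) (f x))
    (h0 : ∀ x ∈ Icc (0 : ℝ) 1, w + x * σ ≠ 0) :
    (∀ x ∈ Icc (0 : ℝ) 1, f x = f 0) ∨ ∃ k : ℤ,
      (∀ x ∈ Icc (0 : ℝ) 1, k * π < φ - f x ∧ φ - f x < k * π + π) ∧
      ((Even k ∧ MonotoneOn f (Icc 0 1)) ∨ (Odd k ∧ AntitoneOn f (Icc 0 1))) := by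
  have hpi := pi_pos
  have hσp : 0 < ‖σ‖ := norm_pos_iff.2 hσ0
  have hcr : ∀ x ∈ Icc (0 : ℝ) 1, cr w σ = ‖w + x * σ‖ * ‖σ‖ * sin (φ - f x) := by
    intro x hx
    rw [← (ha x hx).cr_eq hσ, cr_add_left, cr_smul_left, cr_self]; ring
  have hcr2 : ∀ x ∈ Icc (0 : ℝ) 1, ∀ y ∈ Icc (0 : ℝ) 1, (y - x) * cr w σ =
      ‖w + x * σ‖ * ‖w + y * σ‖ * sin (f y - f x) := by
    intro x hx y hy
    rw [← (ha x hx).cr_eq (ha y hy)]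
    simp only [cr, Complex.add_re, Complex.add_im, Complex.re_ofReal_mul, Complex.im_ofReal_mul]
    ring
  have hn : ∀ x ∈ Icc (0 : ℝ) 1, 0 < ‖w + x * σ‖ := fun x hx => norm_pos_iff.2 (h0 x hx)
  by_cases hκ : cr w σ = 0
  · left
    intro x hx
    have key : ∀ y ∈ Icc (0 : ℝ) 1, e (2 * f y) = e (2 * φ) * e ((fun _ => 0 : ℝ → ℝ) y) := by
      intro y hy
      have h1 := hcr y hy
      rw [hκ] at h1
      have h2 : sin (φ - f y) = 0 := by
        have := mul_pos (hn y hy) hσp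
        rcases mul_eq_zero.1 h1.symm with h3 | h3
        · exact absurd h3 this.ne'
        · exact h3
      obtain ⟨n, hn⟩ := sin_eq_zero_iff.1 h2
      rw [← e_add, e_eq_iff]
      exact ⟨-n, by push_cast; linarith⟩
    have := two_lifts (f := fun x => 2 * f x) (g := fun _ => 0) isPreconnected_Icc
      (continuousOn_const.mul hf) continuousOn_const key hx (left_mem_Icc.2 zero_le_one)
    simpa using this
  · right
    obtain ⟨m, hm⟩ := lift_window (f := fun x => 2 * f x) (δ := 2 * φ) isPreconnected_Icc
      (continuousOn_const.mul hf) (by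
        intro x hx heq
        obtain ⟨m, hm⟩ := e_eq_iff.1 heq
        apply hκ
        rw [hcr x hx, show φ - f x = -((m : ℤ) * π) by linarith, sin_neg, sin_int_mul_pi]; simp)
    have hwin : ∀ x ∈ Icc (0 : ℝ) 1, ((-m - 1 : ℤ) : ℝ) * π < φ - f x ∧
        φ - f x < ((-m - 1 : ℤ) : ℝ) * π + π := by
      intro x hx
      obtain ⟨h1, h2⟩ := hm x hx
      push_cast
      constructor <;> nlinarith
    refine ⟨-m - 1, hwin, ?_⟩
    have h00 : (0 : ℝ) ∈ Icc (0 : ℝ) 1 := left_mem_Icc.2 zero_le_one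
    set k := -m - 1
    have hsin : sin (φ - f 0) = (-1) ^ k * sin (φ - f 0 - k * π) := by
      rw [show φ - f 0 = φ - f 0 - k * π + k * π by ring, sin_add_int_mul_pi]; simp
    have hsp : 0 < sin (φ - f 0 - k * π) := by
      have := hwin 0 h00
      exact sin_pos_of_pos_of_lt_pi (by linarith) (by linarith)
    have hsmall : ∀ x ∈ Icc (0 : ℝ) 1, ∀ y ∈ Icc (0 : ℝ) 1, |f y - f x| < π := by
      intro x hx y hy
      have h1 := hwin x hx
      have h2 := hwin y hy
      rw [abs_lt]; constructor <;> linarith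
    have hpp := mul_pos (hn 0 h00) hσp
    rcases Int.even_or_odd k with hk | hk
    · left
      refine ⟨hk, fun x hx y hy hxy => ?_⟩
      rw [hk.neg_one_zpow, one_mul] at hsin
      have h1 : 0 < cr w σ := by rw [hcr 0 h00, hsin]; positivity
      by_contra hlt
      push Not at hlt
      have h2 := hcr2 x hx y hy
      have h3 := abs_lt.1 (hsmall x hx y hy)
      have h4 := sin_neg_of_neg_of_neg_pi_lt (x := f y - f x) (by linarith) (by linarith)
      have h5 := mul_pos (hn x hx) (hn y hy)
      have h6 : 0 ≤ (y - x) * cr w σ := mul_nonneg (by linarith) h1.le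
      have h7 := mul_neg_of_pos_of_neg h5 h4
      linarith
    · right
      refine ⟨hk, fun x hx y hy hxy => ?_⟩
      rw [hk.neg_one_zpow] at hsin
      have h1 : cr w σ < 0 := by
        rw [hcr 0 h00, hsin]
        have := mul_pos hpp hsp
        nlinarith
      by_contra hlt
      push Not at hlt
      have h2 := hcr2 x hx y hy
      have h3 := abs_lt.1 (hsmall x hx y hy)
      have h4 := sin_pos_of_pos_of_lt_pi (x := f y - f x) (by linarith) (by linarith)
      have h5 := mul_pos (hn x hx) (hn y hy)
      have h6 : (y - x) * cr w σ ≤ 0 := mul_nonpos_of_nonneg_of_nonpos (by linarith) h1.le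
      have h7 := mul_pos h5 h4
      linarith

/-- admissible change of angle along an edge of direction `φ` -/
structure StepOK (φ U U' : ℝ) : Prop where
  s1 : π < φ - U → π < φ - U'
  s2 : 2 * π ≤ φ - U → 2 * π ≤ φ - U'
  s3 : π < φ - U → φ - U < 2 * π → U' ≤ U

lemma edge_step {w σ : ℂ} {φ : ℝ} (hσ : IsArg σ φ) (hσ0 : σ ≠ 0) {f : ℝ → ℝ}
    (hf : ContinuousOn f (Icc 0 1)) (ha : ∀ x ∈ Icc (0 : ℝ) 1, IsArg (w + x * σ) (f x))
    (h0 : ∀ x ∈ Icc (0 : ℝ) 1, w + x * σ ≠ 0) :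
    StepOK φ (f 0) (f 1) ∧ ∀ x ∈ Icc (0 : ℝ) 1, f x ≤ max (f 0) (f 1) ∧ min (f 0) (f 1) ≤ f x := by
  have hpi := pi_pos
  have h00 : (0 : ℝ) ∈ Icc (0 : ℝ) 1 := left_mem_Icc.2 zero_le_one
  have h11 : (1 : ℝ) ∈ Icc (0 : ℝ) 1 := right_mem_Icc.2 zero_le_one
  rcases edge_lift hσ hσ0 hf ha h0 with hc | ⟨k, hk, hmon⟩
  · have h1 := hc 1 h11
    refine ⟨⟨?_, ?_, ?_⟩, fun x hx => ?_⟩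
    · rw [h1]; exact id
    · rw [h1]; exact id
    · rw [h1]; exact fun _ _ => le_rfl
    · rw [hc x hx, h1]; simp
  · have hk0 := hk 0 h00
    have hk1 := hk 1 h11
    refine ⟨⟨?_, ?_, ?_⟩, fun x hx => ?_⟩
    · intro h
      have : (0 : ℝ) < k := by by_contra hcon; push Not at hcon; nlinarith
      have : 1 ≤ k := by have : 0 < k := by exact_mod_cast this
                         omega
      have : (1 : ℝ) ≤ k := by exact_mod_cast this
      nlinarith
    · intro h
      have : (1 : ℝ) < k := by by_contra hcon; push Not at hcon; nlinarith
      have : 2 ≤ k := by have : 1 < k := by exact_mod_cast this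
                         omega
      have : (2 : ℝ) ≤ k := by exact_mod_cast this
      nlinarith
    · intro h h'
      have a1 : (0 : ℝ) < k := by by_contra hcon; push Not at hcon; nlinarith
      have a2 : (k : ℝ) < 2 := by by_contra hcon; push Not at hcon; nlinarith
      have : k = 1 := by
        have a1 : 0 < k := by exact_mod_cast a1
        have a2 : k < 2 := by exact_mod_cast a2
        omega
      subst this
      rcases hmon with ⟨he, -⟩ | ⟨-, hm⟩
      · exact absurd he (by decide)
      · exact hm h00 h11 zero_le_one
    · rcases hmon with ⟨-, hm⟩ | ⟨-, hm⟩
      · exact ⟨le_max_of_le_right (hm hx h11 hx.2), min_le_of_left_le (hm h00 hx hx.1)⟩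
      · exact ⟨le_max_of_le_left (hm h00 hx hx.1), min_le_of_right_le (hm hx h11 hx.2)⟩

/-- the combinatorial lemma -/
lemma glem_aux {α : ℝ} (hα : α < π) {A L : ℤ → ℝ} (hA : ∀ i j, i ≤ j → A i - α ≤ A j)
    (hL : ∀ i j, i ≤ j → L i - α ≤ L j) {U : ℤ → ℤ → ℝ}
    (sA : ∀ i j, StepOK (A i) (U i j) (U (i + 1) j))
    (sL : ∀ i j, StepOK (L j) (U i j) (U i (j + 1))) (i' j' : ℤ) :
    ∀ n : ℕ, ∀ i j : ℤ, i ≤ i' → j ≤ j' → (i' - i) + (j' - j) = n + 1 → ∀ M, 2 * π + U i j ≤ M →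
      (∀ k, i ≤ k → k < i' → M - α ≤ A k) → (∀ k, j ≤ k → k < j' → M - α ≤ L k) →
      (i < i' → A (i' - 1) ≤ U i' j' + π) → (j < j' → L (j' - 1) ≤ U i' j' + π) → False := by
  have hpi := pi_pos
  have hα0 : 0 ≤ α := by have := hA 0 0 le_rfl; linarith
  intro n
  induction n with
  | zero =>
    intro i j hi hj hs M hM mA mL eA eL
    rcases eq_or_lt_of_le hi with rfl | hi'
    · have : j' = j + 1 := by push_cast at hs; omega
      subst this
      have h1 := mL j le_rfl (by omega)
      have h2 := (sL i j).s1 (by linarith)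
      have h3 := eL (by omega)
      rw [add_sub_cancel_right] at h3
      linarith
    · have : i' = i + 1 := by push_cast at hs; omega
      subst this
      have : j = j' := by push_cast at hs; omega
      subst this
      have h1 := mA i le_rfl (by omega)
      have h2 := (sA i j).s1 (by linarith)
      have h3 := eA (by omega)
      rw [add_sub_cancel_right] at h3
      linarith
  | succ n ih =>
    intro i j hi hj hs M hM mA mL eA eL
    -- advance along A
    have advA : i < i' → (j < j' → A i ≤ L j) → False := by
      intro hlt hle
      have h1 := mA i le_rfl hlt
      rcases lt_or_ge (A i - U i j) (2 * π) with h2 | h2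
      · have h3 := (sA i j).s3 (by linarith) h2
        exact ih (i + 1) j (by omega) hj (by push_cast at hs ⊢; omega) M (by linarith)
          (fun k hk hk' => mA k (by omega) hk') mL (fun _ => eA hlt) eL
      · have h3 := (sA i j).s2 h2
        exact ih (i + 1) j (by omega) hj (by push_cast at hs ⊢; omega) (A i) (by linarith)
          (fun k hk hk' => hA i k (by omega))
          (fun k hk hk' => by have := hL j k hk; have := hle (by omega); linarith)
          (fun _ => eA hlt) eL
    have advL : j < j' → (i < i' → L j ≤ A i) → False := by
      intro hlt hle
      have h1 := mL j le_rfl hlt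
      rcases lt_or_ge (L j - U i j) (2 * π) with h2 | h2
      · have h3 := (sL i j).s3 (by linarith) h2
        exact ih i (j + 1) hi (by omega) (by push_cast at hs ⊢; omega) M (by linarith)
          mA (fun k hk hk' => mL k (by omega) hk') eA (fun _ => eL hlt)
      · have h3 := (sL i j).s2 h2
        exact ih i (j + 1) hi (by omega) (by push_cast at hs ⊢; omega) (L j) (by linarith)
          (fun k hk hk' => by have := hA i k hk; have := hle (by omega); linarith)
          (fun k hk hk' => hL j k (by omega)) eA (fun _ => eL hlt)
    rcases eq_or_lt_of_le hi with hi0 | hi0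
    · exact advL (by push_cast at hs; omega) (fun h => by omega)
    · rcases eq_or_lt_of_le hj with hj0 | hj0
      · exact advA hi0 (fun h => by omega)
      · rcases le_total (A i) (L j) with hc | hc
        · exact advA hi0 (fun _ => hc)
        · exact advL hj0 (fun _ => hc)

lemma glem {α : ℝ} (hα : α < π) {A L : ℤ → ℝ} (hA : ∀ i j, i ≤ j → A i - α ≤ A j)
    (hL : ∀ i j, i ≤ j → L i - α ≤ L j) {U : ℤ → ℤ → ℝ}
    (sA : ∀ i j, StepOK (A i) (U i j) (U (i + 1) j))
    (sL : ∀ i j, StepOK (L j) (U i j) (U i (j + 1))) {i j i' j' : ℤ} (hi : i ≤ i') (hj : j ≤ j')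
    (hne : i < i' ∨ j < j')
    (eA : i < i' → A (i' - 1) ≤ U i' j' + π) (eL : j < j' → L (j' - 1) ≤ U i' j' + π)
    (bA : i < i' → U i j + 2 * π ≤ A i) (bL : j < j' → U i j + 2 * π ≤ L j) : False := by
  refine glem_aux hα hA hL sA sL i' j' ((i' - i) + (j' - j) - 1).toNat i j hi hj (by omega) _ le_rfl
    (fun k hk hk' => ?_) (fun k hk hk' => ?_) eA eL
  · linarith [hA i k hk, bA (by omega)]
  · linarith [hL j k hk, bL (by omega)]

end MS

namespace MS

/-- a positively oriented polygonal region of angular convexity at least `-α` -/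
structure IsGd (X : Set ℂ) (N : ℤ) (v : ℤ → ℂ) (φ : ℤ → ℝ) (α : ℝ) : Prop
    extends IsReg X N v φ where
  phper : ∀ k, φ (k + N) = φ k + 2 * π
  aco : ∀ i j, i ≤ j → φ i - α ≤ φ j

/-- the rays from `z` in directions from the open interval `(a, a + ℓ)` avoid `X` -/
def FreeArc (X : Set ℂ) (z : ℂ) (a ℓ : ℝ) : Prop :=
  ∀ δ ∈ Ioo a (a + ℓ), ∀ r : ℝ, 0 < r → z + r * e δ ∉ X

lemma phper_mul {φ : ℤ → ℝ} {N : ℤ} (h : ∀ k, φ (k + N) = φ k + 2 * π) (k m : ℤ) :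
    φ (k + m * N) = φ k + 2 * π * m := by
  induction m using Int.induction_on with
  | zero => simp
  | succ n ih =>
    rw [show k + (↑n + 1) * N = k + n * N + N by ring, h, ih]; push_cast; ring
  | pred n ih =>
    have := h (k + (-↑n - 1) * N)
    rw [show k + (-↑n - 1) * N + N = k + -↑n * N by ring, ih] at this
    push_cast at *; linarith

lemma sin_nonpos_interval {a b U : ℝ} (hab : a < b) (h : ∀ ψ ∈ Ioo a b, sin (ψ - U) ≤ 0) :
    ∃ κ : ℤ, U + π + 2 * π * κ ≤ a ∧ b ≤ U + 2 * π + 2 * π * κ := by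
  have hpi := pi_pos
  set κ := ⌊(a - U - π) / (2 * π)⌋ with hκ
  have h1 : (κ : ℝ) * (2 * π) ≤ a - U - π := by
    rw [← le_div_iff₀ (by positivity)]; exact Int.floor_le _
  have h2 : a - U - π < (κ + 1 : ℝ) * (2 * π) := by
    rw [← div_lt_iff₀ (by positivity)]; exact Int.lt_floor_add_one _
  have key : ∀ ψ ∈ Ioo a b, U + 2 * π + 2 * π * κ < ψ → ψ < U + 3 * π + 2 * π * κ → False := by
    intro ψ hψ h3 h4
    have h5 := h ψ hψ
    have h6 := sin_pos_of_pos_of_lt_pi (x := ψ - U - (κ + 1 : ℤ) * (2 * π))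
      (by push_cast; linarith) (by push_cast; linarith)
    rw [sin_sub_int_mul_two_pi] at h6
    linarith
  refine ⟨κ, by linarith, ?_⟩
  by_contra hcon
  push Not at hcon
  rcases le_total (U + 2 * π + 2 * π * κ) a with h3 | h3
  · have h0 : a < min b (U + 3 * π + 2 * π * κ) := lt_min hab (by linarith)
    obtain ⟨ψ, hψ1, hψ2⟩ := exists_between h0
    exact key ψ ⟨hψ1, hψ2.trans_le (min_le_left _ _)⟩ (by linarith)
      (hψ2.trans_le (min_le_right _ _))
  · have h0 : U + 2 * π + 2 * π * κ < min b (U + 3 * π + 2 * π * κ) := lt_min hcon (by linarith)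
    obtain ⟨ψ, hψ1, hψ2⟩ := exists_between h0
    exact key ψ ⟨by linarith, hψ2.trans_le (min_le_left _ _)⟩ hψ1
      (hψ2.trans_le (min_le_right _ _))

lemma exists_max_per {g : ℤ → ℤ → ℝ} {N M : ℤ} (hN : 0 < N) (hM : 0 < M)
    (p1 : ∀ i j, g (i + N) j = g i j) (p2 : ∀ i j, g i (j + M) = g i j) :
    ∃ k l, ∀ i j, g i j ≤ g k l := by
  obtain ⟨⟨k, l⟩, -, hk⟩ := ((Finset.Ico 0 N) ×ˢ (Finset.Ico 0 M)).exists_max_image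
    (fun p => g p.1 p.2) ⟨(0, 0), by simp [hN, hM]⟩
  refine ⟨k, l, fun i j => ?_⟩
  have h1 := hk (i % N, j % M) (by
    simp only [Finset.mem_product, Finset.mem_Ico]
    exact ⟨⟨Int.emod_nonneg _ hN.ne', Int.emod_lt_of_pos _ hN⟩,
      ⟨Int.emod_nonneg _ hM.ne', Int.emod_lt_of_pos _ hM⟩⟩)
  have h2 : g (i % N + (i / N) * N) j = g (i % N) j :=
    per_mul (v := fun i => g i j) (fun i => p1 i j) _ _
  have h3 : g (i % N) (j % M + (j / M) * M) = g (i % N) (j % M) :=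
    per_mul (v := fun j => g (i % N) j) (fun j => p2 _ j) _ _
  rw [Int.emod_add_ediv_mul] at h2 h3
  rw [h2, h3]
  exact h1

lemma IsPg.gam_step {N : ℤ} {v : ℤ → ℂ} {φ : ℤ → ℝ} (h : IsPg N v φ) {q : ℂ} {f : ℝ → ℝ}
    (hf : Continuous f) (ha : ∀ t, IsArg (gam v t + q) (f t)) (h0 : ∀ t, gam v t + q ≠ 0) (k : ℤ) :
    StepOK (φ k) (f k) (f (k + 1 : ℤ)) ∧ ∀ t : ℝ, k ≤ t → t ≤ k + 1 →
      f t ≤ max (f k) (f (k + 1 : ℤ)) ∧ min (f k) (f (k + 1 : ℤ)) ≤ f t := by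
  have hg : ∀ x ∈ Icc (0 : ℝ) 1, gam v (k + x) + q = v k + q + x * (v (k + 1) - v k) := by
    intro x hx
    rw [gam_edge v (k := k) (by linarith [hx.1]) (by linarith [hx.2]), add_sub_cancel_left]; ring
  have := edge_step (w := v k + q) (h.arg k) (h.edge_ne k) (f := fun x => f (k + x))
    (by fun_prop) (fun x hx => by rw [← hg x hx]; exact ha _)
    (fun x hx => by rw [← hg x hx]; exact h0 _)
  simp only [add_zero] at this
  push_cast
  refine ⟨this.1, fun t h1 h2 => ?_⟩
  have h3 := this.2 (t - k) ⟨by linarith, by linarith⟩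
  rw [add_sub_cancel] at h3
  exact h3

namespace IsGd

variable {X : Set ℂ} {N : ℤ} {v : ℤ → ℂ} {φ : ℤ → ℝ} {α : ℝ} (h : IsGd X N v φ α)
include h

lemma lg : (∀ t, LG v φ t (interior X)) ∧ (∀ t, RG v φ t Xᶜ) := by
  obtain ⟨Θ, c, hT⟩ := exists_theta h.pg
  have h1 := hT.phi_per h.pg 0
  have h2 := h.phper 0
  have hpi := pi_pos
  rcases h.toIsReg.orient hT with h3 | h3
  · exact h3.2
  · linarith [h3.1]

lemma alpha_nonneg : 0 ≤ α := by have := h.aco 0 0 le_rfl; linarith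

lemma type_aux {b : ℂ} (hb : b ∉ X) {f : ℝ → ℝ} (ha : ∀ t, IsArg (gam v t - b) (f t)) (i : ℤ)
    {ψ ε : ℝ} (hψ : ψ ∈ Ioo (φ i) (φ (i - 1) + π)) (hε : 0 < ε) :
    (0 < sin (ψ - f i) → ∃ η ∈ Ioo 0 ε, ∃ (t : ℝ) (m : ℤ), f t = f i + η + 2 * π * m) ∧
    (sin (ψ - f i) < 0 → ∃ η ∈ Ioo 0 ε, ∃ (t : ℝ) (m : ℤ), f t = f i - η + 2 * π * m) := by
  have hne : ∀ t, gam v t - b ≠ 0 := fun t h0 => hb (by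
    rw [← sub_eq_zero.1 h0]; exact h.gam_mem t)
  obtain ⟨ρ, hρ, hg⟩ := h.lg.1 i
  rw [phP_int, phM_int] at hg
  set U := f i with hU
  set d := ‖gam v i - b‖ with hd
  have hdp : 0 < d := norm_pos_iff.2 (hne i)
  -- the perturbed direction
  have main : ∀ τ ∈ Ioo 0 ρ, sin (ψ - U) ≠ 0 → ∃ (t : ℝ) (m : ℤ),
      f t = U + Complex.arg (1 + ((τ / d : ℝ) : ℂ) * e (ψ - U)) + 2 * π * m := by
    intro τ hτ hs
    set w : ℂ := 1 + ((τ / d : ℝ) : ℂ) * e (ψ - U) with hw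
    have him : w.im = τ / d * sin (ψ - U) := by
      rw [hw, Complex.add_im, Complex.im_ofReal_mul, e_im]; simp
    have hwne : w ≠ 0 := by
      intro h0
      rw [h0, Complex.zero_im] at him
      rcases mul_eq_zero.1 him.symm with h1 | h1
      · exact (div_pos hτ.1 hdp).ne' h1
      · exact hs h1
    have hp := interior_subset (hg ψ hψ τ hτ)
    have hpe : gam v i + τ * e ψ = b + ((d * ‖w‖ : ℝ) : ℂ) * e (U + Complex.arg w) := by
      rw [e_add, Complex.ofReal_mul, mul_mul_mul_comm, ← isArg_arg w, ← ha i, hw, e_sub]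
      have h1 := e_ne U
      have h2 : gam v i - b = d * e U := ha i
      have h3 : (d : ℂ) ≠ 0 := by exact_mod_cast hdp.ne'
      have h4 : gam v i = b + d * e U := by rw [← h2]; ring
      rw [h4]
      push_cast
      field_simp
      ring
    rw [hpe] at hp
    obtain ⟨r', hr', hfr⟩ := last_pt h.comp hp
    have hr0 : 0 < r' := lt_of_lt_of_le (mul_pos hdp (norm_pos_iff.2 hwne)) hr'
    rw [h.fr] at hfr
    obtain ⟨t, ht⟩ := hfr
    have h5 : gam v t - b = r' * e (U + Complex.arg w) := by rw [ht]; ring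
    have h6 := isArg_smul_e hr0.le (U + Complex.arg w)
    rw [← h5] at h6
    obtain ⟨m, hm⟩ := (ha t).unique (hne t) h6
    exact ⟨t, m, hm⟩
  have hcont : ContinuousAt (fun τ : ℝ => Complex.arg (1 + ((τ / d : ℝ) : ℂ) * e (ψ - U))) 0 := by
    refine ContinuousAt.comp (g := Complex.arg) (Complex.continuousAt_arg ?_) ?_
    · simp
    · fun_prop
  have hev : ∀ᶠ τ in nhds (0 : ℝ), |Complex.arg (1 + ((τ / d : ℝ) : ℂ) * e (ψ - U))| < ε := by
    refine (hcont.abs).eventually_lt continuousAt_const ?_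
    simpa using hε
  have hev2 : ∀ᶠ τ in nhds (0 : ℝ), τ < ρ := eventually_lt_nhds hρ
  obtain ⟨τ, ⟨h1, h2⟩, h3⟩ := (((hev.and hev2).filter_mono nhdsWithin_le_nhds).and
    (self_mem_nhdsWithin : Ioi (0 : ℝ) ∈ nhdsWithin 0 (Ioi 0))).exists
  have h3 : 0 < τ := h3
  set w : ℂ := 1 + ((τ / d : ℝ) : ℂ) * e (ψ - U) with hw
  have him : w.im = τ / d * sin (ψ - U) := by
    rw [hw, Complex.add_im, Complex.im_ofReal_mul, e_im]; simp
  have hq : 0 < τ / d := div_pos h3 hdp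
  constructor
  · intro hs
    obtain ⟨t, m, hm⟩ := main τ ⟨h3, h2⟩ hs.ne'
    have himp : 0 < w.im := by rw [him]; positivity
    have hpos : 0 < Complex.arg w := by
      refine lt_of_le_of_ne (Complex.arg_nonneg_iff.2 himp.le) (fun h0 => ?_)
      have := (Complex.arg_eq_zero_iff.1 h0.symm).2
      linarith
    exact ⟨_, ⟨hpos, (abs_lt.1 h1).2⟩, t, m, hm⟩
  · intro hs
    obtain ⟨t, m, hm⟩ := main τ ⟨h3, h2⟩ hs.ne
    have himp : w.im < 0 := by rw [him]; exact mul_neg_of_pos_of_neg hq hs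
    have hneg : Complex.arg w < 0 := Complex.arg_neg_iff.2 himp
    exact ⟨-Complex.arg w, ⟨by linarith, by linarith [(abs_lt.1 h1).1]⟩, t, m, by rw [hm]; ring⟩

lemma type_max {b : ℂ} (hb : b ∉ X) {f : ℝ → ℝ} (ha : ∀ t, IsArg (gam v t - b) (f t)) {c : ℝ}
    (hw : ∀ t, f t ∈ Ioo c (c + 2 * π)) {i : ℤ} (hmax : ∀ t, f t ≤ f i) :
    ∃ κ : ℤ, φ (i - 1) ≤ f i + π + 2 * π * κ ∧ f i + π + 2 * π * κ ≤ φ i := by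
  have hpi := pi_pos
  have ht := abs_lt.1 (h.pg.turn (i - 1))
  rw [sub_add_cancel] at ht
  obtain ⟨κ, h1, h2⟩ := sin_nonpos_interval (a := φ i) (b := φ (i - 1) + π) (U := f i)
    (by linarith) (by
      intro ψ hψ
      by_contra hs
      push Not at hs
      obtain ⟨η, ⟨e1, e2⟩, t, m, hm⟩ := (h.type_aux hb ha i hψ (ε := c + 2 * π - f i)
        (by linarith [(hw i).2])).1 hs
      have h3 := hmax t
      have h4 := (hw t).1
      have h5 : (m : ℝ) < 0 := by by_contra hc; push Not at hc; nlinarith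
      have h5 : m < 0 := by exact_mod_cast h5
      have h6 : m ≤ -1 := by omega
      have h6 : (m : ℝ) ≤ -1 := by exact_mod_cast h6
      nlinarith)
  exact ⟨κ, by linarith, by linarith⟩

lemma type_min {b : ℂ} (hb : b ∉ X) {f : ℝ → ℝ} (ha : ∀ t, IsArg (gam v t - b) (f t)) {c : ℝ}
    (hw : ∀ t, f t ∈ Ioo c (c + 2 * π)) {i : ℤ} (hmin : ∀ t, f i ≤ f t) :
    ∃ κ : ℤ, φ (i - 1) ≤ f i + 2 * π + 2 * π * κ ∧ f i + 2 * π + 2 * π * κ ≤ φ i := by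
  have hpi := pi_pos
  have ht := abs_lt.1 (h.pg.turn (i - 1))
  rw [sub_add_cancel] at ht
  obtain ⟨κ, h1, h2⟩ := sin_nonpos_interval (a := φ i) (b := φ (i - 1) + π) (U := f i + π)
    (by linarith) (by
      intro ψ hψ
      rw [← sub_sub, sin_sub_pi]
      by_contra hs
      push Not at hs
      obtain ⟨η, ⟨e1, e2⟩, t, m, hm⟩ := (h.type_aux hb ha i hψ (ε := f i - c)
        (by linarith [(hw i).1])).2 (by linarith)
      have h3 := hmin t
      have h4 := (hw t).2
      have h5 : (0 : ℝ) < m := by by_contra hc; push Not at hc; nlinarith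
      have h5 : 0 < m := by exact_mod_cast h5
      have h6 : (1 : ℝ) ≤ m := by exact_mod_cast h5
      nlinarith)
  exact ⟨κ, by linarith, by linarith⟩

lemma max_shift {f : ℝ → ℝ} (hp : ∀ t, f (t + N) = f t) {i : ℤ} {c : ℝ}
    (hκ : ∃ κ : ℤ, φ (i - 1) ≤ f i + c + 2 * π * κ ∧ f i + c + 2 * π * κ ≤ φ i) :
    ∃ i' : ℤ, f i' = f i ∧ (∃ m, i' = i + m * N) ∧ φ (i' - 1) ≤ f i' + c ∧ f i' + c ≤ φ i' := by
  obtain ⟨κ, h1, h2⟩ := hκ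
  have hp' : f ((i + (-κ) * N : ℤ) : ℝ) = f i := by
    have := per_mul (v := fun i : ℤ => f i) (N := N) (fun i => by push_cast; exact hp i) i (-κ)
    exact this
  refine ⟨i + (-κ) * N, hp', ⟨_, rfl⟩, ?_, ?_⟩
  · rw [hp', show i + -κ * N - 1 = (i - 1) + -κ * N by ring, phper_mul h.phper]
    push_cast; linarith
  · rw [hp', phper_mul h.phper]
    push_cast; linarith

/-- window and periodicity of lifts around a point with a free ray -/
lemma window {z : ℂ} (hz : z ∉ X) {δ : ℝ} (hδ : ∀ r : ℝ, 0 < r → z + r * e δ ∉ X) {f : ℝ → ℝ}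
    (hf : Continuous f) (ha : ∀ t, IsArg (gam v t - z) (f t)) :
    (∃ c, ∀ t, f t ∈ Ioo c (c + 2 * π)) ∧ ∀ t, f (t + N) = f t := by
  have hpi := pi_pos
  have hne : ∀ t, gam v t - z ≠ 0 := fun t h0 => hz (by
    rw [← sub_eq_zero.1 h0]; exact h.gam_mem t)
  obtain ⟨m, hm⟩ := lift_window (S := univ) (f := f) (δ := δ) isPreconnected_univ
    hf.continuousOn (by
      intro t _ heq
      have h1 := ha t
      rw [IsArg, heq] at h1
      refine hδ _ (norm_pos_iff.2 (hne t)) ?_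
      rw [← h1, add_sub_cancel]; exact h.gam_mem t)
  refine ⟨⟨δ + 2 * π * m, fun t => hm t (mem_univ _)⟩, fun t => ?_⟩
  have h1 := ha (t + N)
  rw [gam_per h.pg.per] at h1
  obtain ⟨k, hk⟩ := h1.unique (hne t) (ha t)
  have a1 := hm t (mem_univ _)
  have a2 := hm (t + N) (mem_univ _)
  have b1 : (-1 : ℝ) < k := by by_contra hc; push Not at hc; nlinarith [a1.1, a1.2, a2.1, a2.2]
  have b2 : (k : ℝ) < 1 := by by_contra hc; push Not at hc; nlinarith [a1.1, a1.2, a2.1, a2.2]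
  have b1 : -1 < k := by exact_mod_cast b1
  have b2 : k < 1 := by exact_mod_cast b2
  have : k = 0 := by omega
  rw [hk, this]; simp

/-- a single free ray yields a large free arc -/
lemma arc_of_ray (hα : α < π) {z : ℂ} (hz : z ∉ X) {δ : ℝ}
    (hδ : ∀ r : ℝ, 0 < r → z + r * e δ ∉ X) : ∃ a, FreeArc X z a (π - α) := by
  have hpi := pi_pos
  have hne : ∀ t, gam v t - z ≠ 0 := fun t h0 => hz (by
    rw [← sub_eq_zero.1 h0]; exact h.gam_mem t)
  obtain ⟨f, hf, ha⟩ := exists_lift (S := (univ : Set ℝ)) isOpen_univ convex_univ univ_nonempty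
    (f := fun t => gam v t - z) ((continuous_gam v).sub continuous_const).continuousOn
    (fun t _ => hne t)
  rw [continuousOn_univ] at hf
  replace ha : ∀ t, IsArg (gam v t - z) (f t) := fun t => ha t (mem_univ t)
  obtain ⟨⟨c, hc⟩, hp⟩ := h.window hz hδ hf ha
  have hst := h.pg.gam_step (q := -z) hf (by simpa [sub_eq_add_neg] using ha)
    (by simpa [sub_eq_add_neg] using hne)
  have hN := h.pg.hN
  obtain ⟨i1, -, h1⟩ := exists_max_per (g := fun i _ => f i) hN hN
    (fun i j => by push_cast; exact hp i) (fun _ _ => rfl)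
  obtain ⟨i2, -, h2⟩ := exists_max_per (g := fun i _ => - f i) hN hN
    (fun i j => by push_cast; rw [hp i]) (fun _ _ => rfl)
  have hmax : ∀ t, f t ≤ f i1 := fun t => by
    have h3 := ((hst ⌊t⌋).2 t (Int.floor_le t) (Int.lt_floor_add_one t).le).1
    exact h3.trans (max_le (h1 _ 0) (h1 _ 0))
  have hmin : ∀ t, f i2 ≤ f t := fun t => by
    have h3 := ((hst ⌊t⌋).2 t (Int.floor_le t) (Int.lt_floor_add_one t).le).2
    have a1 := h2 ⌊t⌋ 0
    have a2 := h2 (⌊t⌋ + 1) 0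
    exact (le_min (by linarith) (by linarith)).trans h3
  obtain ⟨I, hI, -, hI1, hI2⟩ := h.max_shift hp (h.type_max hz ha hc hmax)
  obtain ⟨J, hJ, -, hJ1, hJ2⟩ := h.max_shift hp (h.type_min hz ha hc hmin)
  have hα0 := h.alpha_nonneg
  have hrange : f I - f J ≤ π + α := by
    by_contra hcon
    push Not at hcon
    rcases lt_trichotomy J I with hlt | rfl | hlt
    · exact glem hα h.aco (L := fun _ => 0) (fun _ _ _ => by linarith) (U := fun i _ => f i)
        (fun i _ => (hst i).1) (fun _ _ => ⟨id, id, fun _ _ => le_rfl⟩) hlt.le (le_refl (0 : ℤ))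
        (Or.inl hlt) (fun _ => hI1) (fun h0 => by omega) (fun _ => hJ2) (fun h0 => by omega)
    · linarith
    · have := h.aco I (J - 1) (by omega)
      linarith
  refine ⟨f I, fun δ' hδ' r hr hmem => ?_⟩
  obtain ⟨r', hr', hfr⟩ := last_pt h.comp hmem
  rw [h.fr] at hfr
  obtain ⟨t, ht⟩ := hfr
  have h5 : gam v t - z = r' * e δ' := by rw [ht]; ring
  have h6 := isArg_smul_e (hr.le.trans hr') δ'
  rw [← h5] at h6
  obtain ⟨m, hm⟩ := (ha t).unique (hne t) h6
  have b1 := hmax t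
  have b2 := hmin t
  rw [← hI] at b1
  rw [← hJ] at b2
  have c1 : (m : ℝ) < 0 := by by_contra hc; push Not at hc; nlinarith [hδ'.1]
  have c2 : (-1 : ℝ) < m := by by_contra hc; push Not at hc; nlinarith [hδ'.2]
  have c1 : m < 0 := by exact_mod_cast c1
  have c2 : -1 < m := by exact_mod_cast c2
  omega

end IsGd

/-- limits of free arcs -/
lemma limit_arc {X : Set ℂ} (hX : X ⊆ closure (interior X)) {z : ℕ → ℂ} {z0 : ℂ}
    (hz : Filter.Tendsto z Filter.atTop (nhds z0)) {ℓ : ℝ}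
    (h : ∀ n, ∃ a, FreeArc X (z n) a ℓ) :
    ∃ a, FreeArc X z0 a ℓ ∧ ∀ δ ∈ Ioo a (a + ℓ), ∃ᶠ n in Filter.atTop,
      ∀ r : ℝ, 0 < r → z n + r * e δ ∉ X := by
  have hpi := pi_pos
  have h' : ∀ n, ∃ a ∈ Icc 0 (2 * π), FreeArc X (z n) a ℓ := by
    intro n
    obtain ⟨a, ha⟩ := h n
    refine ⟨toIcoMod two_pi_pos 0 a, ?_, ?_⟩
    · have := toIcoMod_mem_Ico two_pi_pos 0 a
      exact ⟨this.1, by linarith [this.2]⟩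
    · intro δ hδ r hr
      set k := toIcoDiv two_pi_pos 0 a
      have h1 : toIcoMod two_pi_pos 0 a = a - k * (2 * π) := by
        rw [← self_sub_toIcoDiv_zsmul]; simp [k]
      rw [h1] at hδ
      have := ha (δ + 2 * π * k) ⟨by linarith [hδ.1], by linarith [hδ.2]⟩ r hr
      rwa [e_add_int] at this
  choose a ha hfree using h'
  obtain ⟨a0, -, g, hg, hlim⟩ := isCompact_Icc.tendsto_subseq ha
  have hzg := hz.comp hg.tendsto_atTop
  have hev : ∀ δ ∈ Ioo a0 (a0 + ℓ), ∀ᶠ n in Filter.atTop, δ ∈ Ioo (a (g n)) (a (g n) + ℓ) := by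
    intro δ hδ
    have h1 : ∀ᶠ n in Filter.atTop, a (g n) < δ := hlim.eventually_lt_const hδ.1
    have h2 : ∀ᶠ n in Filter.atTop, δ - ℓ < a (g n) :=
      hlim.eventually_const_lt (by linarith [hδ.2])
    filter_upwards [h1, h2] with n h1 h2
    exact ⟨h1, by linarith⟩
  refine ⟨a0, fun δ hδ r hr hmem => ?_, fun δ hδ => ?_⟩
  · -- perturb into the interior
    have hcl := hX hmem
    -- coordinates near the point
    have hne : (r : ℂ) * e δ ≠ 0 := mul_ne_zero (by exact_mod_cast hr.ne') (e_ne _)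
    have hcont : ContinuousAt (fun p : ℂ => δ + Complex.arg ((p - z0) / e δ)) (z0 + r * e δ) := by
      refine continuousAt_const.add (ContinuousAt.comp (g := Complex.arg)
        (Complex.continuousAt_arg ?_) (by
          refine ContinuousAt.div (by fun_prop) continuousAt_const (e_ne _)))
      rw [add_sub_cancel_left, mul_div_assoc, div_self (e_ne _), mul_one]
      simp [hr]
    have hval : δ + Complex.arg ((z0 + r * e δ - z0) / e δ) = δ := by
      rw [add_sub_cancel_left, mul_div_assoc, div_self (e_ne _), mul_one,
        Complex.arg_ofReal_of_nonneg hr.le, add_zero]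
    have hnb : ∀ᶠ p in nhds (z0 + r * e δ), δ + Complex.arg ((p - z0) / e δ) ∈ Ioo a0 (a0 + ℓ) := by
      apply hcont.eventually_mem
      rw [hval]
      exact Ioo_mem_nhds hδ.1 hδ.2
    have hnb2 : ∀ᶠ p in nhds (z0 + r * e δ), p ≠ z0 :=
      eventually_ne_nhds (by simpa using hne)
    obtain ⟨p, hp1, hp2, hp3⟩ := (mem_closure_iff_frequently.1 hcl).and_eventually (hnb.and hnb2)
      |>.exists
    set δ' := δ + Complex.arg ((p - z0) / e δ) with hδ'
    have hpa : IsArg (p - z0) δ' := by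
      have h1 : IsArg (e δ) δ := by have := isArg_smul_e (r := 1) zero_le_one δ; simpa using this
      have := h1.mul (isArg_arg ((p - z0) / e δ))
      rwa [mul_div_cancel₀ _ (e_ne _)] at this
    have hpos : 0 < ‖p - z0‖ := norm_pos_iff.2 (sub_ne_zero.2 hp3)
    have ht : Filter.Tendsto (fun n => z (g n) + ‖p - z0‖ * e δ') Filter.atTop (nhds p) := by
      have := hzg.add_const (p - z0)
      rw [add_sub_cancel] at this
      refine this.congr (fun n => ?_)
      change z (g n) + (p - z0) = _
      rw [← hpa]
    have h3 := ht.eventually_mem (isOpen_interior.mem_nhds hp1)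
    obtain ⟨n, h4, h5⟩ := (h3.and (hev δ' hp2)).exists
    exact hfree (g n) δ' h5 _ hpos (interior_subset h4)
  · have h1 := hev δ hδ
    have h2 : ∃ᶠ n in Filter.atTop, ∀ r : ℝ, 0 < r → z (g n) + r * e δ ∉ X :=
      (h1.mono (fun n hn r hr => hfree (g n) δ hn r hr)).frequently
    exact hg.tendsto_atTop.frequently h2

end MS

namespace MS

lemma free_nhds {X : Set ℂ} (hX : IsCompact X) {z : ℂ} (hz : z ∉ X) {δ : ℝ}
    (hδ : ∀ r : ℝ, 0 < r → z + r * e δ ∉ X) :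
    ∃ ε > 0, ∀ z' ∈ Metric.ball z ε, z' ∉ X ∧ ∀ r : ℝ, 0 < r → z' + r * e δ ∉ X := by
  let R : Set ℂ := (fun r : ℝ => z + r * e δ) '' Ici 0
  have hRcl : IsClosed R := by
    have : Isometry (fun r : ℝ => z + (r : ℂ) * e δ) := by
      intro a b
      rw [edist_dist, edist_dist, dist_eq_norm, dist_eq_norm]
      congr 1
      rw [add_sub_add_left_eq_sub, ← sub_mul, norm_mul, norm_e, mul_one, ← Complex.ofReal_sub,
        Complex.norm_real]
    exact this.isClosedEmbedding.isClosedMap _ isClosed_Ici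
  have hd : Disjoint X R := by
    rw [Set.disjoint_left]
    rintro p hp ⟨r, hr, rfl⟩
    rcases eq_or_lt_of_le (show (0 : ℝ) ≤ r from hr) with h0 | h0
    · subst h0; simp at hp; exact hz hp
    · exact hδ r h0 hp
  obtain ⟨ε, hε, hh⟩ := hd.exists_thickenings hX hRcl
  refine ⟨ε, hε, ?_⟩
  have key : ∀ z' ∈ Metric.ball z ε, ∀ r : ℝ, 0 ≤ r → z' + r * e δ ∉ X := by
    intro z' hz' r hr hmem
    refine Set.disjoint_left.1 hh (Metric.self_subset_thickening hε _ hmem) ?_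
    rw [Metric.mem_thickening_iff]
    refine ⟨z + r * e δ, ⟨r, hr, rfl⟩, ?_⟩
    rw [dist_add_right]; exact hz'
  intro z' hz'
  refine ⟨?_, fun r hr => key z' hz' r hr.le⟩
  have := key z' hz' 0 le_rfl
  simpa using this

namespace IsGd

variable {X : Set ℂ} {N : ℤ} {v : ℤ → ℂ} {φ : ℤ → ℝ} {α : ℝ} (h : IsGd X N v φ α)
include h

lemma reg_sub : X ⊆ closure (interior X) := h.reg.subset

/-- every outer point has a large free arc -/
lemma vis (hα : α < π) {z : ℂ} (hz : z ∉ X) : ∃ a, FreeArc X z a (π - α) := by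
  let H : Set ℂ := {z | z ∉ X ∧ ∃ δ, ∀ r : ℝ, 0 < r → z + r * e δ ∉ X}
  have hG : ∀ z ∈ H, ∃ a, FreeArc X z a (π - α) := by
    rintro z ⟨h1, δ, h2⟩
    exact h.arc_of_ray hα h1 h2
  have hopen : IsOpen H := by
    rw [Metric.isOpen_iff]
    rintro z ⟨h1, δ, h2⟩
    obtain ⟨ε, hε, hh⟩ := free_nhds h.comp h1 h2
    exact ⟨ε, hε, fun z' hz' => ⟨(hh z' hz').1, δ, (hh z' hz').2⟩⟩
  have hne : (Xᶜ ∩ H).Nonempty := by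
    obtain ⟨R, hR0, hR⟩ := h.comp.isBounded.subset_closedBall_lt 0 0
    have key : ∀ r : ℝ, 0 ≤ r → ((R + 1 : ℝ) : ℂ) + r * e 0 ∉ X := by
      intro r hr hmem
      have := hR hmem
      rw [e_zero, mul_one, ← Complex.ofReal_add, mem_closedBall_zero_iff,
        Complex.norm_of_nonneg (by linarith)] at this
      linarith
    have k0 : ((R + 1 : ℝ) : ℂ) ∉ X := by have := key 0 le_rfl; simpa using this
    exact ⟨((R + 1 : ℝ) : ℂ), k0, k0, 0, fun r hr => key r hr.le⟩
  have hsub : Xᶜ ⊆ H := by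
    refine h.preconn_compl.subset_of_closure_inter_subset hopen hne ?_
    rintro z ⟨hz1, hz2⟩
    obtain ⟨s, hs, hlim⟩ := mem_closure_iff_seq_limit.1 hz1
    obtain ⟨a, ha, -⟩ := limit_arc h.reg_sub hlim (fun n => hG _ (hs n))
    exact ⟨hz2, a + (π - α) / 2, ha _ ⟨by linarith, by linarith⟩⟩
  exact hG z (hsub hz)

end IsGd

lemma frontier_add {K L : Set ℂ} (hK : IsClosed K) (hL : IsClosed L) (hKL : IsClosed (K + L))
    {x : ℂ} (hx : x ∈ frontier (K + L)) : ∃ k ∈ K, ∃ l ∈ L, k + l = x ∧ ∀ k ∈ K, ∀ l ∈ L,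
      k + l = x → k ∈ frontier K ∧ l ∈ frontier L := by
  rw [hKL.frontier_eq] at hx
  obtain ⟨⟨k, hk, l, hl, hkl⟩, hni⟩ := hx
  refine ⟨k, hk, l, hl, hkl, fun k hk l hl hkl => ?_⟩
  rw [hK.frontier_eq, hL.frontier_eq]
  refine ⟨⟨hk, fun hki => hni ?_⟩, ⟨hl, fun hli => hni ?_⟩⟩
  · rw [← hkl]
    exact interior_maximal (Set.add_subset_add_right interior_subset) isOpen_interior.add_right
      (Set.add_mem_add hki hl)
  · rw [← hkl]
    exact interior_maximal (Set.add_subset_add_left interior_subset) isOpen_interior.add_left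
      (Set.add_mem_add hk hli)

section sum

variable {K L : Set ℂ} {N M : ℤ} {v w : ℤ → ℂ} {φ χ : ℤ → ℝ} {α : ℝ}

/-- every point outside the Minkowski sum has a large free arc -/
lemma vis_add (hα : α < π) (hK : IsGd K N v φ α) (hL : IsGd L M w χ α) {z : ℂ} (hz : z ∉ K + L) :
    ∃ a, FreeArc (K + L) z a (π - α) := by
  have hpi := pi_pos
  have hne : ∀ s t, gam v s + gam w t - z ≠ 0 := fun s t h0 => hz (by
    rw [← sub_eq_zero.1 h0]; exact Set.add_mem_add (hK.gam_mem s) (hL.gam_mem t))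
  obtain ⟨f, hf, ha⟩ := exists_lift (S := (univ : Set (ℝ × ℝ))) isOpen_univ convex_univ univ_nonempty
    (f := fun p => gam v p.1 + gam w p.2 - z)
    ((((continuous_gam v).comp continuous_fst).add ((continuous_gam w).comp continuous_snd)).sub
      continuous_const).continuousOn (fun p _ => hne p.1 p.2)
  rw [continuousOn_univ] at hf
  replace ha : ∀ s t, IsArg (gam v s + gam w t - z) (f (s, t)) := fun s t => ha (s, t) (mem_univ _)
  have hzK : ∀ t, z - gam w t ∉ K := fun t h0 => hz (by
    have := Set.add_mem_add h0 (hL.gam_mem t); rwa [sub_add_cancel] at this)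
  have hzL : ∀ s, z - gam v s ∉ L := fun s h0 => hz (by
    have := Set.add_mem_add (hK.gam_mem s) h0; rwa [add_sub_cancel] at this)
  have haK : ∀ t s, IsArg (gam v s - (z - gam w t)) (f (s, t)) := fun t s => by
    have := ha s t; rwa [show gam v s - (z - gam w t) = gam v s + gam w t - z by ring]
  have haL : ∀ s t, IsArg (gam w t - (z - gam v s)) (f (s, t)) := fun s t => by
    have := ha s t; rwa [show gam w t - (z - gam v s) = gam v s + gam w t - z by ring]
  have cK : ∀ t, Continuous (fun s => f (s, t)) := fun t => by fun_prop
  have cL : ∀ s, Continuous (fun t => f (s, t)) := fun s => by fun_prop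
  have hwK : ∀ t, (∃ c, ∀ s, f (s, t) ∈ Ioo c (c + 2 * π)) ∧ ∀ s, f (s + N, t) = f (s, t) := by
    intro t
    obtain ⟨a, hfree⟩ := hK.vis hα (hzK t)
    exact hK.window (hzK t) (hfree (a + (π - α) / 2) ⟨by linarith, by linarith⟩) (cK t) (haK t)
  have hwL : ∀ s, (∃ c, ∀ t, f (s, t) ∈ Ioo c (c + 2 * π)) ∧ ∀ t, f (s, t + M) = f (s, t) := by
    intro s
    obtain ⟨a, hfree⟩ := hL.vis hα (hzL s)
    exact hL.window (hzL s) (hfree (a + (π - α) / 2) ⟨by linarith, by linarith⟩) (cL s) (haL s)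
  have stK := fun t => hK.pg.gam_step (q := -(z - gam w t)) (cK t)
    (fun s => by have := ha s t; rwa [show gam v s + -(z - gam w t) = gam v s + gam w t - z by ring])
    (by intro s; have := hne s t; rwa [show gam v s + -(z - gam w t) = gam v s + gam w t - z by ring])
  have stL := fun s => hL.pg.gam_step (q := -(z - gam v s)) (cL s)
    (fun t => by have := ha s t; rwa [show gam w t + -(z - gam v s) = gam v s + gam w t - z by ring])
    (by intro t; have := hne s t; rwa [show gam w t + -(z - gam v s) = gam v s + gam w t - z by ring])
  have hN := hK.pg.hN
  have hM := hL.pg.hN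
  obtain ⟨i1, j1, h1⟩ := exists_max_per (g := fun i j => f (i, j)) hN hM
    (fun i j => by push_cast; exact (hwK j).2 i) (fun i j => by push_cast; exact (hwL i).2 j)
  obtain ⟨i2, j2, h2⟩ := exists_max_per (g := fun i j => - f (i, j)) hN hM
    (fun i j => by push_cast; rw [(hwK j).2 i]) (fun i j => by push_cast; rw [(hwL i).2 j])
  have hmax : ∀ s t, f (s, t) ≤ f (i1, j1) := fun s t => by
    have h3 : ∀ k : ℤ, f (k, t) ≤ f (i1, j1) := fun k =>
      (((stL k ⌊t⌋).2 t (Int.floor_le t) (Int.lt_floor_add_one t).le).1).trans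
        (max_le (h1 _ _) (h1 _ _))
    exact (((stK t ⌊s⌋).2 s (Int.floor_le s) (Int.lt_floor_add_one s).le).1).trans
        (max_le (h3 _) (h3 _))
  have hmin : ∀ s t, f (i2, j2) ≤ f (s, t) := fun s t => by
    have h2' : ∀ i j : ℤ, f (i2, j2) ≤ f (i, j) := fun i j => by have := h2 i j; linarith
    have h3 : ∀ k : ℤ, f (i2, j2) ≤ f (k, t) := fun k =>
      (le_min (h2' _ _) (h2' _ _)).trans
      ((stL k ⌊t⌋).2 t (Int.floor_le t) (Int.lt_floor_add_one t).le).2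
    exact (le_min (h3 _) (h3 _)).trans
      ((stK t ⌊s⌋).2 s (Int.floor_le s) (Int.lt_floor_add_one s).le).2
  -- shifts
  have perK : ∀ (m i : ℤ) (t : ℝ), f ((i + m * N : ℤ), t) = f (i, t) := fun m i t =>
    per_mul (v := fun i : ℤ => f (i, t)) (N := N) (fun i => by push_cast; exact (hwK t).2 i) i m
  have perL : ∀ (m j : ℤ) (s : ℝ), f (s, (j + m * M : ℤ)) = f (s, j) := fun m j s =>
    per_mul (v := fun j : ℤ => f (s, j)) (N := M) (fun j => by push_cast; exact (hwL s).2 j) j m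
  obtain ⟨c1, hc1⟩ := (hwK j1).1
  obtain ⟨c2, hc2⟩ := (hwL i1).1
  obtain ⟨c3, hc3⟩ := (hwK j2).1
  obtain ⟨c4, hc4⟩ := (hwL i2).1
  obtain ⟨I, hI, ⟨m1, hm1⟩, hI1, hI2⟩ := hK.max_shift (f := fun s => f (s, j1)) (hwK j1).2
    (hK.type_max (hzK j1) (haK j1) hc1 (fun s => hmax s j1))
  obtain ⟨J, hJ, ⟨m2, hm2⟩, hJ1, hJ2⟩ := hL.max_shift (f := fun t => f (i1, t)) (hwL i1).2
    (hL.type_max (hzL i1) (haL i1) hc2 (fun t => hmax i1 t))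
  obtain ⟨I', hI', ⟨m3, hm3⟩, hI1', hI2'⟩ := hK.max_shift (f := fun s => f (s, j2)) (hwK j2).2
    (hK.type_min (hzK j2) (haK j2) hc3 (fun s => hmin s j2))
  obtain ⟨J', hJ', ⟨m4, hm4⟩, hJ1', hJ2'⟩ := hL.max_shift (f := fun t => f (i2, t)) (hwL i2).2
    (hL.type_min (hzL i2) (haL i2) hc4 (fun t => hmin i2 t))
  have hU : f (I, J) = f (i1, j1) := by rw [hm1, perK, hJ]
  have hU' : f (I', J') = f (i2, j2) := by rw [hm3, perK, hJ']
  rw [hI, ← hU] at hI1 hI2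
  rw [hJ, ← hU] at hJ1 hJ2
  rw [hI', ← hU'] at hI1' hI2'
  rw [hJ', ← hU'] at hJ1' hJ2'
  rw [← hU] at hmax
  rw [← hU'] at hmin
  have hα0 := hK.alpha_nonneg
  have hrange : f (I, J) - f (I', J') ≤ π + α := by
    by_contra hcon
    push Not at hcon
    have hi : I' ≤ I := by
      by_contra hlt
      have := hK.aco I (I' - 1) (by omega)
      linarith
    have hj : J' ≤ J := by
      by_contra hlt
      have := hL.aco J (J' - 1) (by omega)
      linarith
    have hor : I' < I ∨ J' < J := by
      by_contra hno
      have e1 : I' = I := by omega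
      have e2 : J' = J := by omega
      rw [e1, e2] at hcon
      linarith
    exact glem hα hK.aco hL.aco (U := fun i j => f (i, j)) (fun i j => (stK j i).1)
      (fun i j => (stL i j).1) hi hj hor (fun _ => hI1) (fun _ => hJ1) (fun _ => hI2')
      (fun _ => hJ2')
  have hcomp := hK.comp.add hL.comp
  refine ⟨f (I, J), fun δ' hδ' r hr hmem => ?_⟩
  obtain ⟨r', hr', hfr⟩ := last_pt hcomp hmem
  obtain ⟨k, hk, l, hl, hkl, hb⟩ := frontier_add hK.comp.isClosed hL.comp.isClosed hcomp.isClosed hfr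
  obtain ⟨b1, b2⟩ := hb k hk l hl hkl
  rw [hK.fr] at b1
  rw [hL.fr] at b2
  obtain ⟨s, rfl⟩ := b1
  obtain ⟨t, rfl⟩ := b2
  have h5 : gam v s + gam w t - z = r' * e δ' := by rw [hkl]; ring
  have h6 := isArg_smul_e (hr.le.trans hr') δ'
  rw [← h5] at h6
  obtain ⟨m, hm⟩ := (ha s t).unique (hne s t) h6
  have b1 := hmax s t
  have b2 := hmin s t
  have c1 : (m : ℝ) < 0 := by by_contra hc; push Not at hc; nlinarith [hδ'.1]
  have c2 : (-1 : ℝ) < m := by by_contra hc; push Not at hc; nlinarith [hδ'.2]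
  have c1 : m < 0 := by exact_mod_cast c1
  have c2 : -1 < m := by exact_mod_cast c2
  omega

end sum

end MS

namespace MS

/-- the properties of a Minkowski sum that are used to rebuild its boundary -/
structure IsNice (X : Set ℂ) (ℓ : ℝ) (E : Set ℂ) : Prop where
  comp : IsCompact X
  reg : X = closure (interior X)
  conn : IsPreconnected (interior X)
  ne : X.Nonempty
  hl : 0 < ℓ
  hl2 : ℓ ≤ π
  arc : ∀ z, z ∉ X → ∃ a, FreeArc X z a ℓ
  fin : E.Finite
  dir : ∀ x : ℂ, ∃ ε > 0, ∀ w : ℂ, w ≠ 0 → ‖w‖ < ε → x + w ∈ frontier X → w / ‖w‖ ∈ E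

lemma near_ray (θ : ℝ) {r ε κ : ℝ} (hr : 0 < r) (hrε : r < ε) (hκ : 0 < κ) :
    ∃ ρ > 0, ∀ w : ℂ, ‖w‖ < ρ → ∃ η : ℝ, |η| < κ ∧ ∃ r' ∈ Ioo 0 ε,
      (r : ℂ) * e θ + w = (r' : ℝ) * e (θ + η) ∧ (0 < cr (e θ) w → 0 < η) ∧
      (cr (e θ) w < 0 → η < 0) := by
  have hs : (r : ℂ) ∈ Complex.slitPlane := by simp [Complex.ofReal_mem_slitPlane, hr]
  have c1 : ContinuousAt (fun w : ℂ => Complex.arg (r + w / e θ)) 0 := by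
    refine ContinuousAt.comp (f := fun w : ℂ => (r : ℂ) + w / e θ) (g := Complex.arg) ?_
      (Continuous.continuousAt (by fun_prop))
    simpa using Complex.continuousAt_arg hs
  have c2 : ContinuousAt (fun w : ℂ => ‖(r : ℂ) + w / e θ‖) 0 := by fun_prop
  have a0 : Complex.arg r = 0 := Complex.arg_ofReal_of_nonneg hr.le
  have e1 : ∀ᶠ w : ℂ in nhds 0, Complex.arg (r + w / e θ) ∈ Ioo (-κ) κ :=
    c1.eventually_mem (Ioo_mem_nhds (by simp [a0, hκ]) (by simp [a0, hκ]))
  have e2 : ∀ᶠ w : ℂ in nhds 0, ‖(r : ℂ) + w / e θ‖ ∈ Ioo 0 ε :=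
    c2.eventually_mem (Ioo_mem_nhds (by simp [hr.ne']) (by simpa [abs_of_pos hr] using hrε))
  obtain ⟨ρ, hρ, hh⟩ := Metric.eventually_nhds_iff.1 (e1.and e2)
  refine ⟨ρ, hρ, fun w hw => ?_⟩
  obtain ⟨h1, h2⟩ := hh (y := w) (by simpa using hw)
  have him : ((r : ℂ) + w / e θ).im = cr (e θ) w := by
    have h1 : cos θ * cos θ + sin θ * sin θ = 1 := by nlinarith [sin_sq_add_cos_sq θ]
    rw [Complex.add_im, Complex.ofReal_im, Complex.div_im, cr, e_re, e_im,
      Complex.normSq_apply, e_re, e_im, h1]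
    ring
  refine ⟨Complex.arg (r + w / e θ), abs_lt.2 h1, _, h2, ?_, fun h => ?_, fun h => ?_⟩
  · have := isArg_arg (r + w / e θ)
    rw [IsArg] at this
    rw [e_add]
    calc (r : ℂ) * e θ + w = (r + w / e θ) * e θ := by field_simp [e_ne θ]
      _ = _ := by
        conv_lhs => rw [this]
        ring
  · have h3 : 0 ≤ Complex.arg (r + w / e θ) := by rw [Complex.arg_nonneg_iff, him]; exact h.le
    rcases eq_or_lt_of_le h3 with h4 | h4
    · exfalso
      have := Complex.arg_eq_zero_iff.1 h4.symm
      linarith [this.2, him]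
    · exact h4
  · rw [Complex.arg_neg_iff, him]; exact h

/-- local structure of a set at a boundary point -/
structure LocS (X : Set ℂ) (x : ℂ) (α β ε : ℝ) : Prop where
  pos : 0 < ε
  h1 : α < β
  h2 : β < α + 2 * π
  hin : ∀ θ ∈ Ioo α β, ∀ r ∈ Ioo 0 ε, x + (r : ℝ) * e θ ∈ interior X
  hout : ∀ θ ∈ Ioo β (α + 2 * π), ∀ r ∈ Ioo 0 ε, x + (r : ℝ) * e θ ∉ X

/-- rays near `θ` stay in `O` -/
def Dr (O : Set ℂ) (x : ℂ) (ε θ : ℝ) : Prop :=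
  ∃ κ > 0, ∀ η, |η - θ| < κ → ∀ r ∈ Ioo 0 ε, x + (r : ℝ) * e η ∈ O

lemma Dr.self {O : Set ℂ} {x : ℂ} {ε θ : ℝ} (h : Dr O x ε θ) : ∀ r ∈ Ioo 0 ε, x + (r : ℝ) * e θ ∈ O := by
  obtain ⟨κ, hκ, h⟩ := h
  exact h θ (by simpa using hκ)

lemma Dr.open {O : Set ℂ} {x : ℂ} {ε θ : ℝ} (h : Dr O x ε θ) : ∃ κ > 0, ∀ η, |η - θ| < κ → Dr O x ε η := by
  obtain ⟨κ, hκ, h⟩ := h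
  refine ⟨κ / 2, by linarith, fun η hη => ⟨κ / 2, by linarith, fun η' hη' => h η' ?_⟩⟩
  calc |η' - θ| = |(η' - η) + (η - θ)| := by ring_nf
    _ ≤ _ := abs_add_le _ _
    _ < κ := by linarith

lemma Dr.add_int {O : Set ℂ} {x : ℂ} {ε θ : ℝ} (h : Dr O x ε θ) (m : ℤ) : Dr O x ε (θ + 2 * π * m) := by
  obtain ⟨κ, hκ, h⟩ := h
  refine ⟨κ, hκ, fun η hη r hr => ?_⟩
  have := h (η + 2 * π * (-m : ℤ)) (by push_cast; rwa [show η + 2 * π * -m - θ = η - (θ + 2 * π * m) by ring]) r hr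
  rwa [e_add_int] at this

lemma sine_id (ψ η δ : ℝ) :
    ((sin (δ - η) : ℝ) : ℂ) * e ψ + (sin (η - ψ) : ℝ) * e δ = (sin (δ - ψ) : ℝ) * e η := by
  apply Complex.ext <;>
  simp only [Complex.add_re, Complex.add_im, Complex.re_ofReal_mul, Complex.im_ofReal_mul, e_re,
    e_im, sin_sub] <;> nlinarith [sin_sq_add_cos_sq η]

namespace IsNice

variable {X : Set ℂ} {ℓ : ℝ} {E : Set ℂ} (h : IsNice X ℓ E)
include h

lemma compl_fr : (frontier X)ᶜ = interior X ∪ Xᶜ := by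
  rw [h.comp.isClosed.frontier_eq]
  ext z; simp only [mem_compl_iff, mem_sdiff, mem_union, not_and, not_not]
  have := @interior_subset _ _ X z
  tauto

lemma fr_iff {z : ℂ} : z ∈ frontier X ↔ z ∈ X ∧ z ∉ interior X := by
  rw [h.comp.isClosed.frontier_eq]; rfl

lemma disj : Disjoint (interior X) Xᶜ :=
  disjoint_compl_right.mono_left interior_subset

lemma ne_int : ¬ ∃ z, z ∈ interior X ∧ z ∈ Xᶜ := fun ⟨_, h1, h2⟩ => h2 (interior_subset h1)

lemma punct (θ : ℝ) : ∃ κ > 0, ∀ η, |η - θ| < κ → η ≠ θ → e η ∉ E := by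
  have hcl : IsClosed (E \ {e θ}) := (h.fin.subset sdiff_subset).isClosed
  have ho : ∀ᶠ η in nhds θ, e η ∈ (E \ {e θ})ᶜ :=
    continuous_e.continuousAt.eventually_mem (hcl.isOpen_compl.mem_nhds (by simp))
  obtain ⟨κ, hκ, hh⟩ := Metric.eventually_nhds_iff.1 ho
  have hpi := pi_pos
  refine ⟨min κ π, lt_min hκ hpi, fun η hη hne hE => ?_⟩
  have := hh (y := η) (by rw [Real.dist_eq]; exact hη.trans_le (min_le_left _ _))
  have h2 : e η = e θ := by
    by_contra h3; exact this ⟨hE, h3⟩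
  obtain ⟨m, hm⟩ := e_eq_iff.1 h2
  have h3 : |η - θ| < π := hη.trans_le (min_le_right _ _)
  rw [abs_lt] at h3
  have : m = 0 := by
    have c1 : (m : ℝ) < 1 := by nlinarith
    have c2 : (-1 : ℝ) < m := by nlinarith
    have c1 : m < 1 := by exact_mod_cast c1
    have c2 : -1 < m := by exact_mod_cast c2
    omega
  subst this
  exact hne (by simpa using hm)

/-- sector dichotomy -/
lemma sector {x : ℂ} {ε : ℝ} (hε : ∀ w : ℂ, w ≠ 0 → ‖w‖ < ε → x + w ∈ frontier X → w / ‖w‖ ∈ E)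
    {a b : ℝ} (hab : ∀ θ ∈ Ioo a b, e θ ∉ E) :
    (∀ θ ∈ Ioo a b, ∀ r ∈ Ioo 0 ε, x + (r : ℝ) * e θ ∈ interior X) ∨
    (∀ θ ∈ Ioo a b, ∀ r ∈ Ioo 0 ε, x + (r : ℝ) * e θ ∈ Xᶜ) := by
  have hp : IsPreconnected ((fun p : ℝ × ℝ => x + (p.2 : ℂ) * e p.1) '' (Ioo a b ×ˢ Ioo 0 ε)) := by
    refine (isPreconnected_Ioo.prod isPreconnected_Ioo).image _ (Continuous.continuousOn ?_)
    have := continuous_e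
    fun_prop
  have hsub : (fun p : ℝ × ℝ => x + (p.2 : ℂ) * e p.1) '' (Ioo a b ×ˢ Ioo 0 ε) ⊆ interior X ∪ Xᶜ := by
    rw [← h.compl_fr]
    rintro _ ⟨⟨θ, r⟩, ⟨h1, h2⟩, rfl⟩ hfr
    dsimp only at h1 h2 hfr
    have hn : ‖(r : ℂ) * e θ‖ = r := by rw [norm_mul, norm_e, mul_one, Complex.norm_of_nonneg h2.1.le]
    have h0 : (r : ℂ) ≠ 0 := by exact_mod_cast h2.1.ne'
    have := hε _ (mul_ne_zero h0 (e_ne θ)) (by rw [hn]; exact h2.2) hfr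
    rw [hn, mul_div_cancel_left₀ _ h0] at this
    exact hab θ h1 this
  rcases hp.subset_or_subset isOpen_interior h.comp.isClosed.isOpen_compl h.disj hsub with h1 | h1
  · left; intro θ hθ r hr; exact h1 ⟨(θ, r), ⟨hθ, hr⟩, rfl⟩
  · right; intro θ hθ r hr; exact h1 ⟨(θ, r), ⟨hθ, hr⟩, rfl⟩

lemma sectorD {x : ℂ} {ε : ℝ} (hε : ∀ w : ℂ, w ≠ 0 → ‖w‖ < ε → x + w ∈ frontier X → w / ‖w‖ ∈ E)
    {a b : ℝ} (hab : ∀ θ ∈ Ioo a b, e θ ∉ E) :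
    (∀ θ ∈ Ioo a b, Dr (interior X) x ε θ) ∨ (∀ θ ∈ Ioo a b, Dr Xᶜ x ε θ) := by
  have key : ∀ O : Set ℂ, (∀ θ ∈ Ioo a b, ∀ r ∈ Ioo 0 ε, x + (r : ℝ) * e θ ∈ O) →
      ∀ θ ∈ Ioo a b, Dr O x ε θ := by
    intro O hO θ hθ
    refine ⟨min (θ - a) (b - θ), lt_min (by linarith [hθ.1]) (by linarith [hθ.2]), fun η hη => hO η ?_⟩
    rw [lt_min_iff, abs_lt, abs_lt] at hη
    exact ⟨by linarith [hη.1.1], by linarith [hη.2.2]⟩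
  rcases h.sector hε hab with h1 | h1
  · exact Or.inl (key _ h1)
  · exact Or.inr (key _ h1)

/-- germ trichotomy -/
lemma germ {x : ℂ} {ε : ℝ} (hε : ∀ w : ℂ, w ≠ 0 → ‖w‖ < ε → x + w ∈ frontier X → w / ‖w‖ ∈ E)
    (θ : ℝ) :
    Dr (interior X) x ε θ ∨ Dr Xᶜ x ε θ ∨
    ∃ κ > 0, ((∀ η ∈ Ioo (θ - κ) θ, Dr (interior X) x ε η) ∧ ∀ η ∈ Ioo θ (θ + κ), Dr Xᶜ x ε η) ∨
      ((∀ η ∈ Ioo (θ - κ) θ, Dr Xᶜ x ε η) ∧ ∀ η ∈ Ioo θ (θ + κ), Dr (interior X) x ε η) := by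
  obtain ⟨κ, hκ, hp⟩ := h.punct θ
  have hl : ∀ η ∈ Ioo (θ - κ) θ, e η ∉ E := fun η hη =>
    hp η (by rw [abs_lt]; constructor <;> linarith [hη.1, hη.2]) hη.2.ne
  have hr : ∀ η ∈ Ioo θ (θ + κ), e η ∉ E := fun η hη =>
    hp η (by rw [abs_lt]; constructor <;> linarith [hη.1, hη.2]) hη.1.ne'
  have hc : Continuous (fun p : ℝ × ℝ => x + (p.2 : ℂ) * e p.1) := by
    have := continuous_e
    fun_prop
  rcases h.sectorD hε hl with h1 | h1 <;> rcases h.sectorD hε hr with h2 | h2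
  · left
    have hX : ∀ η, |η - θ| < κ → ∀ r ∈ Ioo 0 ε, x + (r : ℝ) * e η ∈ X := by
      intro η hη r hrr
      rcases lt_trichotomy η θ with h3 | h3 | h3
      · exact interior_subset ((h1 η ⟨by linarith [(abs_lt.1 hη).1], h3⟩).self r hrr)
      · subst h3
        have : Filter.Tendsto (fun η' : ℝ => x + (r : ℂ) * e η') (nhdsWithin η (Ioi η))
            (nhds (x + (r : ℂ) * e η)) := by
          have : Continuous (fun η' : ℝ => x + (r : ℂ) * e η') := by
            have := continuous_e
            fun_prop
          exact this.continuousAt.tendsto.mono_left nhdsWithin_le_nhds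
        refine h.comp.isClosed.mem_of_tendsto this ?_
        filter_upwards [Ioo_mem_nhdsGT (show η < η + κ by linarith)] with η' hη'
        exact interior_subset ((h2 η' hη').self r hrr)
      · exact interior_subset ((h2 η ⟨h3, by linarith [(abs_lt.1 hη).2]⟩).self r hrr)
    refine ⟨κ / 2, by linarith, fun η hη r hrr => ?_⟩
    obtain ⟨ρ, hρ, hh⟩ := near_ray η hrr.1 hrr.2 (show 0 < κ / 2 by linarith)
    rw [mem_interior_iff_mem_nhds, Metric.mem_nhds_iff]
    refine ⟨ρ, hρ, fun p hp => ?_⟩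
    obtain ⟨η', h4, r', h5, h6, -⟩ := hh (p - (x + r * e η)) (by rwa [← dist_eq_norm])
    rw [show p = x + r' * e (η + η') by rw [← h6]; ring]
    refine hX _ ?_ r' h5
    rw [abs_lt] at *
    constructor <;> linarith
  · exact Or.inr (Or.inr ⟨κ, hκ, Or.inl ⟨h1, h2⟩⟩)
  · exact Or.inr (Or.inr ⟨κ, hκ, Or.inr ⟨h1, h2⟩⟩)
  · right; left
    have hX : ∀ η, |η - θ| < κ → ∀ r ∈ Ioo 0 ε, x + (r : ℝ) * e η ∉ interior X := by
      intro η hη r hrr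
      rcases lt_trichotomy η θ with h3 | h3 | h3
      · exact fun hh => (h1 η ⟨by linarith [(abs_lt.1 hη).1], h3⟩).self r hrr (interior_subset hh)
      · subst h3
        intro hh
        have hcc : Continuous (fun η' : ℝ => x + (r : ℂ) * e η') := by
          have := continuous_e
          fun_prop
        have e1 := hcc.continuousAt.eventually_mem (isOpen_interior.mem_nhds hh)
        have e2 := (e1.filter_mono nhdsWithin_le_nhds).and (Ioo_mem_nhdsGT (show η < η + κ by linarith))
        obtain ⟨η', h5, h6⟩ := e2.exists
        exact (h2 η' h6).self r hrr (interior_subset h5)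
      · exact fun hh => (h2 η ⟨h3, by linarith [(abs_lt.1 hη).2]⟩).self r hrr (interior_subset hh)
    refine ⟨κ / 2, by linarith, fun η hη r hrr hmem => ?_⟩
    obtain ⟨ρ, hρ, hh⟩ := near_ray η hrr.1 hrr.2 (show 0 < κ / 2 by linarith)
    rw [h.reg, Metric.mem_closure_iff] at hmem
    obtain ⟨p, hp, hd⟩ := hmem ρ hρ
    obtain ⟨η', h4, r', h5, h6, -⟩ := hh (p - (x + r * e η)) (by rwa [← dist_eq_norm, dist_comm])
    rw [show p = x + r' * e (η + η') by rw [← h6]; ring] at hp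
    refine hX _ ?_ r' h5 hp
    rw [abs_lt] at *
    constructor <;> linarith

/-- a free direction close to an outer direction -/
lemma freeB {x : ℂ} {ε ψ : ℝ} (hε : 0 < ε) (hB : Dr Xᶜ x ε ψ) :
    ∃ δ, |δ - ψ| < π ∧ (∀ r : ℝ, 0 < r → x + r * e δ ∉ X) ∧
      ∀ η, (ψ < η ∧ η ≤ δ ∨ δ ≤ η ∧ η < ψ) → ¬ Dr (interior X) x ε η := by
  have hpi := pi_pos
  have hl := h.hl
  have hl2 := h.hl2
  have hτ : ∀ n : ℕ, ε / (n + 2) ∈ Ioo 0 ε := fun n => by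
    constructor
    · positivity
    · apply div_lt_self hε; have : (0 : ℝ) ≤ n := n.cast_nonneg
      linarith
  have ht0 : Filter.Tendsto (fun n : ℕ => ε / ((n : ℝ) + 2)) Filter.atTop (nhds 0) :=
    tendsto_const_nhds.div_atTop (Filter.tendsto_atTop_add_const_right _ _ tendsto_natCast_atTop_atTop)
  have hz : Filter.Tendsto (fun n : ℕ => x + ((ε / ((n : ℝ) + 2) : ℝ) : ℂ) * e ψ) Filter.atTop
      (nhds x) := by
    have h1 := (Complex.continuous_ofReal.tendsto 0).comp ht0
    have h2 := (h1.mul_const (e ψ)).const_add x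
    simpa using h2
  obtain ⟨a, ha, hfr⟩ := limit_arc h.reg.subset hz (ℓ := ℓ) (fun n => h.arc _ (hB.self _ (hτ n)))
  -- choose a direction not opposite
  have hδ : ∃ δ0 ∈ Ioo a (a + ℓ), ∃ δ, e δ = e δ0 ∧ |δ - ψ| < π := by
    obtain ⟨d1, h1, h1'⟩ := exists_arg_Ico (e (a + ℓ / 3)) (ψ - π)
    obtain ⟨d2, h2, h2'⟩ := exists_arg_Ico (e (a + ℓ / 2)) (ψ - π)
    have f1 := h1'.unit (e_ne _)
    have f2 := h2'.unit (e_ne _)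
    simp only [norm_e, Complex.ofReal_one, div_one] at f1 f2
    by_cases c1 : d1 = ψ - π
    · refine ⟨a + ℓ / 2, ⟨by linarith, by linarith⟩, d2, f2, ?_⟩
      rw [abs_lt]
      refine ⟨?_, by linarith [h2.2]⟩
      by_contra hcon
      have c2 : d2 = ψ - π := le_antisymm (by linarith) h2.1
      rw [c2, ← c1, f1] at f2
      obtain ⟨m, hm⟩ := e_eq_iff.1 f2
      have m1 : (-1 : ℝ) < m := by nlinarith
      have m2 : (m : ℝ) < 0 := by nlinarith
      have m1 : -1 < m := by exact_mod_cast m1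
      have m2 : m < 0 := by exact_mod_cast m2
      omega
    · refine ⟨a + ℓ / 3, ⟨by linarith, by linarith⟩, d1, f1, ?_⟩
      rw [abs_lt]
      refine ⟨?_, by linarith [h1.2]⟩
      have := lt_of_le_of_ne h1.1 (Ne.symm c1)
      linarith
  obtain ⟨δ0, hδ0, δ, hδe, hδ⟩ := hδ
  have hfree : ∀ r : ℝ, 0 < r → x + r * e δ ∉ X := fun r hr => by rw [hδe]; exact ha δ0 hδ0 r hr
  refine ⟨δ, hδ, hfree, fun η hη hA => ?_⟩
  rcases eq_or_ne η δ with rfl | hne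
  · exact hfree (ε / 2) (by linarith) (interior_subset (hA.self (ε / 2) ⟨by linarith, by linarith⟩))
  rw [abs_lt] at hδ
  -- the crossing ratios
  have hs : 0 < sin (η - ψ) / sin (δ - η) ∧ 0 < sin (δ - ψ) / sin (δ - η) ∧ sin (δ - η) ≠ 0 := by
    rcases hη with ⟨h1, h2⟩ | ⟨h1, h2⟩
    · have h2 := lt_of_le_of_ne h2 hne
      have p1 := sin_pos_of_pos_of_lt_pi (show 0 < η - ψ by linarith) (by linarith)
      have p2 := sin_pos_of_pos_of_lt_pi (show 0 < δ - η by linarith) (by linarith)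
      have p3 := sin_pos_of_pos_of_lt_pi (show 0 < δ - ψ by linarith) (by linarith)
      exact ⟨div_pos p1 p2, div_pos p3 p2, p2.ne'⟩
    · have h1 := lt_of_le_of_ne h1 hne.symm
      have p1 := sin_neg_of_neg_of_neg_pi_lt (show η - ψ < 0 by linarith) (by linarith)
      have p2 := sin_neg_of_neg_of_neg_pi_lt (show δ - η < 0 by linarith) (by linarith)
      have p3 := sin_neg_of_neg_of_neg_pi_lt (show δ - ψ < 0 by linarith) (by linarith)
      exact ⟨div_pos_of_neg_of_neg p1 p2, div_pos_of_neg_of_neg p3 p2, p2.ne⟩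
  obtain ⟨s1, s2, s3⟩ := hs
  have hev : ∀ᶠ n : ℕ in Filter.atTop, ε / ((n : ℝ) + 2) * (sin (δ - ψ) / sin (δ - η)) < ε := by
    have := ht0.mul_const (sin (δ - ψ) / sin (δ - η))
    rw [zero_mul] at this
    exact this.eventually_lt_const hε
  obtain ⟨n, hn1, hn2⟩ := ((hfr δ0 hδ0).and_eventually hev).exists
  refine hn1 (ε / ((n : ℝ) + 2) * (sin (η - ψ) / sin (δ - η))) (mul_pos (hτ n).1 s1) ?_
  have := hA.self (ε / ((n : ℝ) + 2) * (sin (δ - ψ) / sin (δ - η))) ⟨mul_pos (hτ n).1 s2, hn2⟩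
  rw [← hδe]
  convert interior_subset this using 1
  have hid := sine_id ψ η δ
  have s3' : ((sin (δ - η) : ℝ) : ℂ) ≠ 0 := by exact_mod_cast s3
  rw [add_assoc]
  congr 1
  push_cast at hid s3' ⊢
  calc _ = (ε : ℂ) / (n + 2) / Complex.sin (δ - η) * (Complex.sin (δ - η) * e ψ + Complex.sin (η - ψ) * e δ) := by
        field_simp
    _ = _ := by rw [hid]; ring

/-- two free rays do not separate the interior -/
lemma two_rays {x : ℂ} (hx : x ∉ interior X) {a1 a2 d1 d2 r1 r2 : ℝ} (hr1 : 0 < r1) (hr2 : 0 < r2)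
    (m1 : x + r1 * e a1 ∈ interior X) (m2 : x + r2 * e a2 ∈ interior X)
    (f1 : ∀ r : ℝ, 0 < r → x + r * e d1 ∉ X) (f2 : ∀ r : ℝ, 0 < r → x + r * e d2 ∉ X)
    (h1 : a1 < d1) (h2 : d1 < a2) (h3 : a2 < d2) (h4 : d2 < a1 + 2 * π) : False := by
  have hpi := pi_pos
  let g : ℂ → ℝ := fun p => d1 + π + Complex.arg ((p - x) / e (d1 + π))
  have harg : ∀ p, IsArg (p - x) (g p) := fun p => by
    have := (isArg_arg ((p - x) / e (d1 + π))).mul (show IsArg (e (d1 + π)) (d1 + π) by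
      have := isArg_smul_e (zero_le_one) (d1 + π); simpa using this)
    rwa [div_mul_cancel₀ _ (e_ne _), add_comm] at this
  have hne : ∀ p ∈ interior X, p - x ≠ 0 := fun p hp h0 => hx (by rwa [← sub_eq_zero.1 h0])
  have havoid : ∀ p ∈ interior X, ∀ d, (∀ r : ℝ, 0 < r → x + r * e d ∉ X) → e (g p) ≠ e d := by
    intro p hp d hd he
    have h5 := harg p
    rw [IsArg, he] at h5
    refine hd ‖p - x‖ (norm_pos_iff.2 (hne p hp)) ?_
    rw [← h5, add_sub_cancel]
    exact interior_subset hp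
  have hg : ContinuousOn g (interior X) := by
    intro p hp
    refine ContinuousAt.continuousWithinAt ?_
    refine continuousAt_const.add (ContinuousAt.comp (f := fun p => (p - x) / e (d1 + π)) (g := Complex.arg) ?_
      (Continuous.continuousAt (by fun_prop)))
    apply Complex.continuousAt_arg
    rw [Complex.mem_slitPlane_iff_arg]
    refine ⟨fun h5 => havoid p hp d1 f1 ?_, div_ne_zero (hne p hp) (e_ne _)⟩
    simp only [g, h5]
    rw [e_eq_iff]
    exact ⟨1, by push_cast; ring⟩
  have hval : ∀ r : ℝ, 0 < r → ∀ a, d1 < a → a ≤ d1 + 2 * π → g (x + r * e a) = a := by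
    intro r hr a ha1 ha2
    have h5 : ((x + r * e a) - x) / e (d1 + π) = r * e (a - (d1 + π)) := by
      rw [e_sub]; ring
    simp only [g, h5]
    have h6 := (isArg_smul_e hr.le (a - (d1 + π))).eq_arg
      (mul_ne_zero (by exact_mod_cast hr.ne') (e_ne _)) (by linarith) (by linarith)
    linarith
  have v1 := hval r1 hr1 (a1 + 2 * π) (by linarith) (by linarith)
  have v2 := hval r2 hr2 a2 (by linarith) (by linarith)
  have h5 : e (a1 + 2 * π) = e a1 := by
    have := e_add_int a1 1; simpa using this
  rw [h5] at v1
  obtain ⟨p, hp, hp2⟩ := h.conn.intermediate_value m2 m1 hg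
    (show d2 ∈ Icc (g (x + r2 * e a2)) (g (x + r1 * e a1)) from ⟨by rw [v2]; exact h3.le, by rw [v1]; exact h4.le⟩)
  exact havoid p hp d2 f2 (by rw [hp2])

lemma noABAB {x : ℂ} (hx : x ∈ frontier X) {ε : ℝ} (hε : 0 < ε) {a1 c a2 b : ℝ} (h1 : a1 < c) (h2 : c < a2)
    (h3 : a2 < b) (h4 : b < a1 + 2 * π) (A1 : Dr (interior X) x ε a1) (A2 : Dr (interior X) x ε a2)
    (B1 : Dr Xᶜ x ε c) (B2 : Dr Xᶜ x ε b) : False := by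
  obtain ⟨d1, k1, f1, n1⟩ := h.freeB hε B1
  obtain ⟨d2, k2, f2, n2⟩ := h.freeB hε B2
  have A3 : Dr (interior X) x ε (a1 + 2 * π) := by have := A1.add_int 1; simpa using this
  have g1 : a1 < d1 := by
    by_contra hc; exact n1 a1 (Or.inr ⟨by linarith, h1⟩) A1
  have g2 : d1 < a2 := by
    by_contra hc; exact n1 a2 (Or.inl ⟨h2, by linarith⟩) A2
  have g3 : a2 < d2 := by
    by_contra hc; exact n2 a2 (Or.inr ⟨by linarith, h3⟩) A2
  have g4 : d2 < a1 + 2 * π := by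
    by_contra hc; exact n2 _ (Or.inl ⟨h4, by linarith⟩) A3
  have hr : ε / 2 ∈ Ioo 0 ε := ⟨by linarith, by linarith⟩
  exact h.two_rays (h.fr_iff.1 hx).2 hr.1 hr.1 (A1.self _ hr) (A2.self _ hr) f1 f2 g1 g2 g3 g4

lemma exists_A {x : ℂ} {ε : ℝ} (hε0 : 0 < ε)
    (hε : ∀ w : ℂ, w ≠ 0 → ‖w‖ < ε → x + w ∈ frontier X → w / ‖w‖ ∈ E) {O : Set ℂ} (hO : IsOpen O)
    (hx : x ∈ closure O) (hx2 : x ∉ O) (b : ℝ) :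
    ∃ θ ∈ Ioo b (b + 2 * π), ∃ r ∈ Ioo 0 ε, x + (r : ℝ) * e θ ∈ O ∧ e θ ∉ E := by
  obtain ⟨p, hp, hd⟩ := Metric.mem_closure_iff.1 hx ε hε0
  rw [dist_comm, dist_eq_norm] at hd
  obtain ⟨θ, hθ, ha⟩ := exists_arg_Ico (p - x) b
  have hne : p - x ≠ 0 := fun h0 => hx2 (by rwa [← sub_eq_zero.1 h0])
  have hr := norm_pos_iff.2 hne
  have hp' : x + ‖p - x‖ * e θ ∈ O := by
    rw [IsArg] at ha; rw [← ha, add_sub_cancel]; exact hp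
  have hc : Continuous (fun η : ℝ => x + (‖p - x‖ : ℂ) * e η) := by
    have := continuous_e
    fun_prop
  have e1 := (hc.continuousAt.eventually_mem (hO.mem_nhds hp')).filter_mono
    (nhdsWithin_le_nhds (s := Ioi θ))
  obtain ⟨κ, hκ, hh⟩ := h.punct θ
  obtain ⟨η, g1, g2, g3⟩ := (e1.and
    (Filter.Eventually.and (Filter.eventually_of_mem (Ioo_mem_nhdsGT hθ.2) fun _ hh => hh)
      (Filter.eventually_of_mem (Ioo_mem_nhdsGT (show θ < θ + κ by linarith)) fun _ hh => hh))).exists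
  refine ⟨η, ⟨by linarith [hθ.1, g2.1], g2.2⟩, _, ⟨hr, hd⟩, g1, hh η ?_ g3.1.ne'⟩
  rw [abs_lt]; constructor <;> linarith [g3.1, g3.2]

lemma exists_locS {x : ℂ} (hx : x ∈ frontier X) : ∃ α β ε, LocS X x α β ε := by
  have hpi := pi_pos
  obtain ⟨ε, hε0, hε⟩ := h.dir x
  obtain ⟨hxX, hxi⟩ := h.fr_iff.1 hx
  have AB : ∀ θ, Dr (interior X) x ε θ → Dr Xᶜ x ε θ → False := fun θ h1 h2 =>
    h2.self (ε / 2) ⟨by linarith, by linarith⟩ (interior_subset (h1.self (ε / 2) ⟨by linarith, by linarith⟩))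
  obtain ⟨b, -, rb, hrb, hb1, hb2⟩ := h.exists_A hε0 hε h.comp.isClosed.isOpen_compl
    (by rw [closure_compl]; exact hxi) (by simpa using hxX) 0
  have notE : ∀ θ, e θ ∉ E → Dr (interior X) x ε θ ∨ Dr Xᶜ x ε θ := by
    intro θ hθ
    obtain ⟨κ, hκ, hh⟩ := h.punct θ
    have := h.sectorD hε (a := θ - κ) (b := θ + κ) (fun η hη => by
      by_cases h1 : η = θ
      · rwa [h1]
      · exact hh η (by rw [abs_lt]; constructor <;> linarith [hη.1, hη.2]) h1)
    rcases this with h1 | h1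
    · left; exact h1 θ ⟨by linarith, by linarith⟩
    · right; exact h1 θ ⟨by linarith, by linarith⟩
  have hb : Dr Xᶜ x ε b := by
    rcases notE b hb2 with h1 | h1
    · exact absurd (interior_subset (h1.self rb hrb)) hb1
    · exact h1
  obtain ⟨a, ha, ra, hra, ha1, ha2⟩ := h.exists_A hε0 hε isOpen_interior
    (by rw [← h.reg]; exact hxX) hxi b
  have hA : Dr (interior X) x ε a := by
    rcases notE a ha2 with h1 | h1
    · exact h1
    · exact absurd (interior_subset ha1) (h1.self ra hra)
  let S : Set ℝ := {θ | θ ∈ Ioo b (b + 2 * π) ∧ Dr (interior X) x ε θ}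
  have hSne : S.Nonempty := ⟨a, ha, hA⟩
  have hSb : BddBelow S := ⟨b, fun θ hθ => hθ.1.1.le⟩
  have hSa : BddAbove S := ⟨b + 2 * π, fun θ hθ => hθ.1.2.le⟩
  have hb' : Dr Xᶜ x ε (b + 2 * π) := by have := hb.add_int 1; simpa using this
  obtain ⟨κ, hκ, hbκ⟩ := hb.open
  obtain ⟨κ', hκ', hbκ'⟩ := hb'.open
  have i1 : b + κ ≤ sInf S := le_csInf hSne fun θ hθ => by
    by_contra hc
    exact AB θ hθ.2 (hbκ θ (by rw [abs_lt]; constructor <;> linarith [hθ.1.1]))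
  have i2 : sSup S ≤ b + 2 * π - κ' := csSup_le hSne fun θ hθ => by
    by_contra hc
    exact AB θ hθ.2 (hbκ' θ (by rw [abs_lt]; constructor <;> linarith [hθ.1.2]))
  have ia := csInf_le hSb (show a ∈ S from ⟨ha, hA⟩)
  have sa := le_csSup hSa (show a ∈ S from ⟨ha, hA⟩)
  have ha3 := ha.1
  have ha4 := ha.2
  have noA : ∀ θ ∈ Ioo b (b + 2 * π), (θ < sInf S ∨ sSup S < θ) → Dr Xᶜ x ε θ := by
    intro θ hθ hor
    obtain ⟨μ, hμ, hμ2⟩ : ∃ μ > 0, ∀ η, |η - θ| < μ → ¬ Dr (interior X) x ε η := by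
      rcases hor with ho | ho
      · refine ⟨min (θ - b) (sInf S - θ), lt_min (by linarith [hθ.1]) (by linarith), fun η hη hd => ?_⟩
        rw [lt_min_iff, abs_lt, abs_lt] at hη
        have := csInf_le hSb (show η ∈ S from ⟨⟨by linarith, by linarith⟩, hd⟩)
        linarith
      · refine ⟨min (b + 2 * π - θ) (θ - sSup S), lt_min (by linarith [hθ.2]) (by linarith), fun η hη hd => ?_⟩
        rw [lt_min_iff, abs_lt, abs_lt] at hη
        have := le_csSup hSa (show η ∈ S from ⟨⟨by linarith, by linarith⟩, hd⟩)
        linarith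
    rcases h.germ hε θ with g | g | ⟨κ, hκ, ⟨g, -⟩ | ⟨-, g⟩⟩
    · exact absurd g (hμ2 θ (by simpa using hμ))
    · exact g
    · have m1 := lt_min hκ hμ
      have m2 := min_le_left κ μ
      have m3 := min_le_right κ μ
      exact absurd (g (θ - min κ μ / 2) ⟨by linarith, by linarith⟩)
        (hμ2 _ (by rw [abs_lt]; constructor <;> linarith))
    · have m1 := lt_min hκ hμ
      have m2 := min_le_left κ μ
      have m3 := min_le_right κ μ
      exact absurd (g (θ + min κ μ / 2) ⟨by linarith, by linarith⟩)
        (hμ2 _ (by rw [abs_lt]; constructor <;> linarith))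
  have inA : ∀ θ ∈ Ioo (sInf S) (sSup S), Dr (interior X) x ε θ := by
    intro θ hθ
    obtain ⟨a1, s1, l1⟩ := exists_lt_of_csInf_lt hSne hθ.1
    obtain ⟨a2, s2, l2⟩ := exists_lt_of_lt_csSup hSne hθ.2
    have noB : ∀ η ∈ Ioo a1 a2, ¬ Dr Xᶜ x ε η := fun η hη hB =>
      h.noABAB hx hε0 hη.1 hη.2 s2.1.2 (by linarith [s1.1.1]) s1.2 s2.2 hB hb'
    rcases h.germ hε θ with g | g | ⟨κ, hκ, ⟨-, g⟩ | ⟨g, -⟩⟩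
    · exact g
    · exact absurd g (noB θ ⟨l1, l2⟩)
    · have m1 := lt_min hκ (sub_pos.2 l2)
      have m2 := min_le_left κ (a2 - θ)
      have m3 := min_le_right κ (a2 - θ)
      exact absurd (g (θ + min κ (a2 - θ) / 2) ⟨by linarith, by linarith⟩)
        (noB _ ⟨by linarith, by linarith⟩)
    · have m1 := lt_min hκ (sub_pos.2 l1)
      have m2 := min_le_left κ (θ - a1)
      have m3 := min_le_right κ (θ - a1)
      exact absurd (g (θ - min κ (θ - a1) / 2) ⟨by linarith, by linarith⟩)
        (noB _ ⟨by linarith, by linarith⟩)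
  refine ⟨sInf S, sSup S, ε, hε0, ?_, by linarith, fun θ hθ => (inA θ hθ).self, fun θ hθ => ?_⟩
  · obtain ⟨κ, hκ, hh⟩ := hA.open
    have m1 := lt_min hκ (sub_pos.2 ha.2)
    have m2 := min_le_left κ (b + 2 * π - a)
    have m3 := min_le_right κ (b + 2 * π - a)
    have := le_csSup hSa (show a + min κ (b + 2 * π - a) / 2 ∈ S from
      ⟨⟨by linarith [ha.1], by linarith⟩, hh _ (by rw [abs_lt]; constructor <;> linarith)⟩)
    have := csInf_le hSb (show a ∈ S from ⟨ha, hA⟩)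
    linarith
  · rcases lt_trichotomy θ (b + 2 * π) with h1 | h1 | h1
    · exact (noA θ ⟨by linarith [hθ.1, le_csSup hSa (show a ∈ S from ⟨ha, hA⟩), ha.1], h1⟩ (Or.inr hθ.1)).self
    · rw [h1]; exact hb'.self
    · have := (noA (θ - 2 * π) ⟨by linarith, by linarith [hθ.2, csInf_le hSb (show a ∈ S from ⟨ha, hA⟩), ha.2]⟩
        (Or.inl (by linarith [hθ.2]))).add_int 1
      have := this.self
      simpa using this

end IsNice

end MS

namespace MS

/-- smooth boundary point with direction `u` -/
def Sm (X : Set ℂ) (p u : ℂ) : Prop :=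
  ‖u‖ = 1 ∧ ∃ ε > 0, ∀ w : ℂ, ‖w‖ < ε → (0 < cr u w → p + w ∈ interior X) ∧ (cr u w < 0 → p + w ∉ X)

/-- boundary arrives at `x` in direction `u` -/
def InD (X : Set ℂ) (x u : ℂ) : Prop := ∃ ε > 0, ∀ r ∈ Ioo 0 ε, Sm X (x - (r : ℝ) * u) u
/-- boundary leaves `x` in direction `u` -/
def OutD (X : Set ℂ) (x u : ℂ) : Prop := ∃ ε > 0, ∀ r ∈ Ioo 0 ε, Sm X (x + (r : ℝ) * u) u

lemma cr_comm (a b : ℂ) : cr a b = - cr b a := by simp [cr]; ring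

lemma cr_I (u : ℂ) (hu : ‖u‖ = 1) : cr u (Complex.I * u) = 1 := by
  have h1 : Complex.normSq u = 1 := by rw [Complex.normSq_eq_norm_sq, hu]; norm_num
  rw [Complex.normSq_apply] at h1
  simp [cr]; linarith

lemma Sm.unique {X : Set ℂ} {p u u' : ℂ} (h : Sm X p u) (h' : Sm X p u') : u = u' := by
  obtain ⟨hu, ε, hε, H⟩ := h
  obtain ⟨hu', ε', hε', H'⟩ := h'
  have key : ∀ w : ℂ, 0 < cr u w → cr u' w < 0 → False := by
    intro w h1 h2
    obtain ⟨τ, hτ, hτ1, hτ2⟩ : ∃ τ : ℝ, 0 < τ ∧ τ * ‖w‖ < ε ∧ τ * ‖w‖ < ε' := by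
      refine ⟨min ε ε' / (2 * (‖w‖ + 1)), by positivity, ?_, ?_⟩
      · have := min_le_left ε ε'
        rw [div_mul_eq_mul_div, div_lt_iff₀ (by positivity)]
        nlinarith [norm_nonneg w, lt_min hε hε']
      · have := min_le_right ε ε'
        rw [div_mul_eq_mul_div, div_lt_iff₀ (by positivity)]
        nlinarith [norm_nonneg w, lt_min hε hε']
    have hn : ‖(τ : ℂ) * w‖ = τ * ‖w‖ := by rw [norm_mul, Complex.norm_of_nonneg hτ.le]
    have a1 := (H (τ * w) (by rw [hn]; exact hτ1)).1 (by rw [cr_smul_right]; positivity)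
    have a2 := (H' (τ * w) (by rw [hn]; exact hτ2)).2 (by rw [cr_smul_right]; nlinarith)
    exact a2 (interior_subset a1)
  have n1 : Complex.normSq u = 1 := by rw [Complex.normSq_eq_norm_sq, hu]; norm_num
  have n2 : Complex.normSq u' = 1 := by rw [Complex.normSq_eq_norm_sq, hu']; norm_num
  rcases lt_trichotomy (cr u u') 0 with h1 | h1 | h1
  · exfalso
    refine key (-(u + u')) ?_ ?_
    · rw [cr_neg_right, cr_add_right, cr_self]; linarith
    · rw [cr_neg_right, cr_add_right, cr_self, cr_comm u' u]; linarith
  · -- parallel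
    have h2 : u' = ((u.re * u'.re + u.im * u'.im : ℝ) : ℂ) * u := by
      rw [Complex.normSq_apply] at n1
      rw [cr] at h1
      apply Complex.ext
      · rw [Complex.re_ofReal_mul]
        linear_combination (-u'.re) * n1 + (-u.im) * h1
      · rw [Complex.im_ofReal_mul]
        linear_combination (-u'.im) * n1 + u.re * h1
    set c : ℝ := u.re * u'.re + u.im * u'.im with hc
    have h3 : c * c = 1 := by
      rw [h2, Complex.normSq_mul, n1, Complex.normSq_ofReal] at n2
      linarith
    rcases mul_self_eq_one_iff.1 h3 with h4 | h4
    · rw [h2, h4]; simp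
    · exfalso
      have h5 : u' = -u := by rw [h2, h4]; simp
      refine key (Complex.I * u) (by rw [cr_I u hu]; norm_num) ?_
      have := cr_I u hu
      rw [h5]
      rw [show cr (-u) (Complex.I * u) = - cr u (Complex.I * u) by simp [cr]; ring, this]
      norm_num
  · exfalso
    refine key (u + u') ?_ ?_
    · rw [cr_add_right, cr_self]; linarith
    · rw [cr_add_right, cr_self, cr_comm u' u]; linarith

lemma Sm.ne_neg {X : Set ℂ} {p u : ℂ} (h : Sm X p u) (h' : Sm X p (-u)) : False := by
  have := h.unique h'
  have h1 : u = 0 := by linear_combination this / 2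
  have := h.1
  rw [h1] at this
  simp at this

lemma Sm.move {X : Set ℂ} {p u : ℂ} (h : Sm X p u) : ∃ ε > 0, ∀ s : ℝ, |s| < ε → Sm X (p + s * u) u := by
  obtain ⟨hu, ε, hε, H⟩ := h
  refine ⟨ε / 2, by linarith, fun s hs => ⟨hu, ε / 2, by linarith, fun w hw => ?_⟩⟩
  have h1 := H (s * u + w) (by
    calc ‖(s : ℂ) * u + w‖ ≤ ‖(s : ℂ) * u‖ + ‖w‖ := norm_add_le _ _
      _ = |s| + ‖w‖ := by rw [norm_mul, hu, mul_one, Complex.norm_real, Real.norm_eq_abs]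
      _ < ε := by linarith)
  rw [cr_add_right, cr_smul_right, cr_self, mul_zero, zero_add, ← add_assoc] at h1
  exact h1

lemma Sm.inD {X : Set ℂ} {p u : ℂ} (h : Sm X p u) : InD X p u := by
  obtain ⟨ε, hε, H⟩ := h.move
  refine ⟨ε, hε, fun r hr => ?_⟩
  have := H (-r) (by rw [abs_neg, abs_of_pos hr.1]; exact hr.2)
  convert this using 1
  push_cast; ring

lemma Sm.fr {X : Set ℂ} {p u : ℂ} (h : Sm X p u) : p ∈ frontier X := by
  obtain ⟨hu, ε, hε, H⟩ := h
  rw [frontier_eq_closure_inter_closure]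
  have hn : ∀ τ : ℝ, 0 < τ → ‖(τ : ℂ) * (Complex.I * u)‖ = τ := fun τ hτ => by
    rw [norm_mul, norm_mul, hu, Complex.norm_of_nonneg hτ.le]; simp
  constructor <;> rw [Metric.mem_closure_iff] <;> intro ε' hε'
  · have hm := lt_min hε hε'
    have m1 := min_le_left ε ε'
    have m2 := min_le_right ε ε'
    refine ⟨p + ((min ε ε' / 2 : ℝ) : ℂ) * (Complex.I * u), interior_subset ((H _ ?_).1 ?_), ?_⟩
    · rw [hn _ (by linarith)]; linarith
    · rw [cr_smul_right, cr_I u hu]; linarith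
    · rw [dist_eq_norm, sub_add_cancel_left, norm_neg, hn _ (by linarith)]; linarith
  · have hm := lt_min hε hε'
    have m1 := min_le_left ε ε'
    have m2 := min_le_right ε ε'
    refine ⟨p + -(((min ε ε' / 2 : ℝ) : ℂ) * (Complex.I * u)), (H _ ?_).2 ?_, ?_⟩
    · rw [norm_neg, hn _ (by linarith)]; linarith
    · rw [cr_neg_right, cr_smul_right, cr_I u hu]; linarith
    · rw [dist_eq_norm, sub_add_cancel_left, norm_neg, norm_neg, hn _ (by linarith)]; linarith

namespace LocS

variable {X : Set ℂ} {x : ℂ} {α β ε : ℝ} (h : LocS X x α β ε)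
include h

lemma smA {r : ℝ} (hr : r ∈ Ioo 0 ε) : Sm X (x + r * e α) (e α) := by
  refine ⟨norm_e α, ?_⟩
  obtain ⟨ρ, hρ, H⟩ := near_ray α hr.1 hr.2 (lt_min (sub_pos.2 h.h1) (sub_pos.2 h.h2))
  refine ⟨ρ, hρ, fun w hw => ?_⟩
  obtain ⟨η, hη, r', hr', heq, h1, h2⟩ := H w hw
  rw [lt_min_iff, abs_lt, abs_lt] at hη
  rw [add_assoc, heq]
  refine ⟨fun h3 => h.hin _ ⟨by linarith [h1 h3], by linarith⟩ r' hr', fun h3 => ?_⟩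
  have := h.hout (α + η + 2 * π) ⟨by linarith, by linarith [h2 h3]⟩ r' hr'
  rwa [show e (α + η + 2 * π) = e (α + η) by have := e_add_int (α + η) 1; simpa using this] at this

lemma smB {r : ℝ} (hr : r ∈ Ioo 0 ε) : Sm X (x + r * e β) (-e β) := by
  refine ⟨by rw [norm_neg, norm_e], ?_⟩
  obtain ⟨ρ, hρ, H⟩ := near_ray β hr.1 hr.2 (lt_min (sub_pos.2 h.h1) (sub_pos.2 h.h2))
  refine ⟨ρ, hρ, fun w hw => ?_⟩
  obtain ⟨η, hη, r', hr', heq, h1, h2⟩ := H w hw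
  rw [lt_min_iff, abs_lt, abs_lt] at hη
  rw [add_assoc, heq, show cr (-e β) w = - cr (e β) w by simp [cr]; ring]
  refine ⟨fun h3 => h.hin _ ⟨by linarith, by linarith [h2 (by linarith)]⟩ r' hr', fun h3 => ?_⟩
  exact h.hout _ ⟨by linarith [h1 (by linarith)], by linarith⟩ r' hr'

lemma near {w : ℂ} (hw : w ≠ 0) (hw2 : ‖w‖ < ε) (hf : x + w ∈ frontier X) :
    w = ‖w‖ * e α ∨ w = ‖w‖ * e β := by
  obtain ⟨θ, hθ, ha⟩ := exists_arg_Ico w α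
  have hn := norm_pos_iff.2 hw
  rw [frontier_eq_closure_inter_closure] at hf
  rcases eq_or_lt_of_le hθ.1 with h1 | h1
  · left; rw [h1]; exact ha
  rcases lt_trichotomy θ β with h2 | h2 | h2
  · have := h.hin θ ⟨h1, h2⟩ _ ⟨hn, hw2⟩
    rw [← ha] at this
    rw [closure_compl] at hf
    exact absurd this hf.2
  · right; rw [← h2]; exact ha
  · exfalso
    have hsm := h.hout θ ⟨h2, hθ.2⟩ _ ⟨hn, hw2⟩
    rw [← ha] at hsm
    -- the complement near this point
    obtain ⟨ρ, hρ, H⟩ := near_ray θ hn hw2 (lt_min (sub_pos.2 h2) (sub_pos.2 hθ.2))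
    obtain ⟨q, hq, hd⟩ := Metric.mem_closure_iff.1 hf.1 ρ hρ
    obtain ⟨η, hη, r', hr', heq, -⟩ := H (q - (x + w)) (by rwa [← dist_eq_norm, dist_comm])
    rw [lt_min_iff, abs_lt, abs_lt] at hη
    rw [← ha] at heq
    refine h.hout (θ + η) ⟨by linarith, by linarith⟩ r' hr' ?_
    rw [← heq]
    convert hq using 1
    ring

lemma outA : OutD X x (e α) := ⟨ε, h.pos, fun _ hr => h.smA hr⟩

lemma inB {u : ℂ} (hu : InD X x u) : u = - e β := by
  obtain ⟨ε', hε', H⟩ := hu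
  have hm := lt_min h.pos hε'
  have m1 := min_le_left ε ε'
  have m2 := min_le_right ε ε'
  obtain ⟨r, hrd⟩ : ∃ r, r = min ε ε' / 2 := ⟨_, rfl⟩
  have hs := H r ⟨by linarith, by linarith⟩
  have hr : r ∈ Ioo 0 ε := ⟨by linarith, by linarith⟩
  have hu1 := hs.1
  have hn : ‖-((r : ℂ) * u)‖ = r := by rw [norm_neg, norm_mul, hu1, mul_one, Complex.norm_of_nonneg hr.1.le]
  have hr0 : (r : ℂ) ≠ 0 := by exact_mod_cast hr.1.ne'
  have hne : -((r : ℂ) * u) ≠ 0 := by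
    intro h0; rw [h0, norm_zero] at hn; exact hr.1.ne hn
  have := h.near hne (by rw [hn]; exact hr.2) (by rw [← sub_eq_add_neg]; exact hs.fr)
  rw [hn] at this
  rcases this with h1 | h1
  · exfalso
    have h2 : u = - e α := by
      apply mul_left_cancel₀ hr0; linear_combination -h1
    have h3 := h.smA hr
    rw [h2] at hs
    refine h3.ne_neg ?_
    convert hs using 1
    ring
  · apply mul_left_cancel₀ hr0; linear_combination -h1

lemma smooth_near {w : ℂ} (hw : w ≠ 0) (hw2 : ‖w‖ < ε) (hf : x + w ∈ frontier X) :
    ∃ u, Sm X (x + w) u := by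
  have hn := norm_pos_iff.2 hw
  rcases h.near hw hw2 hf with h1 | h1
  · rw [h1]; exact ⟨_, h.smA ⟨hn, hw2⟩⟩
  · rw [h1]; exact ⟨_, h.smB ⟨hn, hw2⟩⟩

end LocS

/-- corner points -/
def Cor (X : Set ℂ) : Set ℂ := {x | x ∈ frontier X ∧ ¬ ∃ u, Sm X x u}

namespace IsNice

variable {X : Set ℂ} {ℓ : ℝ} {E : Set ℂ} (h : IsNice X ℓ E)
include h

lemma in_unique {x u u' : ℂ} (hx : x ∈ frontier X) (h1 : InD X x u) (h2 : InD X x u') : u = u' := by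
  obtain ⟨α, β, ε, hl⟩ := h.exists_locS hx
  rw [hl.inB h1, hl.inB h2]

lemma cor_finite : (Cor X).Finite := by
  by_contra hinf
  have hc : IsCompact (frontier X) := h.comp.of_isClosed_subset isClosed_frontier h.comp.isClosed.frontier_subset
  obtain ⟨x, hx, hacc⟩ := Set.Infinite.exists_accPt_of_subset_isCompact (K := frontier X) hinf hc
    (fun x hx => hx.1)
  obtain ⟨α, β, ε, hl⟩ := h.exists_locS hx
  rw [accPt_iff_nhds] at hacc
  obtain ⟨y, ⟨hy1, hy2⟩, hne⟩ := hacc (Metric.ball x ε) (Metric.ball_mem_nhds x hl.pos)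
  have := hl.smooth_near (w := y - x) (sub_ne_zero.2 hne) (by rwa [← dist_eq_norm])
    (by rw [add_sub_cancel]; exact hy2.1)
  rw [add_sub_cancel] at this
  exact hy2.2 this

lemma edge_exists {x : ℂ} (hx : x ∈ frontier X) : ∃ (T : ℝ) (u : ℂ), 0 < T ∧ x + T * u ∈ Cor X ∧
    ∀ r ∈ Ioo 0 T, Sm X (x + (r : ℝ) * u) u := by
  obtain ⟨α, β, ε, hl⟩ := h.exists_locS hx
  set u := e α with hu
  let G : Set ℝ := {T | 0 < T ∧ ∀ r ∈ Ioo 0 T, Sm X (x + (r : ℝ) * u) u}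
  have hG0 : ε ∈ G := ⟨hl.pos, fun r hr => hl.smA hr⟩
  obtain ⟨R, hR⟩ := h.comp.isBounded.exists_norm_le
  have hn : ∀ r : ℝ, 0 < r → ‖(r : ℂ) * u‖ = r := fun r hr => by
    rw [norm_mul, norm_e, mul_one, Complex.norm_of_nonneg hr.le]
  have hGb : BddAbove G := by
    refine ⟨4 * R + 2, fun T hT => ?_⟩
    by_contra hc
    have hx' := hR x (h.comp.isClosed.frontier_subset hx)
    have hR0 : 0 ≤ R := (norm_nonneg _).trans hx'
    have h1 := hR _ (h.comp.isClosed.frontier_subset (hT.2 (4 * R + 1) ⟨by linarith, by linarith⟩).fr)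
    have h2 := hn (4 * R + 1) (by linarith)
    have h3 := norm_sub_le (x + ((4 * R + 1 : ℝ) : ℂ) * u) x
    rw [add_sub_cancel_left, h2] at h3
    linarith
  set T := sSup G with hT
  have hTε : ε ≤ T := le_csSup hGb hG0
  have hTpos : 0 < T := hl.pos.trans_le hTε
  have hTG : ∀ r ∈ Ioo 0 T, Sm X (x + (r : ℝ) * u) u := by
    intro r hr
    obtain ⟨T', hT', hlt⟩ := exists_lt_of_lt_csSup ⟨ε, hG0⟩ hr.2
    exact hT'.2 r ⟨hr.1, hlt⟩
  have hyf : x + T * u ∈ frontier X := by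
    have hc : Continuous (fun r : ℝ => x + (r : ℂ) * u) := by fun_prop
    refine isClosed_frontier.mem_of_tendsto (hc.continuousAt.tendsto.mono_left
      (nhdsWithin_le_nhds (a := T) (s := Iio T))) ?_
    filter_upwards [Ioo_mem_nhdsLT hTpos] with r hr
    exact (hTG r hr).fr
  refine ⟨T, u, hTpos, ⟨hyf, ?_⟩, hTG⟩
  rintro ⟨u', hs⟩
  have hin : InD X (x + T * u) u := ⟨T, hTpos, fun r hr => by
    have := hTG (T - r) ⟨by linarith [hr.2], by linarith [hr.1]⟩
    convert this using 1
    push_cast; ring⟩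
  have := h.in_unique hyf hin hs.inD
  subst this
  obtain ⟨ε', hε', H⟩ := hs.move
  have hmem : T + ε' / 2 ∈ G := by
    refine ⟨by linarith, fun r hr => ?_⟩
    rcases lt_or_ge r T with h1 | h1
    · exact hTG r ⟨hr.1, h1⟩
    · have := H (r - T) (by rw [abs_lt]; constructor <;> linarith [hr.2])
      convert this using 1
      push_cast; ring
  have := le_csSup hGb hmem
  linarith

/-- the cycle of corners -/
lemma exists_cycle : ∃ (N : ℤ) (v : ℤ → ℂ) (T : ℤ → ℝ) (u : ℤ → ℂ), 0 < N ∧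
    (∀ k, v k ∈ Cor X) ∧ (∀ k, 0 < T k) ∧ (∀ k, v (k + 1) = v k + T k * u k) ∧
    (∀ k, ∀ r ∈ Ioo 0 (T k), Sm X (v k + (r : ℝ) * u k) (u k)) ∧
    ∀ i j, v i = v j ↔ ∃ m : ℤ, j = i + m * N := by
  have hfin := h.cor_finite
  have : Finite (Cor X) := hfin
  have hch : ∀ x : Cor X, ∃ (T : ℝ) (u : ℂ), 0 < T ∧ x.1 + T * u ∈ Cor X ∧
    ∀ r ∈ Ioo 0 T, Sm X (x.1 + (r : ℝ) * u) u := fun x => h.edge_exists x.2.1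
  choose T u hT hc hs using hch
  let nxt : Cor X → Cor X := fun x => ⟨x.1 + T x * u x, hc x⟩
  have hin : ∀ x, InD X (nxt x).1 (u x) := fun x => ⟨T x, hT x, fun r hr => by
    have := hs x (T x - r) ⟨by linarith [hr.2], by linarith [hr.1]⟩
    convert this using 1
    simp only [nxt]
    push_cast; ring⟩
  have hinj : Function.Injective nxt := by
    have key : ∀ x y, nxt x = nxt y → ¬ T x < T y := by
      intro x y hxy hlt
      have h1 : u x = u y := h.in_unique (nxt x).2.1 (hin x) (by rw [hxy]; exact hin y)
      have h2 : x.1 + T x * u x = y.1 + T y * u y := congrArg Subtype.val hxy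
      refine x.2.2 ⟨u y, ?_⟩
      have := hs y (T y - T x) ⟨by linarith, by linarith [hT x]⟩
      convert this using 1
      rw [h1] at h2
      push_cast
      linear_combination h2
    intro x y hxy
    have h1 : u x = u y := h.in_unique (nxt x).2.1 (hin x) (by rw [hxy]; exact hin y)
    have h2 : x.1 + T x * u x = y.1 + T y * u y := congrArg Subtype.val hxy
    have h3 : T x = T y := le_antisymm (not_lt.1 (key y x hxy.symm)) (not_lt.1 (key x y hxy))
    rw [h1, h3] at h2
    exact Subtype.ext (add_right_cancel h2)
  let σ : Equiv.Perm (Cor X) := Equiv.ofBijective nxt (Finite.injective_iff_bijective.1 hinj)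
  have hσ : ∀ x, σ x = nxt x := fun x => rfl
  -- a first corner
  have hne : (frontier X).Nonempty := by
    obtain ⟨p, hp⟩ := h.ne
    obtain ⟨r', -, hr'⟩ := last_pt h.comp (z := p) (r := 0) (δ := 0) (by simpa using hp)
    exact ⟨_, hr'⟩
  obtain ⟨p, hp⟩ := hne
  obtain ⟨T0, u0, -, hx0, -⟩ := h.edge_exists hp
  let x0 : Cor X := ⟨_, hx0⟩
  have hper : 0 < MulAction.period σ x0 := by
    exact MulAction.period_pos_of_orderOf_pos (isOfFinOrder_iff_pow_eq_one.2 (isOfFinOrder_iff_pow_eq_one.1 (isOfFinOrder_of_finite σ))).orderOf_pos x0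
  refine ⟨MulAction.period σ x0, fun k => ((σ ^ k) x0).1, fun k => T ((σ ^ k) x0),
    fun k => u ((σ ^ k) x0), by exact_mod_cast hper, fun k => ((σ ^ k) x0).2, fun k => hT _, fun k => ?_,
    fun k => hs _, fun i j => ?_⟩
  · have : (σ ^ (k + 1)) x0 = nxt ((σ ^ k) x0) := by
      rw [add_comm, zpow_add, zpow_one, Equiv.Perm.mul_apply, hσ]
    simp only [this, nxt]
  · rw [← Subtype.ext_iff]
    have h1 : (σ ^ i) x0 = (σ ^ j) x0 ↔ (σ ^ (j - i)) • x0 = x0 := by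
      rw [show j = i + (j - i) by ring, zpow_add, Equiv.Perm.mul_apply, Equiv.Perm.smul_def]
      rw [add_sub_cancel_left]
      constructor
      · intro h2; exact ((σ ^ i).injective h2).symm
      · intro h2; rw [h2]
    rw [h1, MulAction.zpow_smul_eq_iff_period_dvd]
    constructor
    · rintro ⟨m, hm⟩; exact ⟨m, by linear_combination hm⟩
    · rintro ⟨m, hm⟩; exact ⟨m, by rw [hm]; ring⟩

end IsNice

end MS

namespace MS

lemma exists_int_sum (f : ℤ → ℝ) (a : ℝ) : ∃ S : ℤ → ℝ, S 0 = a ∧ ∀ k, S (k + 1) - S k = f k := by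
  refine ⟨fun k => a + ∑ i ∈ Finset.range k.toNat, f i
    - ∑ i ∈ Finset.range (-k).toNat, f (-(i + 1 : ℤ)), by simp, ?_⟩
  intro k
  rcases le_or_gt 0 k with hk | hk
  · have h1 : (k + 1).toNat = k.toNat + 1 := by omega
    have h2 : (-(k + 1)).toNat = 0 := by omega
    have h3 : (-k).toNat = 0 := by omega
    have h4 : ((k.toNat : ℕ) : ℤ) = k := by omega
    simp only [h1, h2, h3, Finset.sum_range_succ, h4]
    simp
  · have h1 : (k + 1).toNat = 0 := by omega
    have h2 : (-k).toNat = (-(k + 1)).toNat + 1 := by omega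
    have h3 : k.toNat = 0 := by omega
    have h4 : (-(((-(k + 1)).toNat : ℕ) + 1 : ℤ)) = k := by omega
    simp only [h1, h2, h3, Finset.sum_range_succ, h4]
    simp

lemma mk_phi (q : ℤ → ℂ) (hq : ∀ k, q k ≠ 0) (a : ℝ) (ha : IsArg (q 0) a) :
    ∃ φ : ℤ → ℝ, φ 0 = a ∧ (∀ k, IsArg (q k) (φ k)) ∧
      ∀ k, φ (k + 1) - φ k = Complex.arg (q (k + 1) / q k) := by
  obtain ⟨S, h0, hS⟩ := exists_int_sum (fun k => Complex.arg (q (k + 1) / q k)) a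
  refine ⟨S, h0, ?_, hS⟩
  have hd : ∀ k, IsArg (q (k + 1) / q k) (S (k + 1) - S k) := by
    intro k; rw [hS]; exact isArg_arg _
  intro k
  induction k using Int.induction_on with
  | zero => rw [h0]; exact ha
  | succ n ih =>
    have := (hd n).mul ih
    rw [div_mul_cancel₀ _ (hq _)] at this
    convert this using 1
    ring
  | pred n ih =>
    have h1 := hd (-n - 1)
    rw [sub_add_cancel] at h1
    have := ih.div h1
    rw [div_div_cancel₀ (hq _)] at this
    convert this using 1
    ring

section cyc
variable {X : Set ℂ} {N : ℤ} {v : ℤ → ℂ} {T : ℤ → ℝ} {u : ℤ → ℂ}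
  (hN : 0 < N) (hv : ∀ k, v k ∈ Cor X) (hT : ∀ k, 0 < T k)
  (hs : ∀ k, v (k + 1) = v k + T k * u k)
  (hsm : ∀ k, ∀ r ∈ Ioo 0 (T k), Sm X (v k + (r : ℝ) * u k) (u k))
  (hvi : ∀ i j, v i = v j ↔ ∃ m : ℤ, j = i + m * N)
include hT hsm

lemma cyc_norm (k : ℤ) : ‖u k‖ = 1 :=
  (hsm k (T k / 2) ⟨by linarith [hT k], by linarith [hT k]⟩).1

include hs
lemma cyc_gam {t : ℝ} (ht : 0 < Int.fract t) : Sm X (gam v t) (u ⌊t⌋) := by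
  have h1 := Int.fract_lt_one t
  have h2 := hsm ⌊t⌋ (Int.fract t * T ⌊t⌋) ⟨mul_pos ht (hT _), by nlinarith [hT ⌊t⌋]⟩
  convert h2 using 1
  rw [gam, hs]; push_cast; ring

include hv hvi
lemma cyc_inj (s t : ℝ) (hst : gam v s = gam v t) : ∃ m : ℤ, t = s + m * N := by
  have g0 : ∀ t : ℝ, Int.fract t = 0 → gam v t = v ⌊t⌋ := by
    intro t ht; rw [gam, ht]; simp
  have aux : ∀ s t : ℝ, gam v s = gam v t → Int.fract s = 0 → 0 < Int.fract t → False := by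
    intro s t hst h1 h2
    have h3 := cyc_gam hT hs hsm h2
    rw [← hst, g0 s h1] at h3
    exact (hv ⌊s⌋).2 ⟨_, h3⟩
  have es := Int.floor_add_fract s
  have et := Int.floor_add_fract t
  rcases eq_or_lt_of_le (Int.fract_nonneg s) with h1 | h1
  · rcases eq_or_lt_of_le (Int.fract_nonneg t) with h2 | h2
    · rw [g0 s h1.symm, g0 t h2.symm] at hst
      obtain ⟨m, hm⟩ := (hvi _ _).1 hst
      refine ⟨m, ?_⟩
      rw [← es, ← et, ← h1, ← h2, hm]; push_cast; ring
    · exact (aux s t hst h1.symm h2).elim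
  · rcases eq_or_lt_of_le (Int.fract_nonneg t) with h2 | h2
    · exact (aux t s hst.symm h2.symm h1).elim
    · have a1 := cyc_gam hT hs hsm h1
      have a2 := cyc_gam hT hs hsm h2
      rw [← hst] at a2
      have hu := a1.unique a2
      have hu1 := cyc_norm hT hsm ⌊s⌋
      have hu0 : u ⌊s⌋ ≠ 0 := by intro h0; rw [h0] at hu1; simp at hu1
      have aux2 : ∀ s t : ℝ, gam v s = gam v t → u ⌊s⌋ = u ⌊t⌋ → 0 < Int.fract s →
          Int.fract s * T ⌊s⌋ < Int.fract t * T ⌊t⌋ → False := by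
        intro s t hst hu h0 hlt
        have h3 := hsm ⌊t⌋ (Int.fract t * T ⌊t⌋ - Int.fract s * T ⌊s⌋)
          ⟨by linarith, by nlinarith [hT ⌊t⌋, hT ⌊s⌋, Int.fract_lt_one t]⟩
        refine (hv ⌊s⌋).2 ⟨u ⌊t⌋, ?_⟩
        · convert h3 using 1
          rw [gam, gam, hs, hs, hu] at hst
          push_cast
          linear_combination hst
      have hab : Int.fract s * T ⌊s⌋ = Int.fract t * T ⌊t⌋ := by
        rcases lt_trichotomy (Int.fract s * T ⌊s⌋) (Int.fract t * T ⌊t⌋) with h | h | h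
        · exact (aux2 s t hst hu h1 h).elim
        · exact h
        · exact (aux2 t s hst.symm hu.symm h2 h).elim
      have hveq : v ⌊s⌋ = v ⌊t⌋ := by
        rw [gam, gam, hs, hs, ← hu] at hst
        have hab' : ((Int.fract s : ℝ) : ℂ) * T ⌊s⌋ = (Int.fract t : ℝ) * T ⌊t⌋ := by
          exact_mod_cast hab
        linear_combination hst - u ⌊s⌋ * hab'
      obtain ⟨m, hm⟩ := (hvi _ _).1 hveq
      have hv1 : v (⌊s⌋ + 1) = v (⌊t⌋ + 1) := (hvi _ _).2 ⟨m, by rw [hm]; ring⟩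
      have hTT : T ⌊s⌋ = T ⌊t⌋ := by
        rw [hs, hs, hveq, ← hu] at hv1
        have := mul_right_cancel₀ hu0 (add_left_cancel hv1)
        exact_mod_cast this
      have hff : Int.fract s = Int.fract t := by
        rw [hTT] at hab; exact mul_right_cancel₀ (hT _).ne' hab
      refine ⟨m, ?_⟩
      rw [← es, ← et, ← hff, hm]; push_cast; ring

include hN
lemma cyc_pg : ∃ φ, IsPg N v φ := by
  have hn := cyc_norm hT hsm
  have hu0 : ∀ k, u k ≠ 0 := by intro k h0; have := hn k; rw [h0] at this; simp at this
  have hT0 : ∀ k, (T k : ℂ) ≠ 0 := by intro k; exact_mod_cast (hT k).ne'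
  have hq : ∀ k, v (k + 1) - v k = T k * u k := by intro k; rw [hs]; ring
  obtain ⟨φ, -, h1, h2⟩ := mk_phi (fun k => v (k + 1) - v k)
    (fun k => by rw [hq]; exact mul_ne_zero (hT0 k) (hu0 k)) _ (isArg_arg _)
  have hper : ∀ i, v (i + N) = v i := fun i => ((hvi i (i + N)).2 ⟨1, by ring⟩).symm
  refine ⟨φ, hN, hper, cyc_inj hv hT hs hsm hvi, h1, ?_⟩
  intro k
  rw [h2, abs_lt]
  refine ⟨Complex.neg_pi_lt_arg _, lt_of_le_of_ne (Complex.arg_le_pi _) ?_⟩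
  intro hpi
  obtain ⟨hre, him⟩ := Complex.arg_eq_pi_iff.1 hpi
  set q : ℂ := (v (k + 1 + 1) - v (k + 1)) / (v (k + 1) - v k) with hqd
  have hqr : q = (q.re : ℂ) := by apply Complex.ext <;> simp [him]
  have e1 : T (k + 1) * u (k + 1) = q * (T k * u k) := by
    rw [hqd, hq, hq, div_mul_cancel₀ _ (mul_ne_zero (hT0 k) (hu0 k))]
  have e2 : u (k + 1) = - u k := by
    have h3 := congrArg norm e1
    rw [norm_mul, norm_mul, norm_mul, hn, hn, hqr, Complex.norm_of_nonneg (hT _).le,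
      Complex.norm_of_nonneg (hT _).le, Complex.norm_real, Real.norm_eq_abs,
      abs_of_neg hre] at h3
    have h4 : (T (k + 1) : ℂ) = - q * T k := by
      rw [hqr]; have : T (k + 1) = - q.re * T k := by linarith
      rw [this]; push_cast; ring
    apply mul_left_cancel₀ (hT0 (k + 1))
    rw [e1, h4]; ring
  obtain ⟨r, hr0, hr1, hr2⟩ : ∃ r : ℝ, 0 < r ∧ r < T k ∧ r < T (k + 1) := by
    have := lt_min (hT k) (hT (k + 1))
    refine ⟨min (T k) (T (k + 1)) / 2, by linarith, ?_, ?_⟩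
    · linarith [min_le_left (T k) (T (k + 1))]
    · linarith [min_le_right (T k) (T (k + 1))]
  have a1 := hsm k (T k - r) ⟨by linarith, by linarith⟩
  have a2 := hsm (k + 1) r ⟨by linarith, by linarith⟩
  rw [e2] at a2
  refine a1.ne_neg ?_
  convert a2 using 1
  rw [hs]; push_cast; ring

end cyc

end MS

namespace MS

lemma slit_seg {a b z : ℂ} (h : ∀ τ : ℝ, 0 ≤ τ → τ ≤ 1 → a + τ * (b - a) ≠ z) :
    (b - z) / (a - z) ∈ Complex.slitPlane := by
  have ha : a - z ≠ 0 := by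
    intro h0; exact h 0 le_rfl zero_le_one (by simp [sub_eq_zero.1 h0])
  by_contra hc
  rw [Complex.mem_slitPlane_iff, not_or, not_lt, not_not] at hc
  obtain ⟨h1, h2⟩ := hc
  set q := (b - z) / (a - z) with hq
  have hqr : q = (q.re : ℂ) := by apply Complex.ext <;> simp [h2]
  have e1 : b - z = q * (a - z) := by rw [hq, div_mul_cancel₀ _ ha]
  have hpos : 0 < 1 - q.re := by linarith
  refine h (1 / (1 - q.re)) (by positivity) (by rw [div_le_one hpos]; linarith) ?_
  have hne : (1 : ℂ) - q.re ≠ 0 := by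
    have : ((1 - q.re : ℝ) : ℂ) ≠ 0 := by exact_mod_cast hpos.ne'
    simpa using this
  rw [hqr] at e1
  push_cast
  field_simp
  linear_combination e1

/-- winding sum -/
def wnd (v : ℤ → ℂ) (N : ℤ) (z : ℂ) : ℝ :=
  ∑ k ∈ Finset.range N.toNat, Complex.arg ((v (k + 1) - z) / (v k - z))

section wind
variable {N : ℤ} {v : ℤ → ℂ} (hN : 0 < N) (hper : ∀ i, v (i + N) = v i)

lemma wnd_slit {z : ℂ} (k : ℤ) (hz : ∀ t : ℝ, k ≤ t → t ≤ k + 1 → gam v t ≠ z) :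
    (v (k + 1) - z) / (v k - z) ∈ Complex.slitPlane := by
  apply slit_seg
  intro τ h1 h2
  have := hz (k + τ) (by linarith) (by linarith)
  rw [gam_edge v (k := k) (by linarith) (by linarith)] at this
  simpa using this

lemma wnd_term_cont {z : ℂ} (k : ℤ) (hz : ∀ t : ℝ, k ≤ t → t ≤ k + 1 → gam v t ≠ z) :
    ContinuousAt (fun z => Complex.arg ((v (k + 1) - z) / (v k - z))) z := by
  refine ContinuousAt.comp (f := fun z => ((v (k + 1) - z) / (v k - z))) (g := Complex.arg)
    (Complex.continuousAt_arg (wnd_slit k hz)) ?_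
  refine ContinuousAt.div (Continuous.continuousAt (by fun_prop))
    (Continuous.continuousAt (by fun_prop)) ?_
  intro h0
  exact hz k le_rfl (by linarith) (by rw [gam_int]; exact sub_eq_zero.1 h0)

lemma wnd_cont {z : ℂ} (hz : z ∉ range (gam v)) : ContinuousAt (wnd v N) z := by
  unfold wnd
  refine tendsto_finsetSum _ (fun k _ => ?_)
  exact wnd_term_cont (k : ℤ) (fun t _ _ h => hz ⟨t, h⟩)

include hN hper

lemma wnd_int {z : ℂ} (hz : z ∉ range (gam v)) : ∃ m : ℤ, wnd v N z = 2 * π * m := by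
  have hne : ∀ k : ℤ, v k - z ≠ 0 := by
    intro k h0; exact hz ⟨k, by rw [gam_int]; exact sub_eq_zero.1 h0⟩
  have h1 : ∀ n : ℕ, IsArg ((v n - z) / (v 0 - z))
      (∑ k ∈ Finset.range n, Complex.arg ((v (k + 1) - z) / (v k - z))) := by
    intro n
    induction n with
    | zero =>
      simp only [Nat.cast_zero, div_self (hne 0), Finset.range_zero, Finset.sum_empty]
      simp [IsArg, e_zero]
    | succ n ih =>
      rw [Finset.sum_range_succ]
      have := ih.mul (isArg_arg ((v (n + 1) - z) / (v n - z)))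
      convert this using 1
      have a1 := hne n
      have a2 := hne 0
      push_cast
      field_simp
  have h2 := h1 N.toNat
  have h3 : ((N.toNat : ℕ) : ℤ) = 0 + N := by omega
  rw [h3, hper, div_self (hne 0)] at h2
  have h4 : IsArg (1 : ℂ) 0 := by simp [IsArg, e_zero]
  obtain ⟨m, hm⟩ := h2.unique one_ne_zero h4
  exact ⟨m, by rw [wnd, hm]; ring⟩

lemma wnd_free {z : ℂ} (hz : z ∉ range (gam v)) {δ : ℝ}
    (hδ : ∀ r : ℝ, 0 < r → z + r * e δ ∉ range (gam v)) : wnd v N z = 0 := by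
  have hpi := pi_pos
  have hne : ∀ t : ℝ, gam v t - z ≠ 0 := by
    intro k h0; exact hz ⟨k, sub_eq_zero.1 h0⟩
  have hc : Continuous fun t => gam v t - z := (continuous_gam v).sub continuous_const
  obtain ⟨f, hf, ha⟩ := exists_lift (S := (univ : Set ℝ)) isOpen_univ convex_univ univ_nonempty
    hc.continuousOn (fun t _ => hne t)
  obtain ⟨m, hm⟩ := lift_window (δ := δ) isPreconnected_univ hf (by
    intro t _ h0
    refine hδ ‖gam v t - z‖ (norm_pos_iff.2 (hne t)) ⟨t, ?_⟩
    have := ha t (mem_univ _)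
    unfold IsArg at this
    rw [← h0, ← this]; ring)
  have e0 : f N = f 0 := by
    have a1 := ha N (mem_univ _)
    have a0 := ha 0 (mem_univ _)
    have : gam v N = gam v 0 := by have := gam_per hper 0; rwa [zero_add] at this
    rw [this] at a1
    obtain ⟨j, hj⟩ := a1.unique (hne 0) a0
    have b1 := hm N (mem_univ _)
    have b0 := hm 0 (mem_univ _)
    have c1 : (j : ℝ) < 1 := by
      by_contra hcon; push Not at hcon; nlinarith [b1.2, b0.1]
    have c2 : (-1 : ℝ) < j := by
      by_contra hcon; push Not at hcon; nlinarith [b1.1, b0.2]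
    have : j = 0 := by
      have d1 : j < 1 := by exact_mod_cast c1
      have d2 : -1 < j := by exact_mod_cast c2
      omega
    rw [hj, this]; simp
  have step : ∀ k : ℤ, Complex.arg ((v (k + 1) - z) / (v k - z)) = f (k + 1) - f k := by
    intro k
    have := lift_eq_arg (S := Icc (k : ℝ) (k + 1)) isPreconnected_Icc hc.continuousOn
      (hf.mono (subset_univ _)) (fun x _ => ha x (mem_univ _)) (c := v k - z) (by
        intro t ht
        rw [gam_edge v ht.1 ht.2]
        have h0 := wnd_slit (v := v) (z := z) k (fun t _ _ h => hz ⟨t, h⟩)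
        have h1 := slit_comb h0 (a := 1 - (t - k)) (b := t - k) (by linarith [ht.2])
          (by linarith [ht.1]) (by linarith)
        convert h1 using 1
        have h2 := hne k
        rw [gam_int] at h2
        push_cast
        field_simp
        ring) (x := (k : ℝ)) (y := (k : ℝ) + 1) ⟨le_rfl, by linarith⟩ ⟨by linarith, le_rfl⟩
    have h2 := hne k
    have h3 : gam v ((k : ℝ) + 1) = v (k + 1) := by
      have := gam_int v (k + 1); push_cast at this; exact this
    rw [gam_int] at h2
    simp only [gam_int, h3, div_self h2, Complex.arg_one] at this
    linarith
  have h5 : wnd v N z = ∑ k ∈ Finset.range N.toNat, (f ((k + 1 : ℕ) : ℝ) - f ((k : ℕ) : ℝ)) := by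
    rw [wnd]
    refine Finset.sum_congr rfl (fun k _ => ?_)
    rw [step]; push_cast; rfl
  rw [h5, Finset.sum_range_sub (fun k : ℕ => f (k : ℝ))]
  have h3 : ((N.toNat : ℕ) : ℝ) = N := by
    have : ((N.toNat : ℕ) : ℤ) = N := by omega
    exact_mod_cast this
  rw [h3, e0]; simp

end wind

lemma arg_big {a b : ℝ} (ha : a < 0) (hb : 0 < b) :
    π / 2 < Complex.arg ((a : ℂ) + (b : ℂ) * Complex.I) := by
  have b1 := (Complex.abs_arg_le_pi_div_two_iff (z := (a : ℂ) + (b : ℂ) * Complex.I)).not.2 (by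
    simpa using ha)
  have b2 := Complex.arg_nonneg_iff (z := (a : ℂ) + (b : ℂ) * Complex.I) |>.2 (by
    simpa using hb.le)
  rw [abs_of_nonneg b2] at b1
  linarith

lemma arg_small {a b : ℝ} (ha : a < 0) (hb : b < 0) :
    Complex.arg ((a : ℂ) + (b : ℂ) * Complex.I) < - (π / 2) := by
  have b1 := (Complex.abs_arg_le_pi_div_two_iff (z := (a : ℂ) + (b : ℂ) * Complex.I)).not.2 (by
    simpa using ha)
  have b2 := Complex.arg_neg_iff (z := (a : ℂ) + (b : ℂ) * Complex.I) |>.2 (by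
    simpa using hb)
  rw [abs_of_neg b2] at b1
  linarith

/-- jump of the winding sum across an edge -/
lemma wnd_jump {N : ℤ} {v : ℤ → ℂ} {φ : ℤ → ℝ} (h : IsPg N v φ) {ρ : ℝ} (hρ : 0 < ρ)
    (hl : ∀ r ∈ Ioo 0 ρ, wnd v N (gam v (1/2) + (r : ℝ) * (Complex.I * e (φ 0))) = 0)
    (hr : ∀ r ∈ Ioo 0 ρ, wnd v N (gam v (1/2) - (r : ℝ) * (Complex.I * e (φ 0))) = 0) :
    False := by
  have hpi := pi_pos
  have hN := h.three_le
  set m := gam v (1/2) with hm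
  set L := ‖v (0 + 1) - v 0‖ with hL
  have hLp : 0 < L := h.edge_pos 0
  have em : m = v 0 + ((1/2 : ℝ) : ℂ) * (v (0 + 1) - v 0) := by
    rw [hm, gam_edge v (k := 0) (by norm_num) (by norm_num)]; simp
  have ev := h.edge_eq 0
  rw [← hL] at ev
  set u := e (φ 0) with hu
  have hu0 : u ≠ 0 := e_ne _
  obtain ⟨n, hn⟩ : ∃ n, N.toNat = n + 1 := ⟨N.toNat - 1, by omega⟩
  -- the other terms
  have ho : ContinuousAt (fun z => ∑ k ∈ Finset.range n,
      Complex.arg ((v ((k + 1 : ℕ) + 1) - z) / (v (k + 1 : ℕ) - z))) m := by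
    refine tendsto_finsetSum _ (fun k hk => ?_)
    refine wnd_term_cont ((k + 1 : ℕ) : ℤ) (fun t h1 h2 h3 => ?_)
    rw [Finset.mem_range] at hk
    have hk' : ((k : ℝ)) + 2 ≤ N := by
      have : (k : ℤ) + 2 ≤ N := by omega
      exact_mod_cast this
    obtain ⟨j, hj⟩ := h.inj _ _ h3.symm
    push_cast at h1 h2
    have hNr := h.nreal
    have c1 : (0 : ℝ) < j := by
      by_contra hcon; push Not at hcon
      have : (j : ℝ) * N ≤ 0 := by nlinarith
      have : (0 : ℝ) ≤ k := by positivity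
      linarith
    have c2 : (j : ℝ) < 1 := by
      by_contra hcon; push Not at hcon
      nlinarith
    have d1 : 0 < j := by exact_mod_cast c1
    have d2 : j < 1 := by exact_mod_cast c2
    omega
  obtain ⟨η, hη, hh⟩ := Metric.continuousAt_iff.1 ho (π / 2) (by positivity)
  obtain ⟨r, hr0, hr1, hr2, hr3⟩ : ∃ r : ℝ, 0 < r ∧ r < ρ ∧ r < η ∧ r < L / 2 := by
    have : 0 < min ρ (min η (L / 2)) := by positivity
    refine ⟨min ρ (min η (L / 2)) / 2, by linarith, ?_, ?_, ?_⟩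
    · linarith [min_le_left ρ (min η (L / 2))]
    · linarith [min_le_right ρ (min η (L / 2)), min_le_left η (L / 2)]
    · linarith [min_le_right ρ (min η (L / 2)), min_le_right η (L / 2)]
  have hnorm : ‖(r : ℂ) * (Complex.I * u)‖ = r := by
    rw [norm_mul, norm_mul, Complex.norm_I, hu, norm_e, Complex.norm_of_nonneg hr0.le]; ring
  have h1 := hh (x := m + r * (Complex.I * u)) (by rw [dist_eq_norm, add_sub_cancel_left, hnorm]; exact hr2)
  have h2 := hh (x := m - r * (Complex.I * u)) (by rw [dist_eq_norm, sub_sub_cancel_left, norm_neg, hnorm]; exact hr2)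
  have w1 := hl r ⟨hr0, hr1⟩
  have w2 := hr r ⟨hr0, hr1⟩
  rw [wnd, hn, Finset.sum_range_succ'] at w1 w2
  rw [Real.dist_eq, abs_lt] at h1 h2
  -- edge term
  have T : ∀ s : ℝ, |s| < L / 2 → s ≠ 0 →
      (v ((0 : ℕ) + 1) - (m + s * (Complex.I * u))) / (v (0 : ℕ) - (m + s * (Complex.I * u))) =
      (((s^2 - (L/2)^2) / ((L/2)^2 + s^2) : ℝ) : ℂ) + ((L * s / ((L/2)^2 + s^2) : ℝ) : ℂ) * Complex.I := by
    intro s hs hs0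
    have ev' : v (0 + 1) = v 0 + L * u := by rw [← ev]; ring
    have hpos : 0 < (L/2)^2 + s^2 := by positivity
    have hpc : ((L : ℂ)/2)^2 + s^2 ≠ 0 := by
      have : (((L/2)^2 + s^2 : ℝ) : ℂ) ≠ 0 := by exact_mod_cast hpos.ne'
      push_cast at this; exact this
    have hden : v 0 - (m + s * (Complex.I * u)) ≠ 0 := by
      have : v 0 - (m + s * (Complex.I * u)) = -((L / 2 : ℝ) + s * Complex.I) * u := by
        rw [em, ev]; push_cast; ring
      rw [this]
      refine mul_ne_zero (neg_ne_zero.2 ?_) hu0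
      intro h0
      have := congrArg Complex.re h0
      simp at this
      linarith
    rw [div_eq_iff (by simpa using hden)]
    simp only [Nat.cast_zero]
    rw [em, ev, ev']
    push_cast
    rw [div_mul_eq_mul_div ((L : ℂ) * s), ← add_div, div_mul_eq_mul_div (_ + _), eq_div_iff hpc]
    ring_nf
    simp only [Complex.I_sq, show Complex.I^3 = -Complex.I by rw [pow_succ, Complex.I_sq]; ring]
    ring
  have t1 := arg_big (a := (r^2 - (L/2)^2) / ((L/2)^2 + r^2)) (b := L * r / ((L/2)^2 + r^2))
    (div_neg_of_neg_of_pos (by nlinarith) (by positivity)) (by positivity)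
  have t2 := arg_small (a := ((-r)^2 - (L/2)^2) / ((L/2)^2 + (-r)^2))
    (b := L * (-r) / ((L/2)^2 + (-r)^2))
    (div_neg_of_neg_of_pos (by nlinarith) (by positivity))
    (div_neg_of_neg_of_pos (by nlinarith) (by positivity))
  rw [← T r (by rwa [abs_of_pos hr0]) hr0.ne'] at t1
  rw [← T (-r) (by rwa [abs_neg, abs_of_pos hr0]) (by linarith)] at t2
  have e1 : m + ((-r : ℝ) : ℂ) * (Complex.I * u) = m - r * (Complex.I * u) := by push_cast; ring
  rw [e1] at t2
  linarith [h1.1, h1.2, h2.1, h2.2]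

end MS

namespace MS

lemma e_half_pi (a : ℝ) : e (a + π / 2) = Complex.I * e a := by
  apply Complex.ext
  · simp [e_re, e_im, cos_add_pi_div_two]
  · simp [e_re, e_im, sin_add_pi_div_two]

lemma Sm.left {X : Set ℂ} {p u : ℂ} (h : Sm X p u) : ∃ ρ > 0, ∀ r ∈ Ioo 0 ρ,
    p + (r : ℝ) * (Complex.I * u) ∈ interior X ∧ p - (r : ℝ) * (Complex.I * u) ∉ X := by
  obtain ⟨hu, ε, hε, H⟩ := h
  refine ⟨ε, hε, fun r hr => ?_⟩
  have hn : ‖(r : ℂ) * (Complex.I * u)‖ = r := by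
    rw [norm_mul, norm_mul, Complex.norm_I, hu, Complex.norm_of_nonneg hr.1.le]; ring
  have h1 := (H (r * (Complex.I * u)) (by rw [hn]; exact hr.2)).1 (by
    rw [cr_smul_right, cr_I u hu]; linarith [hr.1])
  have h2 := (H (-(r * (Complex.I * u))) (by rw [norm_neg, hn]; exact hr.2)).2 (by
    rw [cr_neg_right, cr_smul_right, cr_I u hu]; linarith [hr.1])
  exact ⟨h1, by rwa [← sub_eq_add_neg] at h2⟩

namespace IsNice

variable {X : Set ℂ} {ℓ : ℝ} {E : Set ℂ} (h : IsNice X ℓ E)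
include h

lemma arc_bd {y : ℂ} (hy : y ∈ frontier X) : ∃ a, FreeArc X y a ℓ := by
  have h1 : y ∈ closure Xᶜ := by
    rw [frontier_eq_closure_inter_closure] at hy; exact hy.2
  obtain ⟨z, hz, hzy⟩ := mem_closure_iff_seq_limit.1 h1
  obtain ⟨a, ha, -⟩ := limit_arc (h.reg.le) hzy (fun n => h.arc (z n) (hz n))
  exact ⟨a, ha⟩

theorem exists_reg : ∃ (N : ℤ) (v : ℤ → ℂ) (φ : ℤ → ℝ), IsReg X N v φ ∧
    ∀ k, φ (k + N) = φ k + 2 * π := by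
  have hpi := pi_pos
  obtain ⟨N, v, T, u, hN, hv, hT, hs, hsm, hvi⟩ := h.exists_cycle
  obtain ⟨φ, hp⟩ := cyc_pg hN hv hT hs hsm hvi
  have hNr := hp.nreal
  have hsub : range (gam v) ⊆ frontier X := by
    rintro _ ⟨t, rfl⟩
    rcases eq_or_lt_of_le (Int.fract_nonneg t) with h1 | h1
    · rw [gam, ← h1]; simpa using (hv ⌊t⌋).1
    · exact (cyc_gam hT hs hsm h1).fr
  have hcl : IsClosed X := h.comp.isClosed
  have hfr : frontier X = X \ interior X := hcl.frontier_eq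
  -- smoothness at the midpoint of edge zero
  have hfl : ⌊(1 / 2 : ℝ)⌋ = 0 := by rw [Int.floor_eq_iff]; norm_num
  have hmid : Sm X (gam v (1 / 2)) (e (φ 0)) := by
    have h1 : (0 : ℝ) < Int.fract (1 / 2 : ℝ) := by rw [Int.fract, hfl]; norm_num
    have h2 := cyc_gam hT hs hsm h1
    rw [hfl] at h2
    convert h2 using 1
    have h3 : v (0 + 1) - v 0 = T 0 * u 0 := by rw [hs]; ring
    have h4 := hp.edge_eq 0
    rw [h3, norm_mul, h2.1, Complex.norm_of_nonneg (hT 0).le, mul_one] at h4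
    exact (mul_left_cancel₀ (by exact_mod_cast (hT 0).ne') h4).symm
  obtain ⟨ρ, hρ, hlr⟩ := hmid.left
  have hrange : frontier X = range (gam v) := by
    refine Subset.antisymm ?_ hsub
    intro y hy
    by_contra hyC
    have hfree : ∀ z, z ∉ range (gam v) → (∃ a, FreeArc X z a ℓ) → wnd v N z = 0 := by
      rintro z hz ⟨a, ha⟩
      refine wnd_free hN hp.per hz (δ := a + ℓ / 2) (fun r hr hmem => ?_)
      have := h.hl
      refine ha (a + ℓ / 2) ⟨by linarith, by linarith⟩ r hr ?_
      have := hsub hmem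
      rw [hfr] at this; exact this.1
    have hout : ∀ z, z ∉ X → wnd v N z = 0 := by
      intro z hz
      refine hfree z (fun hm => ?_) (h.arc z hz)
      have := hsub hm
      rw [hfr] at this; exact hz this.1
    have hintr : ∀ z ∈ interior X, z ∉ range (gam v) := by
      intro z hz hm
      have := hsub hm
      rw [hfr] at this; exact this.2 hz
    have hy0 : wnd v N y = 0 := hfree y hyC (h.arc_bd hy)
    have hyc : y ∈ closure (interior X) := by rw [← h.reg]; rw [hfr] at hy; exact hy.1
    obtain ⟨η, hη, hh⟩ := Metric.continuousAt_iff.1 (wnd_cont (N := N) hyC) (2 * π) (by positivity)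
    obtain ⟨z0, hz0, hd⟩ := Metric.mem_closure_iff.1 hyc η hη
    have hw0 : wnd v N z0 = 0 := by
      have h1 := hh (x := z0) (by rw [dist_comm]; exact hd)
      rw [hy0, Real.dist_eq, sub_zero] at h1
      obtain ⟨m, hm⟩ := wnd_int hN hp.per (hintr z0 hz0)
      rw [hm, abs_lt] at h1
      have c1 : (m : ℝ) < 1 := by nlinarith
      have c2 : (-1 : ℝ) < m := by nlinarith
      have d1 : m < 1 := by exact_mod_cast c1
      have d2 : -1 < m := by exact_mod_cast c2
      have : m = 0 := by omega
      rw [hm, this]; simp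
    have hin : ∀ z ∈ interior X, wnd v N z = 0 := by
      intro z hz
      have hc : ContinuousOn (wnd v N) (interior X) := fun z hz =>
        (wnd_cont (hintr z hz)).continuousWithinAt
      have := two_lifts h.conn hc (continuousOn_const (c := (0 : ℝ))) (c := 1) (by
        intro x hx
        obtain ⟨m, hm⟩ := wnd_int hN hp.per (hintr x hx)
        rw [hm, e_zero, e_int]; norm_num) hz hz0
      linarith
    exact wnd_jump hp hρ (fun r hr => hin _ (hlr r hr).1) (fun r hr => hout _ (hlr r hr).2)
  have hreg : IsReg X N v φ := ⟨hp, h.comp, h.reg, hrange⟩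
  obtain ⟨Θ, c, hTh⟩ := exists_theta hp
  refine ⟨N, v, φ, hreg, fun k => ?_⟩
  rw [hTh.phi_per hp]
  rcases hreg.orient hTh with ⟨hc, -, -⟩ | ⟨-, -, hc⟩
  · rw [hc]
  · exfalso
    obtain ⟨ρ', hρ', H⟩ := hc (1 / 2)
    rw [phP_of (k := 0) (by norm_num) (by norm_num), phM_of (k := 0) (by norm_num) (by norm_num)] at H
    obtain ⟨r, hr0, hr1, hr2⟩ : ∃ r : ℝ, 0 < r ∧ r < ρ ∧ r < ρ' := by
      have := lt_min hρ hρ'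
      exact ⟨min ρ ρ' / 2, by linarith, by linarith [min_le_left ρ ρ'], by linarith [min_le_right ρ ρ']⟩
    have h1 := H (φ 0 + π / 2) ⟨by linarith, by linarith⟩ r ⟨hr0, hr2⟩
    rw [e_half_pi] at h1
    exact h1 (interior_subset (hlr r ⟨hr0, hr1⟩).1)

end IsNice

end MS

namespace MS

lemma fin_range_per {β : Type*} {f : ℤ → β} {N : ℤ} (hN : 0 < N) (hf : ∀ i, f (i + N) = f i) :
    (range f).Finite := by
  refine ((finite_Ico (0 : ℤ) N).image f).subset ?_
  rintro _ ⟨i, rfl⟩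
  refine ⟨i % N, ⟨Int.emod_nonneg _ hN.ne', Int.emod_lt_of_pos _ hN⟩, ?_⟩
  rw [← per_mul hf (i % N) (i / N)]
  congr 1
  rw [mul_comm]; exact Int.emod_add_mul_ediv i N

lemma cr_zero {d w : ℂ} (hd : d ≠ 0) (h : cr d w = 0) : ∃ s : ℝ, w = s * d := by
  have hn : Complex.normSq d ≠ 0 := Complex.normSq_eq_zero.not.2 hd
  have hn' := hn
  rw [Complex.normSq_apply] at hn
  refine ⟨(d.re * w.re + d.im * w.im) / (d.re * d.re + d.im * d.im), ?_⟩
  rw [cr] at h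
  apply Complex.ext
  · rw [Complex.re_ofReal_mul, div_mul_eq_mul_div, eq_div_iff hn]
    linear_combination (-d.im) * h
  · rw [Complex.im_ofReal_mul, div_mul_eq_mul_div, eq_div_iff hn]
    linear_combination (d.re) * h

lemma lines_dir {F P D : Set ℂ} (hP : P.Finite) (hD : D.Finite) (hD0 : ∀ d ∈ D, d ≠ 0)
    (hF : ∀ x ∈ F, ∃ p ∈ P, ∃ d ∈ D, ∃ s : ℝ, x = p + s * d) :
    ∃ E : Set ℂ, E.Finite ∧ ∀ x : ℂ, ∃ ε > 0, ∀ w : ℂ, w ≠ 0 → ‖w‖ < ε → x + w ∈ F →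
      w / ‖w‖ ∈ E := by
  refine ⟨(fun d : ℂ => d / ‖d‖) '' D ∪ (fun d : ℂ => -d / ‖d‖) '' D,
    (hD.image _).union (hD.image _), fun x => ?_⟩
  have key : ∀ p : ℂ, ∀ d ∈ D, ∀ᶠ w : ℂ in nhds 0, w ≠ 0 → (∃ s : ℝ, x + w = p + s * d) →
      w / ‖w‖ ∈ (fun d : ℂ => d / ‖d‖) '' D ∪ (fun d : ℂ => -d / ‖d‖) '' D := by
    intro p d hd
    have hd0 := hD0 d hd
    by_cases hx : cr d (x - p) = 0
    · refine Filter.Eventually.of_forall ?_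
      rintro w hw ⟨s, hs⟩
      have h1 : cr d w = 0 := by
        have : w = s * d - (x - p) := by linear_combination hs
        rw [this, cr_sub_right, hx, cr_smul_right, cr_self]; simp
      obtain ⟨s, rfl⟩ := cr_zero hd0 h1
      have hs0 : s ≠ 0 := by rintro rfl; simp at hw
      have hn : (‖d‖ : ℂ) ≠ 0 := by exact_mod_cast norm_ne_zero_iff.2 hd0
      have hs' : (s : ℂ) ≠ 0 := by exact_mod_cast hs0
      rcases lt_or_gt_of_ne hs0 with h2 | h2
      · right
        refine ⟨d, hd, ?_⟩
        simp only [norm_mul, Complex.norm_real, Real.norm_eq_abs, abs_of_neg h2]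
        push_cast; field_simp
      · left
        refine ⟨d, hd, ?_⟩
        simp only [norm_mul, Complex.norm_real, Real.norm_eq_abs, abs_of_pos h2]
        push_cast; field_simp
    · have hc : ContinuousAt (fun w : ℂ => cr d (x + w - p)) 0 := by
        unfold cr; fun_prop
      have := hc.eventually_ne (y := 0) (by simpa using hx)
      filter_upwards [this] with w hw _ hs
      obtain ⟨s, hs⟩ := hs
      exfalso
      apply hw
      rw [hs, show p + s * d - p = s * d by ring, cr_smul_right, cr_self]; simp
  have := (Filter.eventually_all_finite (l := nhds (0 : ℂ)) (hP.prod hD)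
    (p := fun q w => w ≠ 0 → (∃ s : ℝ, x + w = q.1 + s * q.2) →
      w / ‖w‖ ∈ (fun d : ℂ => d / ‖d‖) '' D ∪ (fun d : ℂ => -d / ‖d‖) '' D)).2
    (fun q hq => key q.1 q.2 hq.2)
  obtain ⟨ε, hε, hh⟩ := Metric.eventually_nhds_iff.1 this
  refine ⟨ε, hε, fun w hw0 hw hx => ?_⟩
  obtain ⟨p, hp, d, hd, s, hs⟩ := hF _ hx
  exact hh (y := w) (by simpa using hw) (p, d) ⟨hp, hd⟩ hw0 ⟨s, hs⟩

section add
variable {K L : Set ℂ} {N M : ℤ} {v w : ℤ → ℂ} {φ χ : ℤ → ℝ} {α : ℝ}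
  (hα : α < π) (hK : IsGd K N v φ α) (hL : IsGd L M w χ α)
include hK hL

lemma closed_add : IsClosed (K + L) := (hK.comp.add hL.comp).isClosed

lemma not_transversal {s t : ℝ} (hx : gam v s + gam w t ∈ frontier (K + L))
    (hs : 0 < Int.fract s) (ht : 0 < Int.fract t) :
    cr (v (⌊s⌋ + 1) - v ⌊s⌋) (w (⌊t⌋ + 1) - w ⌊t⌋) = 0 := by
  by_contra hne
  obtain ⟨-, -, -, -, -, H⟩ := frontier_add hK.comp.isClosed hL.comp.isClosed
    (closed_add hK hL) hx
  have hs1 : (⌊s⌋ : ℝ) < s := by have := Int.floor_add_fract s; linarith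
  have ht1 : (⌊t⌋ : ℝ) < t := by have := Int.floor_add_fract t; linarith
  have hs2 := Int.lt_floor_add_one s
  have ht2 := Int.lt_floor_add_one t
  obtain ⟨σ, hσ1, hσ⟩ : ∃ σ : ℝ, |σ| = 1 ∧ 0 < cr (v (⌊s⌋ + 1) - v ⌊s⌋)
      (σ * (w (⌊t⌋ + 1) - w ⌊t⌋)) := by
    rcases lt_or_gt_of_ne hne with h1 | h1
    · exact ⟨-1, by simp, by rw [cr_smul_right]; linarith⟩
    · exact ⟨1, by simp, by rw [cr_smul_right]; linarith⟩
  set F : ℂ := σ * (w (⌊t⌋ + 1) - w ⌊t⌋) with hF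
  have hF0 : F ≠ 0 := by
    intro h0; rw [h0] at hσ; simp [cr] at hσ
  have hFn := norm_pos_iff.2 hF0
  obtain ⟨θ, hθ, ha⟩ := exists_arg_Ico F (φ ⌊s⌋)
  rw [(hK.pg.arg ⌊s⌋).cr_eq ha] at hσ
  have hsin : 0 < sin (θ - φ ⌊s⌋) := by
    have := hK.pg.edge_pos ⌊s⌋
    by_contra hc; push Not at hc
    have h2 : 0 < ‖v (⌊s⌋ + 1) - v ⌊s⌋‖ * ‖F‖ := by positivity
    nlinarith
  have hθ1 : φ ⌊s⌋ < θ := by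
    rcases eq_or_lt_of_le hθ.1 with h1 | h1
    · rw [← h1] at hsin; simp at hsin
    · exact h1
  have hθ2 : θ < φ ⌊s⌋ + π := by
    by_contra hc; push Not at hc
    have : 0 ≤ sin (θ - φ ⌊s⌋ - π) := sin_nonneg_of_nonneg_of_le_pi (by linarith) (by linarith [hθ.2])
    rw [sin_sub_pi] at this
    linarith
  obtain ⟨ρ, hρ, hg⟩ := hK.lg.1 s
  rw [phP, phM_of hs1 hs2.le] at hg
  obtain ⟨τ, hτ0, hτ1, hτ2, hτ3⟩ : ∃ τ : ℝ, 0 < τ ∧ τ * ‖F‖ < ρ ∧ τ ≤ t - ⌊t⌋ ∧ τ ≤ ⌊t⌋ + 1 - t := by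
    refine ⟨min (ρ / (2 * ‖F‖)) (min (t - ⌊t⌋) (⌊t⌋ + 1 - t)), ?_, ?_, ?_, ?_⟩
    · refine lt_min (by positivity) (lt_min (by linarith) (by linarith))
    · have := min_le_left (ρ / (2 * ‖F‖)) (min (t - ⌊t⌋) (⌊t⌋ + 1 - t))
      have h3 : ρ / (2 * ‖F‖) * ‖F‖ = ρ / 2 := by field_simp
      nlinarith
    · exact (min_le_right _ _).trans (min_le_left _ _)
    · exact (min_le_right _ _).trans (min_le_right _ _)
  have h1 := hg θ ⟨hθ1, hθ2⟩ (τ * ‖F‖) ⟨by positivity, hτ1⟩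
  have ab := abs_le.1 hσ1.le
  have h2 : gam w (t - τ * σ) = gam w t - τ * F := by
    rw [gam_edge w (k := ⌊t⌋) (t := t - τ * σ) (by nlinarith) (by nlinarith),
      gam_edge w (k := ⌊t⌋) (t := t) ht1.le ht2.le, hF]
    push_cast; ring
  have h3 : (τ : ℂ) * F = ((τ * ‖F‖ : ℝ) : ℂ) * e θ := by
    rw [Complex.ofReal_mul, mul_assoc]; congr 1
  have h4 := (H _ (interior_subset h1) _ (hL.gam_mem (t - τ * σ)) (by rw [h2, h3]; ring)).1
  rw [hK.comp.isClosed.frontier_eq] at h4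
  exact h4.2 h1

lemma frontier_lines {x : ℂ} (hx : x ∈ frontier (K + L)) : ∃ p ∈ range v + range w,
    ∃ d ∈ range (fun k => v (k + 1) - v k) ∪ range (fun k => w (k + 1) - w k), ∃ s : ℝ,
      x = p + s * d := by
  obtain ⟨k, hk, l, hl, hkl, H⟩ := frontier_add hK.comp.isClosed hL.comp.isClosed
    (closed_add hK hL) hx
  obtain ⟨h1, h2⟩ := H k hk l hl hkl
  rw [hK.fr] at h1
  rw [hL.fr] at h2
  obtain ⟨s, rfl⟩ := h1
  obtain ⟨t, rfl⟩ := h2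
  rw [← hkl] at hx ⊢
  refine ⟨v ⌊s⌋ + w ⌊t⌋, Set.add_mem_add ⟨_, rfl⟩ ⟨_, rfl⟩, ?_⟩
  rcases eq_or_lt_of_le (Int.fract_nonneg s) with h1 | h1
  · exact ⟨w (⌊t⌋ + 1) - w ⌊t⌋, Or.inr ⟨_, rfl⟩, Int.fract t, by
      rw [gam, gam, ← h1]; push_cast; ring⟩
  · refine ⟨v (⌊s⌋ + 1) - v ⌊s⌋, Or.inl ⟨_, rfl⟩, ?_⟩
    rcases eq_or_lt_of_le (Int.fract_nonneg t) with h2 | h2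
    · exact ⟨Int.fract s, by rw [gam, gam, ← h2]; push_cast; ring⟩
    · obtain ⟨c, hc⟩ := cr_zero (hK.pg.edge_ne ⌊s⌋) (not_transversal hK hL hx h1 h2)
      exact ⟨Int.fract s + Int.fract t * c, by rw [gam, gam, hc]; push_cast; ring⟩

include hα
theorem nice_add : ∃ E, IsNice (K + L) (π - α) E := by
  have hKo : interior K + L ⊆ interior (K + L) :=
    interior_maximal (Set.add_subset_add_right interior_subset) isOpen_interior.add_right
  have hKL : interior K + interior L ⊆ interior (K + L) :=
    (Set.add_subset_add_left interior_subset).trans hKo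
  have hd : K + L ⊆ closure (interior K + interior L) := by
    rintro _ ⟨k, hk, l, hl, rfl⟩
    refine map_mem_closure₂ continuous_add (hK.reg_sub hk) (hL.reg_sub hl) ?_
    intro a ha b hb
    exact Set.add_mem_add ha hb
  have hE : ∃ E : Set ℂ, E.Finite ∧ ∀ x : ℂ, ∃ ε > 0, ∀ w : ℂ, w ≠ 0 → ‖w‖ < ε →
      x + w ∈ frontier (K + L) → w / ‖w‖ ∈ E := by
    refine lines_dir (P := range v + range w)
      (D := range (fun k => v (k + 1) - v k) ∪ range (fun k => w (k + 1) - w k))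
      ((fin_range_per hK.pg.hN hK.pg.per).add (fin_range_per hL.pg.hN hL.pg.per))
      ((fin_range_per hK.pg.hN ?_).union (fin_range_per hL.pg.hN ?_)) ?_
      (fun x hx => frontier_lines hK hL hx)
    · intro i; rw [add_right_comm, hK.pg.per, hK.pg.per]
    · intro i; rw [add_right_comm, hL.pg.per, hL.pg.per]
    · rintro d (⟨k, rfl⟩ | ⟨k, rfl⟩)
      · exact hK.pg.edge_ne k
      · exact hL.pg.edge_ne k
  obtain ⟨E, hE1, hE2⟩ := hE
  refine ⟨E, hK.comp.add hL.comp, ?_, ?_, ⟨_, Set.add_mem_add (hK.gam_mem 0) (hL.gam_mem 0)⟩,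
    by linarith, by linarith [hK.alpha_nonneg], fun z hz => vis_add hα hK hL hz, hE1, hE2⟩
  · refine Subset.antisymm (hd.trans (closure_mono hKL)) ?_
    exact closure_minimal interior_subset (closed_add hK hL)
  · refine IsPreconnected.subset_closure (s := interior K + interior L) ?_ hKL
      (interior_subset.trans hd)
    rw [← Set.add_image_prod]
    exact (hK.preconn_int.prod hL.preconn_int).image _ continuous_add.continuousOn

end add

end MS

namespace MS

lemma exists_theta_pi {N : ℤ} {v : ℤ → ℂ} {φ : ℤ → ℝ} (h : IsPg N v φ)
    (hph : ∀ k, φ (k + N) = φ k + 2 * π) : ∃ Θ, IsTheta N v φ Θ π := by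
  obtain ⟨Θ, c, hT⟩ := exists_theta h
  have h1 := hT.phi_per h 0
  have h2 := hph 0
  have : c = π := by linarith
  exact ⟨Θ, this ▸ hT⟩

section th
variable {N : ℤ} {v : ℤ → ℂ} {φ : ℤ → ℝ} {Θ : ℝ × ℝ → ℝ} (h : IsPg N v φ)
  (hT : IsTheta N v φ Θ π)
include hT

lemma th_shift2 {s t : ℝ} (h1 : s < t) (h2 : t < s + N) : Θ (s + N, t + N) = Θ (s, t) + 2 * π := by
  have a1 := hT.shift s t h1 h2
  have a2 := hT.shift t (s + N) h2 (by linarith)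
  linarith

include h
lemma th_shift_mul (m : ℤ) {s t : ℝ} (h1 : s < t) (h2 : t < s + N) :
    Θ (s + m * N, t + m * N) = Θ (s, t) + 2 * π * m := by
  induction m using Int.induction_on with
  | zero => simp
  | succ n ih =>
    have := th_shift2 hT (s := s + n * N) (t := t + n * N) (by linarith) (by linarith)
    push_cast at ih ⊢
    rw [show s + (n + 1) * (N : ℝ) = s + n * N + N by ring,
      show t + (n + 1) * (N : ℝ) = t + n * N + N by ring, this, ih]
    ring
  | pred n ih =>
    push_cast at ih ⊢
    have := th_shift2 hT (s := s + (-n - 1) * N) (t := t + (-n - 1) * N) (by linarith) (by linarith)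
    rw [show s + (-n - 1) * (N : ℝ) + N = s + -n * N by ring,
      show t + (-n - 1) * (N : ℝ) + N = t + -n * N by ring, ih] at this
    linarith

lemma th_first {s t : ℝ} (h1 : s < t) (h2 : t ≤ ⌊s⌋ + 1) : Θ (s, t) = phP φ s := by
  rw [phP]
  exact hT.edge ⌊s⌋ s t (Int.floor_le s) h1 h2

lemma th_last (hph : ∀ k, φ (k + N) = φ k + 2 * π) {s t : ℝ} (h1 : ⌈s⌉ - 1 + N ≤ t)
    (h2 : t < s + N) : Θ (s, t) = phM φ s + π := by
  have hN := h.nreal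
  have hc := Int.ceil_lt_add_one s
  have hc2 := Int.le_ceil s
  have h3 : s < t := by linarith
  have a1 := hT.shift s t h3 h2
  have a2 := hT.edge (⌈s⌉ - 1 + N) t (s + N) (by push_cast; linarith) h2 (by push_cast; linarith)
  rw [phM]
  rw [hph] at a2
  linarith

lemma th_cont (s : ℝ) : ContinuousOn (fun t => Θ (s, t)) (Ioo s (s + N)) := by
  refine hT.cont.comp (f := fun t : ℝ => (s, t)) (by fun_prop) ?_
  intro t ht
  exact ⟨ht.1, ht.2⟩

lemma th_cut (s : ℝ) : s < ⌊s⌋ + 1 ∧ (⌊s⌋ : ℝ) + 1 ≤ ⌈s⌉ - 1 + N ∧ (⌈s⌉ : ℝ) - 1 + N < s + N := by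
  have hN := h.nreal
  have hc := Int.ceil_lt_add_one s
  have hc2 := Int.le_ceil s
  have := Int.lt_floor_add_one s
  have := Int.floor_le s
  refine ⟨?_, ?_, ?_⟩ <;> linarith

lemma th_ext (hph : ∀ k, φ (k + N) = φ k + 2 * π) (s : ℝ) :
    ∃ t1 ∈ Ioo s (s + N), ∃ t2 ∈ Ioo s (s + N), ∀ t ∈ Ioo s (s + N),
      Θ (s, t1) ≤ Θ (s, t) ∧ Θ (s, t) ≤ Θ (s, t2) := by
  obtain ⟨c1, c2, c3⟩ := th_cut h hT s
  have hsub : Icc ((⌊s⌋ : ℝ) + 1) (⌈s⌉ - 1 + N) ⊆ Ioo s (s + N) :=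
    fun t ht => ⟨by linarith [ht.1], by linarith [ht.2]⟩
  have hc := (th_cont h hT s).mono hsub
  obtain ⟨t1, ht1, hmin⟩ := isCompact_Icc.exists_isMinOn ⟨_, left_mem_Icc.2 c2⟩ hc
  obtain ⟨t2, ht2, hmax⟩ := isCompact_Icc.exists_isMaxOn ⟨_, left_mem_Icc.2 c2⟩ hc
  refine ⟨t1, hsub ht1, t2, hsub ht2, fun t ht => ?_⟩
  have key : ∀ t ∈ Icc ((⌊s⌋ : ℝ) + 1) (⌈s⌉ - 1 + N), Θ (s, t1) ≤ Θ (s, t) ∧ Θ (s, t) ≤ Θ (s, t2) :=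
    fun t ht => ⟨hmin ht, hmax ht⟩
  rcases le_or_gt t (⌊s⌋ + 1) with h1 | h1
  · have := key _ (left_mem_Icc.2 c2)
    rw [th_first h hT c1 le_rfl] at this
    rwa [th_first h hT ht.1 h1]
  · rcases le_or_gt t (⌈s⌉ - 1 + N) with h2 | h2
    · exact key t ⟨h1.le, h2⟩
    · have := key _ (right_mem_Icc.2 c2)
      rw [th_last h hT hph le_rfl c3] at this
      rwa [th_last h hT hph h2.le ht.2]

end th

lemma avoid_int {P Q δ lo : ℝ} (hPQ : P < Q) (hP : δ ≤ P) (hQ : Q ≤ δ + 2 * π) (h1 : lo < δ)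
    (h2 : δ < lo + π)
    (H : ∀ θ ∈ Ioo P Q, ∀ m : ℤ, θ ∉ Ioo (lo + 2 * π * m) (lo + π + 2 * π * m)) :
    lo + π ≤ P ∧ Q ≤ lo + 2 * π := by
  constructor
  · by_contra hc; push Not at hc
    obtain ⟨θ, h3, h4⟩ := exists_between (lt_min hPQ hc)
    rw [lt_min_iff] at h4
    refine H θ ⟨h3, h4.1⟩ 0 ⟨?_, ?_⟩ <;> norm_num <;> linarith
  · by_contra hc; push Not at hc
    obtain ⟨θ, h3, h4⟩ := exists_between (max_lt hPQ hc)
    rw [max_lt_iff] at h3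
    refine H θ ⟨h3.1, h4⟩ 1 ⟨?_, ?_⟩ <;> norm_num <;> linarith

namespace IsGd
variable {X : Set ℂ} {N : ℤ} {v : ℤ → ℂ} {φ : ℤ → ℝ} {α : ℝ} (h : IsGd X N v φ α)
include h

lemma free_th {Θ : ℝ × ℝ → ℝ} (hT : IsTheta N v φ Θ π) {s δ : ℝ}
    (hδ : ∀ r : ℝ, 0 < r → gam v s + r * e δ ∉ X) :
    ∃ m : ℤ, ∀ t ∈ Ioo s (s + N), Θ (s, t) ∈ Ioo (δ + 2 * π * m) (δ + 2 * π * m + 2 * π) := by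
  refine lift_window isPreconnected_Ioo (th_cont h.pg hT s) ?_
  intro t ht h0
  have h1 := h.pg.gam_ne ht.1 ht.2
  refine hδ ‖gam v t - gam v s‖ (norm_pos_iff.2 h1) ?_
  have := hT.arg s t ht.1 ht.2
  unfold IsArg at this
  rw [← h0, ← this, add_sub_cancel]
  exact h.gam_mem t

/-- angles at a boundary point which is locally on one side -/
lemma half_loc {s δ lo : ℝ} {Θ : ℝ × ℝ → ℝ} (hT : IsTheta N v φ Θ π)
    (hw : ∀ t ∈ Ioo s (s + N), Θ (s, t) ∈ Ioo δ (δ + 2 * π)) (h1 : lo < δ) (h2 : δ < lo + π)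
    (hl : ∀ θ ∈ Ioo lo (lo + π), ∃ ρ > 0, ∀ r ∈ Ioo 0 ρ, gam v s + (r : ℝ) * e θ ∉ X) :
    lo + π ≤ phP φ s ∧ phM φ s + π ≤ lo + 2 * π := by
  obtain ⟨c1, c2, c3⟩ := th_cut h.pg hT s
  have a1 := hw _ ⟨c1, by linarith⟩
  have a2 := hw _ ⟨by linarith, c3⟩
  rw [th_first h.pg hT c1 le_rfl] at a1
  rw [th_last h.pg hT h.phper le_rfl c3] at a2
  have ht := abs_lt.1 (h.pg.turn_abs s)
  refine avoid_int (by linarith) a1.1.le a2.2.le h1 h2 ?_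
  intro θ hθ m hm
  obtain ⟨ρ, hρ, hg⟩ := h.lg.1 s
  obtain ⟨ρ', hρ', hg'⟩ := hl (θ - 2 * π * m) ⟨by linarith [hm.1], by linarith [hm.2]⟩
  have hmm := lt_min hρ hρ'
  have r1 := min_le_left ρ ρ'
  have r2 := min_le_right ρ ρ'
  have b1 := hg θ hθ (min ρ ρ' / 2) ⟨by linarith, by linarith⟩
  have b2 := hg' (min ρ ρ' / 2) ⟨by linarith, by linarith⟩
  have e1 : e (θ - 2 * π * m) = e θ := by
    rw [← e_add_int (θ - 2 * π * m) m]; congr 1; ring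
  rw [e1] at b2
  exact b2 (interior_subset b1)

lemma two_pts {a1 a2 : ℂ} (ha1 : a1 ∈ frontier X) (ha2 : a2 ∈ frontier X) {δ lo hi : ℝ}
    (h1 : lo < δ) (h2 : δ < lo + π) (h3 : δ < hi) (h4 : hi - π < δ)
    (f1 : ∀ r : ℝ, 0 < r → a1 + r * e δ ∉ X) (f2 : ∀ r : ℝ, 0 < r → a2 + r * e δ ∉ X)
    (l1 : ∀ θ ∈ Ioo lo (lo + π), ∃ ρ > 0, ∀ r ∈ Ioo 0 ρ, a1 + (r : ℝ) * e θ ∉ X)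
    (l2 : ∀ θ ∈ Ioo (hi - π) hi, ∃ ρ > 0, ∀ r ∈ Ioo 0 ρ, a2 + (r : ℝ) * e θ ∉ X)
    (hc : 0 < cr (e δ) (a2 - a1)) : lo + π - α ≤ hi := by
  have hpi := pi_pos
  obtain ⟨Θ, hT⟩ := exists_theta_pi h.pg h.phper
  have hN := h.pg.nreal
  rw [h.fr] at ha1 ha2
  obtain ⟨s, hs⟩ := ha1
  obtain ⟨t, ht⟩ := ha2
  obtain ⟨m, hm⟩ := h.free_th hT (s := s) (δ := δ) (by rw [hs]; exact f1)
  obtain ⟨s1, hs1⟩ : ∃ s1, s1 = s + ((-m : ℤ) : ℝ) * N := ⟨_, rfl⟩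
  have gs1 : gam v s1 = a1 := by rw [hs1, gam_per_mul h.pg.per, hs]
  have hw1 : ∀ t ∈ Ioo s1 (s1 + N), Θ (s1, t) ∈ Ioo δ (δ + 2 * π) := by
    intro t ht
    have b := hm (t + m * N) ⟨by rw [hs1] at ht; push_cast at ht; linarith [ht.1],
      by rw [hs1] at ht; push_cast at ht; linarith [ht.2]⟩
    have c := th_shift_mul h.pg hT (-m) (s := s) (t := t + m * N)
      (by rw [hs1] at ht; push_cast at ht; linarith [ht.1])
      (by rw [hs1] at ht; push_cast at ht; linarith [ht.2])
    rw [← hs1, show t + m * (N : ℝ) + ((-m : ℤ) : ℝ) * N = t by push_cast; ring] at c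
    rw [c]
    push_cast
    constructor <;> linarith [b.1, b.2]
  obtain ⟨t', ht', hgt'⟩ := h.pg.mod_near s1 t 0
  rw [ht, sub_zero] at *
  have hne : a2 ≠ a1 := by rintro rfl; simp [cr] at hc
  have hlt : s1 < t' := by
    rcases eq_or_lt_of_le ht'.1 with h5 | h5
    · exact (hne (by rw [← hgt', ← h5, gs1])).elim
    · exact h5
  have w12 := hw1 t' ⟨hlt, ht'.2⟩
  have ar := hT.arg s1 t' hlt ht'.2
  rw [hgt', gs1] at ar
  have hcr : 0 < sin (Θ (s1, t') - δ) := by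
    have e1 : IsArg (e δ) δ := by simp [IsArg, norm_e]
    rw [e1.cr_eq ar, norm_e] at hc
    by_contra hcon; push Not at hcon
    nlinarith [norm_nonneg (a2 - a1)]
  have hlt2 : Θ (s1, t') < δ + π := by
    by_contra hcon; push Not at hcon
    have : 0 ≤ sin (Θ (s1, t') - δ - π) :=
      sin_nonneg_of_nonneg_of_le_pi (by linarith) (by linarith [w12.2])
    rw [sin_sub_pi] at this
    linarith
  obtain ⟨m2, hm2⟩ := h.free_th hT (s := t') (δ := δ) (by rw [hgt']; exact f2)
  have hsh := hT.shift s1 t' hlt ht'.2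
  have hm20 : m2 = 0 := by
    have := hm2 (s1 + N) ⟨ht'.2, by linarith⟩
    rw [hsh] at this
    have c1 : (m2 : ℝ) < 1 := by
      by_contra hcon; push Not at hcon; nlinarith [this.1]
    have c2 : (-1 : ℝ) < m2 := by
      by_contra hcon; push Not at hcon; nlinarith [this.2, w12.1]
    have d1 : m2 < 1 := by exact_mod_cast c1
    have d2 : -1 < m2 := by exact_mod_cast c2
    omega
  rw [hm20] at hm2
  simp only [Int.cast_zero, mul_zero, add_zero] at hm2
  have r1 := (h.half_loc hT hw1 h1 h2 (by rw [gs1]; exact l1)).1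
  have r2 := (h.half_loc hT hm2 (lo := hi - π) h4 (by linarith) (by
    rw [hgt']; intro θ hθ; exact l2 θ ⟨hθ.1, by linarith [hθ.2]⟩)).2
  have hfl : ⌊s1⌋ ≤ ⌈t'⌉ - 1 := by
    have : ⌊s1⌋ < ⌈t'⌉ := by
      have : (⌊s1⌋ : ℝ) < ⌈t'⌉ := by linarith [Int.floor_le s1, Int.le_ceil t']
      exact_mod_cast this
    omega
  have := h.aco _ _ hfl
  rw [phP] at r1
  rw [phM] at r2
  linarith

end IsGd

end MS

namespace MS

/-- extreme directions of chords from `gam v s` -/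
structure Ext (X : Set ℂ) (N : ℤ) (v : ℤ → ℂ) (Θ : ℝ × ℝ → ℝ) (ℓ s A B : ℝ) : Prop where
  lo : ∃ t ∈ Ioo s (s + N), Θ (s, t) = A
  hi : ∃ t ∈ Ioo s (s + N), Θ (s, t) = B
  bd : ∀ t ∈ Ioo s (s + N), A ≤ Θ (s, t) ∧ Θ (s, t) ≤ B
  gap : B - 2 * π + ℓ ≤ A
  free : ∀ δ ∈ Ioo (B - 2 * π) A, ∀ r : ℝ, 0 < r → gam v s + r * e δ ∉ X

lemma IsReg.ext {X : Set ℂ} {N : ℤ} {v : ℤ → ℂ} {φ : ℤ → ℝ} (h : IsReg X N v φ)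
    (hph : ∀ k, φ (k + N) = φ k + 2 * π) {Θ : ℝ × ℝ → ℝ} (hT : IsTheta N v φ Θ π) {ℓ s : ℝ}
    (hl : 0 < ℓ) (hl2 : ℓ ≤ π) (arc : ∃ a, FreeArc X (gam v s) a ℓ) :
    ∃ A B, Ext X N v Θ ℓ s A B := by
  have hpi := pi_pos
  obtain ⟨a, ha⟩ := arc
  obtain ⟨t1, ht1, t2, ht2, hb⟩ := th_ext h.pg hT hph s
  have nof : ∀ t ∈ Ioo s (s + N), ∀ δ ∈ Ioo a (a + ℓ), e (Θ (s, t)) ≠ e δ := by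
    intro t ht δ hδ h0
    have h1 := h.pg.gam_ne ht.1 ht.2
    refine ha δ hδ ‖gam v t - gam v s‖ (norm_pos_iff.2 h1) ?_
    have := hT.arg s t ht.1 ht.2
    unfold IsArg at this
    rw [← h0, ← this, add_sub_cancel]
    exact h.gam_mem t
  have nof2 : ∀ t ∈ Ioo s (s + N), ∀ m : ℤ, ¬ (a + 2 * π * m < Θ (s, t) ∧ Θ (s, t) < a + ℓ + 2 * π * m) := by
    intro t ht m hm
    refine nof t ht (Θ (s, t) - 2 * π * m) ⟨by linarith [hm.1], by linarith [hm.2]⟩ ?_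
    rw [← e_add_int (Θ (s, t) - 2 * π * m) m]; congr 1; ring
  obtain ⟨m, hm⟩ := lift_window isPreconnected_Ioo (th_cont h.pg hT s) (δ := a + ℓ / 2)
    (fun t ht => nof t ht _ ⟨by linarith, by linarith⟩)
  refine ⟨_, _, ⟨t1, ht1, rfl⟩, ⟨t2, ht2, rfl⟩, hb, ?_, ?_⟩
  · have h1 : a + ℓ + 2 * π * m ≤ Θ (s, t1) := by
      by_contra hc; push Not at hc
      exact nof2 t1 ht1 m ⟨by linarith [(hm t1 ht1).1], hc⟩
    have h2 : Θ (s, t2) ≤ a + 2 * π * (m + 1) := by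
      by_contra hc; push Not at hc
      have := (hm t2 ht2).2
      refine nof2 t2 ht2 (m + 1) ⟨by push_cast; linarith, by push_cast; linarith⟩
    linarith
  · intro δ hδ r hr hmem
    obtain ⟨r', hr', hfr⟩ := last_pt h.comp hmem
    rw [h.fr] at hfr
    obtain ⟨x, hx⟩ := hfr
    obtain ⟨t, ht, hgt⟩ := h.pg.mod_near s x 0
    rw [sub_zero] at ht
    have hr0 : 0 < r' := by linarith
    have hd : gam v t - gam v s = r' * e δ := by rw [hgt, hx]; ring
    have hne : (r' : ℂ) * e δ ≠ 0 := mul_ne_zero (by exact_mod_cast hr0.ne') (e_ne _)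
    have hlt : s < t := by
      rcases eq_or_lt_of_le ht.1 with h5 | h5
      · rw [← h5, sub_self] at hd; exact (hne hd.symm).elim
      · exact h5
    have a1 := hT.arg s t hlt ht.2
    rw [hd] at a1
    obtain ⟨k, hk⟩ := IsArg.unique hne a1 (isArg_smul_e hr0.le δ)
    have b := hb t ⟨hlt, ht.2⟩
    rw [hk] at b
    have c1 : (k : ℝ) < 1 := by
      by_contra hcon; push Not at hcon; nlinarith [hδ.1, b.2]
    have c2 : (0 : ℝ) < k := by
      by_contra hcon; push Not at hcon; nlinarith [hδ.2, b.1]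
    have d1 : k < 1 := by exact_mod_cast c1
    have d2 : 0 < k := by exact_mod_cast c2
    omega

lemma ray_mix {p r a b : ℝ} (hp : 0 < p) (hr : 0 < r) (h1 : a < b) (h2 : b < a + π) :
    ∃ θ ∈ Ioo a b, ∃ r' : ℝ, 0 < r' ∧ (p : ℂ) * e a + r * e b = r' * e θ := by
  have hs : 0 < sin (b - a) := sin_pos_of_pos_of_lt_pi (by linarith) (by linarith)
  obtain ⟨w, hw⟩ : ∃ w : ℂ, w = (p : ℂ) * e 0 + r * e (b - a) := ⟨_, rfl⟩
  have him : 0 < w.im := by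
    rw [hw, e_zero]; simp [e_im]; positivity
  have hw0 : w ≠ 0 := by rintro h; rw [h] at him; simp at him
  have hn : 0 < ‖w‖ := norm_pos_iff.2 hw0
  have ha := isArg_arg w
  have hc1 : 0 < Complex.arg w := by
    have := Complex.arg_nonneg_iff.2 him.le
    rcases eq_or_lt_of_le this with h | h
    · have := (Complex.arg_eq_zero_iff.1 h.symm).2; linarith
    · exact h
  have hc2 : Complex.arg w < b - a := by
    have c := ha.cr_eq (isArg_smul_e (r := 1) (by norm_num) (b - a))
    rw [hw, cr_add_left, cr_smul_e, cr_smul_e, ← hw] at c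
    simp [norm_e] at c
    by_contra hcon; push Not at hcon
    have := sin_nonneg_of_nonneg_of_le_pi (x := Complex.arg w - (b - a)) (by linarith)
      (by linarith [Complex.arg_le_pi w])
    rw [← neg_sub, sin_neg] at this
    have e1 : b - a - Complex.arg w = -(Complex.arg w - (b - a)) := by ring
    have : 0 < p * sin (b - a) := by positivity
    nlinarith
  refine ⟨a + Complex.arg w, ⟨by linarith, by linarith⟩, ‖w‖, hn, ?_⟩
  have e1 : e b = e a * e (b - a) := by rw [← e_add]; congr 1; ring
  rw [e_add]
  have : (‖w‖ : ℂ) * (e a * e (Complex.arg w)) = e a * w := by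
    conv_rhs => rw [ha]
    ring
  rw [this, hw, e1, e_zero]; ring

section
variable {K L : Set ℂ} {α : ℝ} {Nk Nl : ℤ} {vk vl : ℤ → ℂ} {φk φl : ℤ → ℝ}
  (hα : α < π) (hK : IsGd K Nk vk φk α) (hL : IsGd L Nl vl φl α)
  {N : ℤ} {v : ℤ → ℂ} {φ : ℤ → ℝ} (h : IsReg (K + L) N v φ)
  (hph : ∀ k, φ (k + N) = φ k + 2 * π) {Θ : ℝ × ℝ → ℝ} (hT : IsTheta N v φ Θ π)
include hα hK hL h hT

lemma claim_aux {s0 s' A0 B0 A' B' : ℝ} (x0 : Ext (K + L) N v Θ (π - α) s0 A0 B0)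
    (x' : Ext (K + L) N v Θ (π - α) s' A' B') (h1 : s0 < s') (h2 : s' < s0 + N)
    (hlo : B0 - 2 * π < A') : B0 - 2 * π + (π - α) ≤ A' := by
  by_contra hcon; push Not at hcon
  have hpi := pi_pos
  have hα0 := hK.alpha_nonneg
  obtain ⟨lo, hlo'⟩ : ∃ lo, lo = B0 - 2 * π := ⟨_, rfl⟩
  have g0 := x0.gap
  have g' := x'.gap
  rw [← hlo'] at hlo hcon g0
  obtain ⟨δ, hd1, hd2⟩ := exists_between hlo
  have f0 : ∀ θ ∈ Ioo lo A0, ∀ r : ℝ, 0 < r → gam v s0 + r * e θ ∉ K + L := by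
    rw [hlo']; exact x0.free
  have f' := x'.free
  obtain ⟨t1, ht1, hB⟩ := x0.hi
  obtain ⟨t2, ht2, hA⟩ := x'.lo
  obtain ⟨p, hp, hy1⟩ : ∃ p : ℝ, 0 < p ∧ gam v t1 = gam v s0 + p * e lo := by
    refine ⟨_, norm_pos_iff.2 (h.pg.gam_ne ht1.1 ht1.2), ?_⟩
    have := hT.arg s0 t1 ht1.1 ht1.2
    unfold IsArg at this
    rw [hB, show B0 = lo + 2 * π * (1 : ℤ) by rw [hlo']; push_cast; ring, e_add_int] at this
    rw [← this]; ring
  obtain ⟨q, hq, hy2⟩ : ∃ q : ℝ, 0 < q ∧ gam v t2 = gam v s' + q * e A' := by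
    refine ⟨_, norm_pos_iff.2 (h.pg.gam_ne ht2.1 ht2.2), ?_⟩
    have := hT.arg s' t2 ht2.1 ht2.2
    unfold IsArg at this
    rw [hA] at this
    rw [← this]; ring
  have F1 : ∀ r : ℝ, 0 < r → gam v t1 + r * e δ ∉ K + L := by
    intro r hr
    obtain ⟨θ, hθ, r', hr', he⟩ := ray_mix hp hr hd1 (by linarith)
    rw [hy1, add_assoc, he]
    exact f0 θ ⟨hθ.1, by linarith [hθ.2]⟩ r' hr'
  have F2 : ∀ r : ℝ, 0 < r → gam v t2 + r * e δ ∉ K + L := by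
    intro r hr
    obtain ⟨θ, hθ, r', hr', he⟩ := ray_mix hr hq hd2 (by linarith)
    rw [hy2, add_assoc, add_comm ((q : ℂ) * e A'), he]
    exact f' θ ⟨by linarith [hθ.1], hθ.2⟩ r' hr'
  have L1 : ∀ θ ∈ Ioo lo (lo + π), ∃ ρ > 0, ∀ r ∈ Ioo 0 ρ, gam v t1 + (r : ℝ) * e θ ∉ K + L := by
    intro θ hθ
    obtain ⟨ρ, hρ, H⟩ := near_ray lo hp (lt_add_one p) (κ := A0 - lo) (by linarith)
    refine ⟨ρ, hρ, fun r hr => ?_⟩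
    obtain ⟨η, hη, r', hr', he, hpos, -⟩ := H (r * e θ) (by simp [norm_e, abs_of_pos hr.1, hr.2])
    have : 0 < cr (e lo) (r * e θ) := by
      have c := cr_smul_e 1 r lo θ
      simp only [Complex.ofReal_one, one_mul] at c
      rw [c]
      exact mul_pos hr.1 (sin_pos_of_pos_of_lt_pi (by linarith [hθ.1]) (by linarith [hθ.2]))
    have := hpos this
    rw [hy1, add_assoc, he]
    exact f0 _ ⟨by linarith, by linarith [(abs_lt.1 hη).2]⟩ r' hr'.1
  have L2 : ∀ θ ∈ Ioo (A' - π) A', ∃ ρ > 0, ∀ r ∈ Ioo 0 ρ, gam v t2 + (r : ℝ) * e θ ∉ K + L := by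
    intro θ hθ
    obtain ⟨ρ, hρ, H⟩ := near_ray A' hq (lt_add_one q) (κ := A' - (B' - 2 * π)) (by linarith)
    refine ⟨ρ, hρ, fun r hr => ?_⟩
    obtain ⟨η, hη, r', hr', he, -, hneg⟩ := H (r * e θ) (by simp [norm_e, abs_of_pos hr.1, hr.2])
    have : cr (e A') (r * e θ) < 0 := by
      have c := cr_smul_e 1 r A' θ
      simp only [Complex.ofReal_one, one_mul] at c
      rw [c]
      exact mul_neg_of_pos_of_neg hr.1
        (sin_neg_of_neg_of_neg_pi_lt (by linarith [hθ.2]) (by linarith [hθ.1]))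
    have := hneg this
    rw [hy2, add_assoc, he]
    exact f' _ ⟨by linarith [(abs_lt.1 hη).1], by linarith⟩ r' hr'.1
  have C : 0 < cr (e δ) (gam v t2 - gam v t1) := by
    have e1 : gam v t2 - gam v t1 = q * e A' + (gam v s' - gam v s0) - p * e lo := by
      rw [hy1, hy2]; ring
    rw [e1, cr_sub_right, cr_add_right]
    have c1 := cr_smul_e 1 q δ A'
    have c2 := cr_smul_e 1 p δ lo
    simp only [Complex.ofReal_one, one_mul] at c1 c2
    have s1 : 0 < sin (A' - δ) := sin_pos_of_pos_of_lt_pi (by linarith) (by linarith)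
    have s2 : sin (lo - δ) < 0 := sin_neg_of_neg_of_neg_pi_lt (by linarith) (by linarith)
    have a3 := hT.arg s0 s' h1 h2
    have c3 := (isArg_smul_e (r := 1) (by norm_num) δ).cr_eq a3
    have b0 := x0.bd s' ⟨h1, h2⟩
    have b' := x'.bd (s0 + N) ⟨h2, by linarith⟩
    rw [hT.shift s0 s' h1 h2] at b'
    have s3 : 0 ≤ sin (Θ (s0, s') - δ) :=
      sin_nonneg_of_nonneg_of_le_pi (by linarith) (by linarith)
    simp [norm_e] at c3
    rw [c1, c2, c3]
    have : 0 ≤ ‖gam v s' - gam v s0‖ * sin (Θ (s0, s') - δ) := by positivity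
    nlinarith [mul_pos hq s1, mul_pos hp (neg_pos.2 s2)]
  have hcl := closed_add hK hL
  have m1 : gam v t1 ∈ frontier (K + L) := by rw [h.fr]; exact ⟨_, rfl⟩
  have m2 : gam v t2 ∈ frontier (K + L) := by rw [h.fr]; exact ⟨_, rfl⟩
  obtain ⟨a1, ha1, l1, hl1, e1, fr1⟩ := frontier_add hK.comp.isClosed hL.comp.isClosed hcl m1
  obtain ⟨a2, ha2, l2, hl2, e2, fr2⟩ := frontier_add hK.comp.isClosed hL.comp.isClosed hcl m2
  have q1 := fr1 _ ha1 _ hl1 e1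
  have q2 := fr2 _ ha2 _ hl2 e2
  have tk1 : ∀ z, gam v t1 + z ∉ K + L → a1 + z ∉ K := fun z hz hk =>
    hz ⟨_, hk, _, hl1, by simp only [← e1]; ring⟩
  have tk2 : ∀ z, gam v t2 + z ∉ K + L → a2 + z ∉ K := fun z hz hk =>
    hz ⟨_, hk, _, hl2, by simp only [← e2]; ring⟩
  have tl1 : ∀ z, gam v t1 + z ∉ K + L → l1 + z ∉ L := fun z hz hk =>
    hz ⟨_, ha1, _, hk, by simp only [← e1]; ring⟩
  have tl2 : ∀ z, gam v t2 + z ∉ K + L → l2 + z ∉ L := fun z hz hk =>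
    hz ⟨_, ha2, _, hk, by simp only [← e2]; ring⟩
  have e3 : gam v t2 - gam v t1 = (a2 - a1) + (l2 - l1) := by rw [← e1, ← e2]; ring
  rw [e3, cr_add_right] at C
  have main : lo + π - α ≤ A' := by
    rcases lt_or_ge 0 (cr (e δ) (a2 - a1)) with hc | hc
    · refine hK.two_pts q1.1 q2.1 hd1 (by linarith) hd2 (by linarith) (fun r hr => tk1 _ (F1 r hr))
        (fun r hr => tk2 _ (F2 r hr)) (fun θ hθ => ?_) (fun θ hθ => ?_) hc
      · obtain ⟨ρ, hρ, H⟩ := L1 θ hθ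
        exact ⟨ρ, hρ, fun r hr => tk1 _ (H r hr)⟩
      · obtain ⟨ρ, hρ, H⟩ := L2 θ hθ
        exact ⟨ρ, hρ, fun r hr => tk2 _ (H r hr)⟩
    · refine hL.two_pts q1.2 q2.2 hd1 (by linarith) hd2 (by linarith) (fun r hr => tl1 _ (F1 r hr))
        (fun r hr => tl2 _ (F2 r hr)) (fun θ hθ => ?_) (fun θ hθ => ?_) (by linarith)
      · obtain ⟨ρ, hρ, H⟩ := L1 θ hθ
        exact ⟨ρ, hρ, fun r hr => tl1 _ (H r hr)⟩
      · obtain ⟨ρ, hρ, H⟩ := L2 θ hθ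
        exact ⟨ρ, hρ, fun r hr => tl2 _ (H r hr)⟩
  linarith

omit hα hK hL in
include hph in
lemma near_right {σ c : ℝ} (hc : ∀ t ∈ Ioo σ (σ + N), c ≤ Θ (σ, t)) {lo : ℝ} (hlo : lo < c) :
    ∃ ε > 0, ∀ s ∈ Ioo σ (σ + ε), ∀ t ∈ Ioo s (s + N), lo < Θ (s, t) := by
  have hpi := pi_pos
  have hN := h.pg.nreal
  obtain ⟨c1, c2, c3⟩ := th_cut h.pg hT σ
  have hP := hc _ ⟨c1, by linarith⟩
  have hM := hc _ ⟨by linarith, c3⟩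
  rw [th_first h.pg hT c1 le_rfl] at hP
  rw [th_last h.pg hT hph le_rfl c3] at hM
  have ev : ∀ᶠ s in nhds σ, ∀ t ∈ Icc ((⌊σ⌋ : ℝ) + 1) (⌈σ⌉ - 1 + N), lo < Θ (s, t) := by
    refine isCompact_Icc.eventually_forall_of_forall_eventually (P := fun s t => lo < Θ (s, t)) ?_
    intro t ht
    have hm : (σ, t) ∈ strip N := ⟨by simp only; linarith [ht.1], by simp only; linarith [ht.2]⟩
    have hca := hT.cont.continuousAt ((isOpen_strip N).mem_nhds hm)
    exact hca.eventually_const_lt (hlo.trans_le (hc t ⟨by linarith [ht.1], by linarith [ht.2]⟩))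
  obtain ⟨ε, hε, H⟩ := Metric.eventually_nhds_iff.1 ev
  have hfl := Int.floor_le σ
  refine ⟨min ε (⌊σ⌋ + 1 - σ), lt_min hε (by linarith), ?_⟩
  intro s hs t ht
  have r1 := min_le_left ε (⌊σ⌋ + 1 - σ)
  have r2 := min_le_right ε (⌊σ⌋ + 1 - σ)
  have hs1 := hs.1
  have hs2 := hs.2
  rcases le_or_gt t (⌊σ⌋ + 1) with h1 | h1
  · rw [hT.edge ⌊σ⌋ s t (by linarith) ht.1 h1]
    exact hlo.trans_le hP
  rcases le_or_gt t (⌈σ⌉ - 1 + N) with h2 | h2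
  · exact H (by rw [Real.dist_eq, abs_of_pos (by linarith)]; linarith) t ⟨h1.le, h2⟩
  have hsh := hT.shift (t - N) s (by linarith [ht.2]) (by linarith [ht.1])
  rw [sub_add_cancel] at hsh
  rw [hsh]
  have hts : t - N < s := by linarith [ht.2]
  rcases le_or_gt ((⌊σ⌋ : ℤ) : ℝ) (t - N) with h3 | h3
  · rw [hT.edge ⌊σ⌋ (t - N) s h3 hts (by linarith)]
    rw [phP] at hP
    linarith
  · have hk : ⌈σ⌉ - 1 = ⌊σ⌋ - 1 := by
      have : (⌈σ⌉ : ℝ) < ⌊σ⌋ + 1 := by linarith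
      have : ⌈σ⌉ < ⌊σ⌋ + 1 := by exact_mod_cast this
      have := Int.floor_le_ceil σ
      omega
    have hk2 : (⌈σ⌉ : ℝ) = ⌊σ⌋ := by
      have : ⌈σ⌉ = ⌊σ⌋ := by omega
      rw [this]
    have := hT.corner (⌊σ⌋ - 1) (t - N) s (by push_cast; linarith) (by push_cast; linarith)
      (by push_cast; linarith) (by push_cast; linarith) hts
    rw [sub_add_cancel] at this
    rw [phP] at hP
    rw [phM, hk] at hM
    rcases le_total (φ (⌊σ⌋ - 1)) (φ ⌊σ⌋) with h5 | h5
    · rw [uIcc_of_le h5] at this; linarith [this.1]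
    · rw [uIcc_of_ge h5] at this; linarith [this.1]

include hph in
lemma stay (arc : ∀ s, ∃ a, FreeArc (K + L) (gam v s) a (π - α)) {s0 A0 B0 : ℝ}
    (x0 : Ext (K + L) N v Θ (π - α) s0 A0 B0) {b : ℝ} (hb : s0 ≤ b) (hb2 : b < s0 + N) :
    ∀ t ∈ Ioo b (b + N), B0 - 2 * π + (π - α) ≤ Θ (b, t) := by
  have hα0 := hK.alpha_nonneg
  obtain ⟨c, hcdef⟩ : ∃ c, c = B0 - 2 * π + (π - α) := ⟨_, rfl⟩
  rw [← hcdef]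
  let G : Set ℝ := {s | ∀ t ∈ Ioo s (s + N), c ≤ Θ (s, t)}
  have hGc : IsClosed G := by
    rw [← isOpen_compl_iff, isOpen_iff_mem_nhds]
    intro s hs
    simp only [G, mem_compl_iff, mem_ofPred_eq] at hs
    push Not at hs
    obtain ⟨t, ht, hlt⟩ := hs
    have hm : (s, t) ∈ strip N := ⟨ht.1, ht.2⟩
    have hca := hT.cont.continuousAt ((isOpen_strip N).mem_nhds hm)
    have e1 := hca.eventually_lt_const hlt
    have e2 := (isOpen_strip N).mem_nhds hm
    have e3 : ∀ᶠ p in nhds (s, t), p ∈ strip N ∧ Θ p < c := by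
      filter_upwards [e1, e2] with p h1 h2 using ⟨h2, h1⟩
    have cc : ContinuousAt (fun x : ℝ => (x, t)) s := by fun_prop
    filter_upwards [cc.eventually e3] with x hx hxG
    exact absurd (hxG t ⟨hx.1.1, hx.1.2⟩) (not_le.2 hx.2)
  have hsub : Icc s0 b ⊆ G := by
    refine IsClosed.Icc_subset_of_forall_exists_gt (hGc.inter isClosed_Icc) ?_ ?_
    · intro t ht
      rw [hcdef]; exact x0.gap.trans (x0.bd t ht).1
    · rintro σ ⟨hσ, hσ0, hσb⟩ y hy
      obtain ⟨ε, hε, H⟩ := near_right h hph hT hσ (lo := B0 - 2 * π) (by rw [hcdef]; linarith)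
      have hy : σ < y := hy
      obtain ⟨s, hs1, hs2⟩ := exists_between (a₁ := σ) (a₂ := min (min (σ + ε) y) b)
        (lt_min (lt_min (by linarith) hy) hσb)
      rw [lt_min_iff, lt_min_iff] at hs2
      refine ⟨s, ?_, hs1, hs2.1.2.le⟩
      obtain ⟨A, B, xs⟩ := h.ext hph hT (s := s) (ℓ := π - α) (by linarith) (by linarith) (arc s)
      obtain ⟨t, ht, htA⟩ := xs.lo
      have := H s ⟨hs1, hs2.1.1⟩ t ht
      rw [htA] at this
      have := claim_aux hα hK hL h hT x0 xs (by linarith) (by linarith [hs2.2]) this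
      intro t ht
      rw [hcdef]; exact this.trans (xs.bd t ht).1
  exact hsub ⟨hb, le_rfl⟩

end

theorem core {K L : Set ℂ} {α : ℝ} {Nk Nl : ℤ} {vk vl : ℤ → ℂ} {φk φl : ℤ → ℝ}
    (hα : α < π) (hK : IsGd K Nk vk φk α) (hL : IsGd L Nl vl φl α) :
    ∃ N v φ, IsGd (K + L) N v φ α := by
  have hpi := pi_pos
  have hα0 := hK.alpha_nonneg
  obtain ⟨E, hE⟩ := nice_add hα hK hL
  obtain ⟨N, v, φ, h, hph⟩ := hE.exists_reg
  obtain ⟨Θ, hT⟩ := exists_theta_pi h.pg hph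
  have hN := h.pg.nreal
  have arc : ∀ s, ∃ a, FreeArc (K + L) (gam v s) a (π - α) := fun s =>
    hE.arc_bd (by rw [h.fr]; exact ⟨s, rfl⟩)
  have key : ∀ i j : ℤ, i < j → j < i + 1 + N → φ i - α ≤ φ j := by
    intro i j hij hj
    obtain ⟨A, B, x0⟩ := h.ext hph hT (s := ((i + 1 : ℤ) : ℝ)) (ℓ := π - α) (by linarith)
      (by linarith) (arc _)
    have hij' : ((i + 1 : ℤ) : ℝ) ≤ j := by exact_mod_cast hij
    have hj' : (j : ℝ) < ((i + 1 : ℤ) : ℝ) + N := by exact_mod_cast hj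
    have st := stay hα hK hL h hph hT arc x0 hij' hj' (j + 1) ⟨by linarith, by linarith⟩
    rw [hT.edge j j (j + 1) le_rfl (by linarith) le_rfl] at st
    obtain ⟨c1, c2, c3⟩ := th_cut h.pg hT ((i + 1 : ℤ) : ℝ)
    have b := x0.bd _ ⟨by linarith, c3⟩
    rw [th_last h.pg hT hph le_rfl c3, phM_int, add_sub_cancel_right] at b
    linarith [b.2]
  refine ⟨N, v, φ, { toIsReg := h, phper := hph, aco := ?_ }⟩
  intro i j hij
  have hN0 := h.pg.hN
  have hm : 0 ≤ (j - i) / N := Int.ediv_nonneg (by omega) hN0.le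
  have hr0 : 0 ≤ (j - i) % N := Int.emod_nonneg _ hN0.ne'
  have hr1 := Int.emod_lt_of_pos (j - i) hN0
  have hj : j = i + (j - i) % N + (j - i) / N * N := by
    have := Int.emod_add_ediv_mul (j - i) N
    linarith
  rw [hj, phper_mul hph]
  have hm' : (0 : ℝ) ≤ (((j - i) / N : ℤ) : ℝ) := by exact_mod_cast hm
  have : 0 ≤ 2 * π * (((j - i) / N : ℤ) : ℝ) := by positivity
  rcases eq_or_lt_of_le hr0 with h0 | h0
  · rw [← h0, add_zero]; linarith
  · have := key i (i + (j - i) % N) (by omega) (by omega)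
    linarith

end MS

namespace MS

/-- the plane as the complex numbers -/
def TT : (ℝ × ℝ) ≃L[ℝ] ℂ := Complex.equivRealProdCLM.symm

lemma TT_apply (p : ℝ × ℝ) : TT p = p.1 + p.2 * Complex.I := Complex.equivRealProdCLM_symm_apply p

lemma TT_smul (a : ℝ) (p : ℝ × ℝ) : TT (a • p) = (a : ℂ) * TT p := by
  rw [map_smul, Complex.real_smul]

lemma vangle_eq (p q : ℝ × ℝ) : vangle p q = Complex.arg (TT q / TT p) := by
  rw [vangle, TT_apply, TT_apply]

lemma opp_iff {p q : ℝ × ℝ} (hp : p ≠ 0) (hq : q ≠ 0) :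
    Opp p q ↔ Complex.arg (TT q / TT p) = π := by
  have hp' : TT p ≠ 0 := by simpa using hp
  have hq' : TT q ≠ 0 := by simpa using hq
  rw [Complex.arg_eq_pi_iff]
  constructor
  · rintro ⟨a, ha, rfl⟩
    rw [TT_smul, mul_div_cancel_right₀ _ hp']
    simpa using ha
  · rintro ⟨h1, h2⟩
    refine ⟨(TT q / TT p).re, h1, ?_⟩
    apply TT.injective
    rw [TT_smul]
    have : (((TT q / TT p).re : ℝ) : ℂ) = TT q / TT p := Complex.ext (by simp) (by simp [h2])
    rw [this, div_mul_cancel₀ _ hp']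

/-- segments of a bi-infinite sequence -/
def Lst (s : ℤ → ℝ × ℝ) (i : ℤ) (n : ℕ) : List (ℝ × ℝ) := (List.range n).map (fun j : ℕ => s (i + j))

lemma Lst_length (s : ℤ → ℝ × ℝ) (i : ℤ) (n : ℕ) : (Lst s i n).length = n := by simp [Lst]

lemma Lst_get (s : ℤ → ℝ × ℝ) (i : ℤ) (n k : ℕ) (hk : k < (Lst s i n).length) :
    (Lst s i n)[k] = s (i + k) := by simp [Lst]

lemma Lst_add (s : ℤ → ℝ × ℝ) (i : ℤ) (a b : ℕ) : Lst s i (a + b) = Lst s i a ++ Lst s (i + a) b := by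
  simp [Lst, List.range_add, Function.comp_def, add_assoc]

lemma Lst_succ (s : ℤ → ℝ × ℝ) (i : ℤ) (n : ℕ) : Lst s i (n + 1) = s i :: Lst s (i + 1) n := by
  rw [add_comm, Lst_add]; simp [Lst]

lemma Lst_per {s : ℤ → ℝ × ℝ} {N : ℤ} (hs : ∀ k, s (k + N) = s k) (i : ℤ) (n : ℕ) :
    Lst s (i + N) n = Lst s i n := by
  simp only [Lst]
  congr 1; funext j
  rw [← hs (i + j)]; congr 1; ring

lemma Lst_sub {s : ℤ → ℝ × ℝ} {i : ℤ} {n : ℕ} {t : List (ℝ × ℝ)} (h : t <:+: Lst s i n) :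
    ∃ j : ℤ, t = Lst s j t.length := by
  obtain ⟨a, b, hab⟩ := h
  refine ⟨i + a.length, List.ext_getElem (by simp [Lst]) fun k h1 h2 => ?_⟩
  rw [Lst_get]
  have hl := congrArg List.length hab
  rw [Lst_length] at hl
  simp at hl
  have h3 := Lst_get s i n (a.length + k) (by rw [Lst_length]; omega)
  have h4 : (a ++ t ++ b)[a.length + k]'(by simp; omega) = t[k] := by
    rw [List.getElem_append_left (by simp; omega)]
    simp
  rw [← h4]
  simp only [hab]
  rw [h3]; push_cast; congr 1; ring

lemma rot_Lst {s : ℤ → ℝ × ℝ} {φ : ℤ → ℝ} (h : ∀ k, vangle (s k) (s (k + 1)) = φ (k + 1) - φ k)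
    (n : ℕ) : ∀ i : ℤ, rotShifts (Lst s i (n + 1)) = φ (i + n) - φ i := by
  induction n with
  | zero => intro i; simp [Lst, rotShifts]
  | succ n ih =>
    intro i
    have := ih (i + 1)
    rw [Lst_succ, Lst_succ, rotShifts, ← Lst_succ, this, h]
    push_cast
    rw [show i + 1 + (n : ℤ) = i + (n + 1) by ring]; ring

lemma nonrev_Lst {s : ℤ → ℝ × ℝ} {n : ℕ} :
    NonReverse (Lst s 0 (n + 1)) ↔ ∀ k : ℕ, k < n → ¬ Opp (s k) (s (k + 1)) := by
  have : NonReverse (Lst s 0 (n + 1)) ↔ List.IsChain (fun v w => ¬ Opp v w) (Lst s 0 (n + 1)) := Iff.rfl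
  rw [this, List.isChain_iff_getElem]
  simp only [Lst_get, Lst_length, zero_add]
  constructor
  · intro h k hk
    have := h k (by omega)
    push_cast at this
    exact this
  · intro h k hk
    have := h k (by omega)
    push_cast
    exact this

section
variable {s : ℤ → ℝ × ℝ} {N : ℕ} {φ : ℤ → ℝ} (hN : 0 < N) (hs : ∀ k, s (k + N) = s k)
  {l : List (ℝ × ℝ)} (hl : l = Lst s 0 N)

include hs hl
lemma dbl : l ++ l = Lst s 0 (N + N) := by
  rw [Lst_add, hl]
  have := Lst_per hs 0 N
  rw [this]

include hN
lemma take_one : l ++ l.take 1 = Lst s 0 (N + 1) := by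
  rw [Lst_add, hl, Lst_per hs 0 1]
  congr 1
  obtain ⟨n, rfl⟩ : ∃ n, N = n + 1 := ⟨N - 1, by omega⟩
  rw [Lst_succ, Lst_succ]; simp [Lst]

include φ
variable (hv : ∀ k, vangle (s k) (s (k + 1)) = φ (k + 1) - φ k)
include hv
lemma rotClosed_eq : rotClosed l = φ N - φ 0 := by
  rw [rotClosed, take_one hN hs hl, rot_Lst hv, zero_add]

omit hN in
lemma aco_ge {α : ℝ} (hα : 0 ≤ α) (h : ∀ i j, i ≤ j → φ i - α ≤ φ j) : -α ≤ acoClosed l := by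
  rw [acoClosed]
  refine le_csInf ⟨_, [], ⟨by simp, ⟨[], l ++ l, rfl⟩⟩, rfl⟩ ?_
  rintro _ ⟨t, ⟨-, ht⟩, rfl⟩
  rw [dbl hs hl] at ht
  obtain ⟨j, hj⟩ := Lst_sub ht
  rcases Nat.eq_zero_or_pos t.length with h0 | h0
  · rw [List.length_eq_zero_iff.1 h0]; simp [rotShifts, hα]
  · obtain ⟨n, hn⟩ : ∃ n, t.length = n + 1 := ⟨t.length - 1, by omega⟩
    rw [hj, hn, rot_Lst hv]
    have := h j (j + n) (by omega)
    linarith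

lemma aco_of {α : ℝ} (h : -α ≤ acoClosed l) (hph : ∀ k, φ (k + N) = φ k + 2 * π) :
    ∀ i j, i ≤ j → φ i - α ≤ φ j := by
  have hpi := pi_pos
  have hbdd : BddBelow (rotShifts '' { t : List (ℝ × ℝ) | t.length ≤ l.length ∧ t <:+: (l ++ l) }) := by
    apply Set.Finite.bddBelow
    apply Set.Finite.image
    refine (List.finite_toSet (l ++ l).sublists).subset ?_
    rintro t ⟨-, ht⟩
    exact List.mem_sublists.2 ht.sublist
  have key : ∀ i r : ℕ, i < N → r < N → φ i - α ≤ φ (i + r) := by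
    intro i r hi hr
    have : acoClosed l ≤ rotShifts (Lst s i (r + 1)) := by
      refine csInf_le hbdd ⟨_, ⟨?_, ?_⟩, rfl⟩
      · rw [Lst_length, hl, Lst_length]; omega
      · rw [dbl hs hl]
        refine ⟨Lst s 0 i, Lst s (i + (r + 1)) (N + N - i - (r + 1)), ?_⟩
        have e1 := Lst_add s 0 i (r + 1)
        have e2 := Lst_add s 0 (i + (r + 1)) (N + N - i - (r + 1))
        rw [zero_add] at e1 e2
        rw [← e1]
        push_cast at e2
        rw [← e2]
        congr 1
        omega
    rw [rot_Lst hv] at this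
    linarith
  intro i j hij
  have hN' : (0 : ℤ) < N := by exact_mod_cast hN
  have k0 : 0 ≤ i % N := Int.emod_nonneg _ hN'.ne'
  have k1 := Int.emod_lt_of_pos i hN'
  have hr0 : 0 ≤ (j - i) % N := Int.emod_nonneg _ hN'.ne'
  have hr1 := Int.emod_lt_of_pos (j - i) hN'
  have hm : 0 ≤ (j - i) / N := Int.ediv_nonneg (by omega) hN'.le
  have hi : i = i % N + i / N * N := by
    have := Int.emod_add_ediv_mul i N
    linarith
  have hj : j = i % N + (j - i) % N + (i / N + (j - i) / N) * N := by
    have := Int.emod_add_ediv_mul (j - i) N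
    linarith
  have h1 := phper_mul hph (i % N) (i / N)
  have h2 := phper_mul hph (i % N + (j - i) % N) (i / N + (j - i) / N)
  rw [← hi] at h1
  rw [← hj] at h2
  have := key (i % N).toNat ((j - i) % N).toNat (by omega) (by omega)
  rw [Int.toNat_of_nonneg k0, Int.toNat_of_nonneg hr0] at this
  have hm' : (0 : ℝ) ≤ (((j - i) / N : ℤ) : ℝ) := by exact_mod_cast hm
  have : 0 ≤ 2 * π * (((j - i) / N : ℤ) : ℝ) := by positivity
  push_cast at h2
  linarith
end

lemma image_reg {K : Set (ℝ × ℝ)} (h : K = closure (interior K)) :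
    TT '' K = closure (interior (TT '' K)) := by
  have h1 := TT.toHomeomorph.image_interior K
  have h2 := TT.toHomeomorph.image_closure (interior K)
  rw [h1, ← h] at h2
  exact h2

lemma reg_of_image {K : Set (ℝ × ℝ)} (h : TT '' K = closure (interior (TT '' K))) :
    K = closure (interior K) := by
  have h1 := TT.toHomeomorph.image_interior K
  have h2 := TT.toHomeomorph.image_closure (interior K)
  rw [h1] at h2
  apply TT.injective.image_injective
  exact h.trans h2.symm

lemma image_fr (K : Set (ℝ × ℝ)) : TT '' frontier K = frontier (TT '' K) :=
  TT.toHomeomorph.image_frontier K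

/-- relation between the two parameterizations -/
lemma param_gam {P : Polyline} {N : ℕ} (hN : 0 < N) {v : ℤ → ℂ} (hper : ∀ i, v (i + N) = v i)
    (hlen : P.shifts.length = N) (hv : ∀ j : ℕ, j ≤ N → TT (P.vert j) = v j)
    (hsh : ∀ j : ℕ, j < N → TT (P.shifts.getD j 0) = v (j + 1) - v j) {t : ℝ} (h0 : 0 ≤ t)
    (h1 : t ≤ N) : TT (P.param t) = gam v t := by
  obtain ⟨n, hn⟩ : ∃ n : ℕ, ⌊t⌋ = n := ⟨⌊t⌋.toNat, by rw [Int.toNat_of_nonneg (Int.floor_nonneg.2 h0)]⟩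
  rw [Polyline.param, gam, hn, map_add, TT_smul, Int.toNat_natCast]
  rcases eq_or_lt_of_le h1 with h2 | h2
  · have : n = N := by
      rw [h2] at hn; simp at hn; omega
    subst this
    rw [hv _ le_rfl, h2]; simp
  · have hnN : n < N := by
      have : ((n : ℤ) : ℝ) ≤ t := by rw [← hn]; exact Int.floor_le t
      have : (n : ℝ) < N := by push_cast at this; linarith
      exact_mod_cast this
    rw [hv _ hnN.le, hsh _ hnN]

lemma range_gam {v : ℤ → ℂ} {N : ℕ} (hN : 0 < N) (hper : ∀ i, v (i + N) = v i) :
    range (gam v) = gam v '' Icc 0 (N : ℝ) := by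
  apply Subset.antisymm
  · rintro _ ⟨t, rfl⟩
    have hN' : (0 : ℝ) < N := by exact_mod_cast hN
    refine ⟨toIcoMod hN' 0 t, ?_, ?_⟩
    · have := toIcoMod_mem_Ico hN' 0 t
      exact ⟨this.1, by linarith [this.2]⟩
    · rw [← self_sub_toIcoDiv_zsmul]
      have := gam_per_mul hper (t - toIcoDiv hN' 0 t • (N : ℝ)) (toIcoDiv hN' 0 t)
      rw [← this]; congr 1; simp
  · rintro _ ⟨t, -, rfl⟩; exact ⟨t, rfl⟩

theorem to_gd {K : Set (ℝ × ℝ)} {P : Polyline} (h : IsSimplePolygon K P) {α : ℝ}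
    (hα : -α ≤ acoClosed P.shifts) : ∃ N v φ, IsGd (TT '' K) N v φ α := by
  have hpi := pi_pos
  obtain ⟨N, hlen⟩ : ∃ N, P.shifts.length = N := ⟨_, rfl⟩
  have hN : 0 < N := by rw [← hlen]; exact List.length_pos_iff.2 h.proper.1
  have hN' : (0 : ℤ) < N := by exact_mod_cast hN
  have hNr : (0 : ℝ) < N := by exact_mod_cast hN
  obtain ⟨s, hsdef⟩ : ∃ s : ℤ → ℝ × ℝ, s = fun k : ℤ => P.shifts.getD (k % (N : ℤ)).toNat 0 := ⟨_, rfl⟩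
  obtain ⟨v, hvdef⟩ : ∃ v : ℤ → ℂ, v = fun k : ℤ => TT (P.vert (k % (N : ℤ)).toNat) := ⟨_, rfl⟩
  have hs : ∀ k, s (k + N) = s k := by intro k; simp [hsdef]
  have hper : ∀ k, v (k + N) = v k := by intro k; simp [hvdef]
  have hsn : ∀ j : ℕ, j < N → s j = P.shifts.getD j 0 := by
    intro j hj
    simp only [hsdef]
    rw [Int.emod_eq_of_lt (by omega) (by omega), Int.toNat_natCast]
  have hvert0 : P.vert N = P.vert 0 := by
    have : P.shifts.take N = P.shifts := by rw [← hlen]; exact List.take_length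
    rw [Polyline.vert, Polyline.vert, this, h.simpleClosed.1]; simp
  have hvn : ∀ j : ℕ, j ≤ N → TT (P.vert j) = v j := by
    intro j hj
    simp only [hvdef]
    rcases eq_or_lt_of_le hj with rfl | hj
    · rw [hvert0]; simp
    · rw [Int.emod_eq_of_lt (by omega) (by omega), Int.toNat_natCast]
  have hvs : ∀ j : ℕ, j < N → P.vert (j + 1) = P.vert j + P.shifts.getD j 0 := by
    intro j hj
    rw [Polyline.vert, Polyline.vert, List.sum_take_succ _ _ (by omega), add_assoc,
      List.getD_eq_getElem _ _ (by omega)]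
  have hd0 : ∀ j : ℕ, j < N → v (j + 1) - v j = TT (s j) := by
    intro j hj
    have e1 := hvn (j + 1) (by omega)
    push_cast at e1
    rw [← e1, ← hvn j hj.le, hvs j hj, map_add, hsn j hj]; ring
  have hd : ∀ k : ℤ, v (k + 1) - v k = TT (s k) := by
    intro k
    have k0 : 0 ≤ k % N := Int.emod_nonneg _ hN'.ne'
    have k1 := Int.emod_lt_of_pos k hN'
    have hk : k = k % N + k / N * N := by
      have := Int.emod_add_ediv_mul k N
      linarith
    have := hd0 (k % N).toNat (by omega)
    rw [Int.toNat_of_nonneg k0] at this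
    rw [hk, per_mul hper, per_mul hs, add_right_comm, per_mul hper, this]
  have hs0 : ∀ k, s k ≠ 0 := by
    intro k
    have k0 : 0 ≤ k % N := Int.emod_nonneg _ hN'.ne'
    have k1 := Int.emod_lt_of_pos k hN'
    simp only [hsdef]
    rw [List.getD_eq_getElem _ _ (by omega)]
    exact h.proper.2 _ (List.getElem_mem _)
  have hT0 : ∀ k, TT (s k) ≠ 0 := by intro k; simpa using hs0 k
  have hl : P.shifts = Lst s 0 N := by
    refine List.ext_getElem (by rw [Lst_length, hlen]) fun k h1 h2 => ?_
    rw [Lst_get, zero_add, hsn k (by omega), List.getD_eq_getElem _ _ h1]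
  obtain ⟨φ, -, harg, hturn⟩ := mk_phi (fun k => TT (s k)) hT0 _ (isArg_arg _)
  have hv : ∀ k, vangle (s k) (s (k + 1)) = φ (k + 1) - φ k := by
    intro k; rw [hturn, vangle_eq]
  have hrot := h.orient
  rw [rotClosed_eq hN hs hl hv] at hrot
  have hph : ∀ k, φ (k + N) = φ k + 2 * π := by
    have hstep : ∀ k, φ (k + 1 + N) - φ (k + 1) = φ (k + N) - φ k := by
      intro k
      have a1 := hv k
      have a2 := hv (k + N)
      rw [hs, add_right_comm, hs, a1] at a2
      linarith
    have : ∀ k, φ (k + N) - φ k = 2 * π := by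
      intro k
      induction k using Int.induction_on with
      | zero => rw [zero_add]; exact hrot
      | succ n ih => rw [hstep, ih]
      | pred n ih =>
        have := hstep (-n - 1)
        rw [sub_add_cancel] at this
        rw [← this, ih]
    intro k; linarith [this k]
  have hnr := h.nonReverse
  rw [take_one hN hs hl, nonrev_Lst] at hnr
  have hopp : ∀ k : ℤ, ¬ Opp (s k) (s (k + 1)) := by
    intro k
    have k0 : 0 ≤ k % N := Int.emod_nonneg _ hN'.ne'
    have k1 := Int.emod_lt_of_pos k hN'
    have hk : k = k % N + k / N * N := by
      have := Int.emod_add_ediv_mul k N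
      linarith
    have := hnr (k % N).toNat (by omega)
    rw [Int.toNat_of_nonneg k0] at this
    rw [hk, per_mul hs, add_right_comm, per_mul hs]
    exact this
  have hpg : ∀ t : ℝ, 0 ≤ t → t ≤ N → TT (P.param t) = gam v t := fun t h0 h1 =>
    param_gam hN hper hlen hvn (fun j hj => by rw [hd0 j hj, hsn j hj]) h0 h1
  refine ⟨N, v, φ, { pg := ⟨hN', hper, ?_, ?_, ?_⟩, comp := ?_, reg := image_reg h.regular, fr := ?_, phper := hph, aco := aco_of hN hs hl hv hα hph }⟩
  · have red : ∀ x : ℝ, ∃ m : ℤ, ∃ y ∈ Ico (0 : ℝ) N, x = y + m * N := by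
      intro x
      refine ⟨toIcoDiv hNr 0 x, toIcoMod hNr 0 x, ?_, ?_⟩
      · have := toIcoMod_mem_Ico hNr 0 x
        rwa [zero_add] at this
      · have := toIcoMod_add_toIcoDiv_zsmul hNr 0 x
        rw [zsmul_eq_mul] at this
        exact this.symm
    intro x y hxy
    obtain ⟨m, x', hx', rfl⟩ := red x
    obtain ⟨n, y', hy', rfl⟩ := red y
    have g1 := gam_per_mul hper x' m
    have g2 := gam_per_mul hper y' n
    simp only [Int.cast_natCast] at g1 g2
    rw [g1, g2, ← hpg _ hx'.1 hx'.2.le, ← hpg _ hy'.1 hy'.2.le] at hxy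
    have := h.simpleClosed.2 (by rw [hlen]; exact hx') (by rw [hlen]; exact hy') (TT.injective hxy)
    subst this
    refine ⟨n - m, ?_⟩
    push_cast; ring
  · intro k; rw [hd]; exact harg k
  · intro k
    rw [hturn, abs_lt]
    refine ⟨Complex.neg_pi_lt_arg _, lt_of_le_of_ne (Complex.arg_le_pi _) ?_⟩
    intro h0
    exact hopp k ((opp_iff (hs0 _) (hs0 _)).2 h0)
  · exact h.compact.image TT.continuous
  · rw [← image_fr, h.boundary, range_gam hN hper, Polyline.trace, hlen, image_image]
    exact image_congr fun t ht => hpg t ht.1 ht.2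

theorem of_gd {K : Set (ℝ × ℝ)} {M : ℤ} {v : ℤ → ℂ} {φ : ℤ → ℝ} {α : ℝ}
    (h : IsGd (TT '' K) M v φ α) :
    ∃ P, IsSimplePolygon K P ∧ -α ≤ acoClosed P.shifts := by
  obtain ⟨N, rfl⟩ : ∃ N : ℕ, M = N := ⟨M.toNat, by rw [Int.toNat_of_nonneg h.pg.hN.le]⟩
  have hN : 0 < N := by exact_mod_cast h.pg.hN
  obtain ⟨s, hsd⟩ : ∃ s : ℤ → ℝ × ℝ, ∀ k, TT (s k) = v (k + 1) - v k :=
    ⟨fun k => TT.symm (v (k + 1) - v k), fun k => by simp⟩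
  have hper := h.pg.per
  have hs : ∀ k, s (k + N) = s k := by
    intro k
    apply TT.injective
    rw [hsd, hsd, hper, add_right_comm, hper]
  have hs0 : ∀ k, s k ≠ 0 := by
    intro k h0
    have := hsd k
    rw [h0, map_zero] at this
    exact h.pg.edge_ne k this.symm
  have hv : ∀ k, vangle (s k) (s (k + 1)) = φ (k + 1) - φ k := by
    intro k; rw [h.pg.turn_eq, vangle_eq, hsd, hsd]
  obtain ⟨P, hP⟩ : ∃ P : Polyline, P = ⟨TT.symm (v 0), Lst s 0 N⟩ := ⟨_, rfl⟩
  have hl : P.shifts = Lst s 0 N := by rw [hP]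
  have hlen : P.shifts.length = N := by rw [hl, Lst_length]
  have hsn : ∀ j : ℕ, j < N → P.shifts.getD j 0 = s j := by
    intro j hj
    rw [List.getD_eq_getElem _ _ (by omega)]
    simp only [hl]
    rw [Lst_get, zero_add]
  have hvs : ∀ j : ℕ, j < N → P.vert (j + 1) = P.vert j + P.shifts.getD j 0 := by
    intro j hj
    rw [Polyline.vert, Polyline.vert, List.sum_take_succ _ _ (by omega), add_assoc,
      List.getD_eq_getElem _ _ (by omega)]
  have hvn : ∀ j : ℕ, j ≤ N → TT (P.vert j) = v j := by
    intro j
    induction j with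
    | zero => intro _; simp [Polyline.vert, hP]
    | succ j ih =>
      intro hj
      rw [hvs j (by omega), map_add, ih (by omega), hsn j (by omega), hsd]; push_cast; ring
  have hclosed : P.Closed := by
    have h1 := hvn N le_rfl
    have h2 := hvn 0 (by omega)
    have h3 := hper 0
    rw [zero_add] at h3
    rw [h3] at h1
    have h4 := TT.injective (h1.trans h2.symm)
    have : P.shifts.take N = P.shifts := by rw [← hlen]; exact List.take_length
    rw [Polyline.vert, Polyline.vert, this] at h4
    rw [Polyline.Closed]
    simpa using h4
  have hpg : ∀ t : ℝ, 0 ≤ t → t ≤ N → TT (P.param t) = gam v t := fun t h0 h1 =>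
    param_gam hN hper hlen hvn (fun j hj => by rw [hsn j hj, hsd]) h0 h1
  refine ⟨P, ⟨?_, reg_of_image h.reg, ⟨?_, ?_⟩, ?_, ⟨hclosed, ?_⟩, ?_, ?_⟩,
    aco_ge hs hl hv h.alpha_nonneg h.aco⟩
  · have := h.comp
    exact TT.toHomeomorph.isCompact_image.1 this
  · intro h0; rw [h0] at hlen; simp at hlen; omega
  · intro x hx
    rw [hl, Lst, List.mem_map] at hx
    obtain ⟨j, -, rfl⟩ := hx
    exact hs0 _
  · rw [take_one hN hs hl, nonrev_Lst]
    intro k hk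
    rw [opp_iff (hs0 _) (hs0 _), ← vangle_eq, hv]
    exact ne_of_lt (abs_lt.1 (h.pg.turn k)).2
  · rw [hlen]
    intro x hx y hy hxy
    have h1 := congrArg TT hxy
    rw [hpg x hx.1 hx.2.le, hpg y hy.1 hy.2.le] at h1
    obtain ⟨m, hm⟩ := h.pg.inj _ _ h1
    rw [Int.cast_natCast] at hm
    have hNr : (0 : ℝ) < N := by exact_mod_cast hN
    have c1 : (m : ℝ) < 1 := by
      by_contra hcon; push Not at hcon; nlinarith [hx.1, hy.2]
    have c2 : (-1 : ℝ) < m := by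
      by_contra hcon; push Not at hcon; nlinarith [hx.2, hy.1]
    have d1 : m < 1 := by exact_mod_cast c1
    have d2 : -1 < m := by exact_mod_cast c2
    have : m = 0 := by omega
    rw [this] at hm; simp at hm; exact hm.symm
  · apply TT.injective.image_injective
    rw [image_fr, h.fr, range_gam hN hper, Polyline.trace, hlen, image_image]
    exact image_congr fun t ht => (hpg t ht.1 ht.2).symm
  · rw [rotClosed_eq hN hs hl hv]
    have := h.phper 0
    rw [zero_add] at this
    linarith

theorem sum_gd {α : ℝ} (hα : α < π) : ∀ (n : ℕ) (K : Fin (n + 1) → Set (ℝ × ℝ)),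
    (∀ i, ∃ N v φ, IsGd (TT '' K i) N v φ α) → ∃ N v φ, IsGd (TT '' ∑ i, K i) N v φ α := by
  intro n
  induction n with
  | zero => intro K h; simpa using h 0
  | succ n ih =>
    intro K h
    rw [Fin.sum_univ_castSucc, Set.image_add]
    obtain ⟨N, v, φ, h1⟩ := ih (fun i => K i.castSucc) (fun i => h _)
    obtain ⟨M, w, χ, h2⟩ := h (Fin.last (n + 1))
    exact core hα h1 h2

end MS

/-- If `K₁, …, Kₙ` are simple polygons with `aco Kᵢ > -π` for every `i`, then
their Minkowski sum is a simple polygon and `aco (K₁ + ⋯ + Kₙ) ≥ min_i aco Kᵢ`. -/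
theorem minkowski_sum_many_simple_polygons (n : ℕ) (hn : 0 < n)
    (K : Fin n → Set (ℝ × ℝ)) (P : Fin n → Polyline)
    (hK : ∀ i, IsSimplePolygon (K i) (P i))
    (haco : ∀ i, -π < acoClosed (P i).shifts) :
    ∃ R : Polyline, IsSimplePolygon (∑ i, K i) R ∧
      (⨅ i, acoClosed (P i).shifts) ≤ acoClosed R.shifts := by
  obtain ⟨m, rfl⟩ : ∃ m, n = m + 1 := ⟨n - 1, by omega⟩
  obtain ⟨i0, hi0⟩ := exists_eq_ciInf_of_finite (f := fun i => acoClosed (P i).shifts)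
  have h0 := haco i0
  obtain ⟨N, v, φ, h⟩ := MS.sum_gd (α := -⨅ i, acoClosed (P i).shifts)
    (by rw [← hi0]; linarith) m K
    (fun i => MS.to_gd (hK i) (by
      rw [neg_neg]; exact ciInf_le (Set.finite_range _).bddBelow i))
  obtain ⟨R, hR, hle⟩ := MS.of_gd h
  exact ⟨R, hR, by rwa [neg_neg] at hle⟩
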